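/- Let f and g be rational maps on ℙ¹(ℂ) of degrees at least 2. Then the set Preper(f) ∩ Preper(g) is infinite if and only if Preper(f) = Preper(g). -/

import Mathlib

noncomputable section

open MvPolynomial

abbrev P1 : Type := Projectivization ℂ (Fin 2 → ℂ)

lemma vec_ne {p q : ℂ} (h : p ≠ 0 ∨ q ≠ 0) : ![p, q] ≠ 0 := by
  intro hz
  rcases h with h | h
  · exact h (by simpa using congrFun hz 0)
  · exact h (by simpa using congrFun hz 1)

/-- Evaluation at `v ∈ ℂ²` of the homogeneous degree-`d` form `∑ⱼ aⱼ Xʲ Y^(d-j)`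
whose coefficient tuple is `a`. -/
def homEval {d : ℕ} (a : Fin (d + 1) → ℂ) (v : Fin 2 → ℂ) : ℂ :=
  ∑ j : Fin (d + 1), a j * v 0 ^ (j : ℕ) * v 1 ^ (d - (j : ℕ))

/-- The pair of degree-`d` forms with coefficient tuples `a`, `b` has no common zero
in `ℂ² \ {0}`. -/
def GoodPair {d : ℕ} (a b : Fin (d + 1) → ℂ) : Prop :=
  ∀ v : Fin 2 → ℂ, v ≠ 0 → homEval a v ≠ 0 ∨ homEval b v ≠ 0

open Classical in
/-- The self-map of `ℙ¹(ℂ)` induced by the pair of degree-`d` forms with coefficient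
tuples `a`, `b` (defined arbitrarily where both forms vanish, which does not happen
for a `GoodPair`). -/
def ratFun {d : ℕ} (a b : Fin (d + 1) → ℂ) (x : P1) : P1 :=
  if h : homEval a x.rep ≠ 0 ∨ homEval b x.rep ≠ 0 then
    Projectivization.mk ℂ ![homEval a x.rep, homEval b x.rep] (vec_ne h)
  else x

/-- A rational map of degree `d` on `ℙ¹(ℂ)`: a pair of homogeneous degree-`d` forms
(recorded through their coefficient tuples) with no common zero in `ℂ² \ {0}`. -/
structure RatMap (d : ℕ) where
  a : Fin (d + 1) → ℂ
  b : Fin (d + 1) → ℂ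
  good : GoodPair a b

/-- The self-map of `ℙ¹(ℂ)` induced by a rational map. -/
def RatMap.toFun {d : ℕ} (f : RatMap d) : P1 → P1 := ratFun f.a f.b

/-- The set of preperiodic points of a rational map of degree `d` on `ℙ¹(ℂ)`. -/
def Preper {d : ℕ} (f : RatMap d) : Set P1 :=
  {x | ∃ n m : ℕ, m < n ∧ f.toFun^[n] x = f.toFun^[m] x}

/-- The point `[z : 1]` of `ℙ¹(ℂ)`. -/
def toP1 (z : ℂ) : P1 := Projectivization.mk ℂ ![z, 1] (vec_ne (Or.inr one_ne_zero))

/-- The point `∞ = [1 : 0]` of `ℙ¹(ℂ)`. -/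
def infty : P1 := Projectivization.mk ℂ ![1, 0] (vec_ne (Or.inl one_ne_zero))

/-- The Möbius transformation of `ℙ¹(ℂ)` induced by an invertible linear map of `ℂ²`. -/
def mobius (M : (Fin 2 → ℂ) ≃ₗ[ℂ] (Fin 2 → ℂ)) (x : P1) : P1 :=
  Projectivization.mk ℂ (M x.rep) (by
    simpa using (LinearEquiv.map_ne_zero_iff M).mpr x.rep_nonzero)

namespace BD

def wedge {B : Type*} [CommRing B] (x y : B × B) : B := x.1 * y.2 - x.2 * y.1

def ev {d : ℕ} {B : Type*} [CommRing B] (a : Fin (d + 1) → B) (x : B × B) : B :=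
  ∑ j : Fin (d + 1), a j * x.1 ^ (j : ℕ) * x.2 ^ (d - (j : ℕ))

def Fm {d : ℕ} {B : Type*} [CommRing B] (a b : Fin (d + 1) → B) (x : B × B) : B × B :=
  (ev a x, ev b x)

def mp {B C : Type*} [CommRing B] [CommRing C] (φ : B →+* C) (x : B × B) : C × C := (φ x.1, φ x.2)

section alg
variable {B C : Type*} [CommRing B] [CommRing C] {d : ℕ}

lemma ev_map (φ : B →+* C) (a : Fin (d + 1) → B) (x : B × B) :
    φ (ev a x) = ev (φ ∘ a) (mp φ x) := by
  simp [ev, mp, map_sum]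

lemma Fm_map (φ : B →+* C) (a b : Fin (d + 1) → B) (x : B × B) :
    mp φ (Fm a b x) = Fm (φ ∘ a) (φ ∘ b) (mp φ x) := by
  simp only [Fm, ← ev_map]; rfl

lemma Fm_iter_map (φ : B →+* C) (a b : Fin (d + 1) → B) (n : ℕ) (x : B × B) :
    mp φ ((Fm a b)^[n] x) = (Fm (φ ∘ a) (φ ∘ b))^[n] (mp φ x) := by
  induction n generalizing x with
  | zero => rfl
  | succ n ih => rw [Function.iterate_succ_apply, Function.iterate_succ_apply, ih, Fm_map]

lemma wedge_map (φ : B →+* C) (x y : B × B) : φ (wedge x y) = wedge (mp φ x) (mp φ y) := by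
  simp [wedge, mp]

lemma mp_smul (φ : B →+* C) (c : B) (x : B × B) : mp φ (c • x) = φ c • mp φ x := by
  simp [mp, Prod.smul_mk]

lemma mp_inj {φ : B →+* C} (h : Function.Injective φ) : Function.Injective (mp φ) := by
  intro x y hxy
  simp only [mp, Prod.mk.injEq] at hxy
  exact Prod.ext (h hxy.1) (h hxy.2)

lemma mp_zero (φ : B →+* C) : mp φ 0 = 0 := by simp [mp]

lemma ev_smul (a : Fin (d + 1) → B) (c : B) (x : B × B) : ev a (c • x) = c ^ d * ev a x := by
  rw [ev, ev, Finset.mul_sum]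
  refine Finset.sum_congr rfl fun j _ => ?_
  have : c ^ d = c ^ (j : ℕ) * c ^ (d - (j : ℕ)) := by
    rw [← pow_add]; congr 1; omega
  rw [this]
  simp only [Prod.smul_fst, Prod.smul_snd, smul_eq_mul, mul_pow]
  ring

lemma Fm_smul (a b : Fin (d + 1) → B) (c : B) (x : B × B) : Fm a b (c • x) = c ^ d • Fm a b x := by
  simp [Fm, ev_smul]

lemma Fm_iter_smul (a b : Fin (d + 1) → B) (c : B) (n : ℕ) (x : B × B) :
    (Fm a b)^[n] (c • x) = c ^ (d ^ n) • (Fm a b)^[n] x := by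
  induction n generalizing x c with
  | zero => simp
  | succ n ih =>
    rw [Function.iterate_succ_apply, Function.iterate_succ_apply, Fm_smul, ih, ← pow_mul]
    congr 2; ring

lemma wedge_smul_left (c : B) (x y : B × B) : wedge (c • x) y = c * wedge x y := by
  simp [wedge]; ring
lemma wedge_smul_right (c : B) (x y : B × B) : wedge x (c • y) = c * wedge x y := by
  simp [wedge]; ring
lemma wedge_self (x : B × B) : wedge x x = 0 := by simp [wedge]; ring
lemma wedge_swap (x y : B × B) : wedge x y = - wedge y x := by simp [wedge]; ring

end alg

section fld
variable {k : Type*} [Field k] {d : ℕ}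

lemma prop_of_wedge {x y : k × k} (hy : y ≠ 0) (h : wedge x y = 0) : ∃ c : k, x = c • y := by
  simp only [wedge] at h
  by_cases h1 : y.1 = 0
  · have h2 : y.2 ≠ 0 := fun h2 => hy (Prod.ext h1 h2)
    refine ⟨x.2 / y.2, Prod.ext ?_ ?_⟩
    · simp [h1] at h ⊢; tauto
    · simp; field_simp
  · refine ⟨x.1 / y.1, Prod.ext ?_ ?_⟩
    · simp; field_simp
    · simp; field_simp; linear_combination -h

lemma wedge_trans {x y z : k × k} (hy : y ≠ 0) (h : wedge x y = 0) (h' : wedge y z = 0) :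
    wedge x z = 0 := by
  obtain ⟨c, rfl⟩ := prop_of_wedge hy h
  rw [wedge_smul_left, h', mul_zero]

/-- homogeneous Bezout identities -/
structure Bez {B : Type*} [CommRing B] {q d : ℕ} (a b : Fin (d + 1) → B)
    (u v u' v' : Fin (q + 1) → B) (S : B) : Prop where
  h1 : ∀ x : B × B, ev u x * ev a x + ev v x * ev b x = S * x.2 ^ (q + d)
  h2 : ∀ x : B × B, ev u' x * ev a x + ev v' x * ev b x = S * x.1 ^ (q + d)

def NZ (a b : Fin (d + 1) → k) : Prop := ∀ x : k × k, x ≠ 0 → Fm a b x ≠ 0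

lemma Bez.nz {q : ℕ} {a b : Fin (d + 1) → k} {u v u' v' : Fin (q + 1) → k} {S : k}
    (h : Bez a b u v u' v' S) (hS : S ≠ 0) : NZ a b := by
  intro x hx h0
  simp only [Fm, Prod.mk_eq_zero] at h0
  have e1 := h.h1 x
  have e2 := h.h2 x
  rw [h0.1, h0.2] at e1 e2
  simp only [mul_zero, add_zero] at e1 e2
  have := (mul_eq_zero.1 e1.symm).resolve_left hS
  have h2 := (mul_eq_zero.1 e2.symm).resolve_left hS
  exact hx (Prod.ext (eq_zero_of_pow_eq_zero h2) (eq_zero_of_pow_eq_zero this))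

lemma NZ.iter {a b : Fin (d + 1) → k} (h : NZ a b) (n : ℕ) {x : k × k} (hx : x ≠ 0) :
    (Fm a b)^[n] x ≠ 0 := by
  induction n with
  | zero => exact hx
  | succ n ih => rw [Function.iterate_succ_apply']; exact h _ ih

lemma ev_snd_zero (a : Fin (d + 1) → k) (s : k) : ev a (s, 0) = a (Fin.last d) * s ^ d := by
  rw [ev, Fin.sum_univ_castSucc, Finset.sum_eq_zero]
  · simp
  · intro j _
    have : d - (j : ℕ) ≠ 0 := by omega
    simp [this]

lemma exists_zero_form [IsAlgClosed k] (hd : 1 ≤ d) (a : Fin (d + 1) → k) :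
    ∃ x : k × k, x ≠ 0 ∧ ev a x = 0 := by
  by_cases h : a (Fin.last d) = 0
  · exact ⟨(1, 0), by simp, by rw [ev_snd_zero, h]; simp⟩
  · let P : Polynomial k := ∑ j : Fin (d + 1), Polynomial.C (a j) * Polynomial.X ^ (j : ℕ)
    have hc : P.coeff d = a (Fin.last d) := by
      simp only [P, Polynomial.finsetSum_coeff, Polynomial.coeff_C_mul, Polynomial.coeff_X_pow]
      rw [Finset.sum_eq_single (Fin.last d)]
      · simp
      · intro j _ hj
        have : d ≠ (j : ℕ) := fun e => hj (Fin.ext (by simp [← e]))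
        simp [this]
      · simp
    have hdeg : P.degree ≠ 0 := by
      intro h0
      have : P.coeff d = 0 := Polynomial.coeff_eq_zero_of_degree_lt (by
        rw [h0]; exact_mod_cast hd)
      exact h (hc ▸ this)
    obtain ⟨r, hr⟩ := IsAlgClosed.exists_root P hdeg
    refine ⟨(r, 1), by simp, ?_⟩
    rw [Polynomial.IsRoot.def] at hr
    simpa [P, ev, Polynomial.eval_finsetSum] using hr

lemma wedge_Fm (a b : Fin (d + 1) → k) (x z : k × k) :
    wedge (Fm a b x) z = ev (fun j => a j * z.2 - b j * z.1) x := by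
  simp only [wedge, Fm, ev, Finset.sum_mul, ← Finset.sum_sub_distrib]
  exact Finset.sum_congr rfl fun j _ => by ring

lemma surj_iter [IsAlgClosed k] (hd : 1 ≤ d) {a b : Fin (d + 1) → k}
    (n : ℕ) (z : k × k) (hz : z ≠ 0) : ∃ x : k × k, x ≠ 0 ∧ wedge ((Fm a b)^[n] x) z = 0 := by
  induction n generalizing z with
  | zero => exact ⟨z, hz, wedge_self z⟩
  | succ n ih =>
    obtain ⟨w, hw, hwz⟩ := exists_zero_form hd (fun j => a j * z.2 - b j * z.1)
    rw [← wedge_Fm] at hwz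
    obtain ⟨x, hx, hxw⟩ := ih w hw
    refine ⟨x, hx, ?_⟩
    obtain ⟨c, hc⟩ := prop_of_wedge hw hxw
    rw [Function.iterate_succ_apply', hc, Fm_smul, wedge_smul_left, hwz, mul_zero]

def dg (D : ℕ) (p : Polynomial k × Polynomial k) : Prop := p.1.natDegree ≤ D ∧ p.2.natDegree ≤ D

lemma ev_natDegree {D : ℕ} (a : Fin (d + 1) → k) (p : Polynomial k × Polynomial k) (h : dg D p) :
    (ev (Polynomial.C ∘ a) p).natDegree ≤ d * D := by
  refine Polynomial.natDegree_sum_le_of_forall_le _ _ fun j _ => ?_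
  have hj : (j : ℕ) + (d - j) = d := by omega
  calc _ ≤ (Polynomial.natDegree (((Polynomial.C ∘ a) j) * p.1 ^ (j : ℕ))) +
          (p.2 ^ (d - (j : ℕ))).natDegree := Polynomial.natDegree_mul_le
    _ ≤ (0 + j * D) + (d - j) * D := by
        refine add_le_add (Polynomial.natDegree_mul_le.trans (add_le_add ?_ ?_)) ?_
        · simp
        · exact Polynomial.natDegree_pow_le.trans (Nat.mul_le_mul_left _ h.1)
        · exact Polynomial.natDegree_pow_le.trans (Nat.mul_le_mul_left _ h.2)
    _ = d * D := by rw [zero_add, ← add_mul, hj]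

lemma Fm_iter_natDegree (a b : Fin (d + 1) → k) (n : ℕ) :
    dg (d ^ n) ((Fm (Polynomial.C ∘ a) (Polynomial.C ∘ b))^[n] (Polynomial.X, 1)) := by
  induction n with
  | zero => simp [dg]
  | succ n ih =>
    rw [Function.iterate_succ_apply', pow_succ']
    exact ⟨ev_natDegree a _ ih, ev_natDegree b _ ih⟩

end fld

lemma comp_C {k B : Type*} [CommRing k] [CommRing B] {d : ℕ} (φ : k →+* B) (a : Fin (d + 1) → k)
    {A : Type*} [CommRing A] (θ : A →+* B) (ι : k →+* A) (h : θ.comp ι = φ) :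
    (θ ∘ (ι ∘ a)) = φ ∘ a := by
  subst h; rfl

theorem factor {k : Type} [Field k] [IsAlgClosed k] {d : ℕ} (hd : 1 ≤ d) (a b : Fin (d + 1) → k)
    (hnz : NZ a b) (n : ℕ) (z : k × k) (hz : z ≠ 0) :
    ∃ W : Fin (d ^ n) → k × k, (∀ i, W i ≠ 0) ∧
      ∀ (B : Type) [CommRing B] (φ : k →+* B) (x : B × B),
        wedge ((Fm (φ ∘ a) (φ ∘ b))^[n] x) (mp φ z) = ∏ i, wedge x (mp φ (W i)) := by
  classical
  set p : Polynomial k :=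
    wedge ((Fm (Polynomial.C ∘ a) (Polynomial.C ∘ b))^[n] (Polynomial.X, 1)) (mp Polynomial.C z)
    with hp
  set D := d ^ n with hD
  -- generic point
  let X0 : MvPolynomial (Fin 2) k := MvPolynomial.X 0
  let X1 : MvPolynomial (Fin 2) k := MvPolynomial.X 1
  let ι : MvPolynomial (Fin 2) k →+* FractionRing (MvPolynomial (Fin 2) k) := algebraMap _ _
  have hι : Function.Injective ι := IsFractionRing.injective _ _
  let c2 : k →+* FractionRing (MvPolynomial (Fin 2) k) := ι.comp MvPolynomial.C
  have hX1 : ι X1 ≠ 0 := by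
    intro h
    exact MvPolynomial.X_ne_zero (R := k) (1 : Fin 2) (hι (by simpa using h))
  let t : FractionRing (MvPolynomial (Fin 2) k) := ι X0 / ι X1
  let θ : Polynomial k →+* FractionRing (MvPolynomial (Fin 2) k) := Polynomial.eval₂RingHom c2 t
  have hθC : θ.comp Polynomial.C = c2 := by ext; simp [θ]
  have key : ι (wedge ((Fm (MvPolynomial.C ∘ a) (MvPolynomial.C ∘ b))^[n] (X0, X1))
      (mp MvPolynomial.C z)) = ι X1 ^ D * θ p := by
    rw [wedge_map, Fm_iter_map, hp, wedge_map, Fm_iter_map]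
    rw [comp_C c2 a θ Polynomial.C hθC, comp_C c2 b θ Polynomial.C hθC,
      comp_C c2 a ι MvPolynomial.C rfl, comp_C c2 b ι MvPolynomial.C rfl]
    have e1 : mp ι (X0, X1) = ι X1 • mp θ (Polynomial.X, 1) := by
      refine Prod.ext ?_ ?_
      · simp [mp, θ, t, mul_div_cancel₀ _ hX1]
      · simp [mp]
    have e2 : mp θ (mp Polynomial.C z) = mp ι (mp MvPolynomial.C z) := by
      simp [mp, θ, c2]
    rw [e1, Fm_iter_smul, wedge_smul_left, e2]
  have hp0 : p ≠ 0 := by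
    intro h0
    rw [h0, map_zero, mul_zero] at key
    have k0 := hι (key.trans (map_zero ι).symm)
    have all : ∀ x : k × k, wedge ((Fm a b)^[n] x) z = 0 := by
      intro x
      let E : MvPolynomial (Fin 2) k →+* k := MvPolynomial.eval ![x.1, x.2]
      have := congrArg E k0
      rw [wedge_map, Fm_iter_map, map_zero,
        comp_C (RingHom.id k) a E MvPolynomial.C (by ext; simp [E]),
        comp_C (RingHom.id k) b E MvPolynomial.C (by ext; simp [E])] at this
      have e1 : mp E (X0, X1) = x := by simp [mp, E, X0, X1]
      have e2 : mp E (mp MvPolynomial.C z) = z := by simp [mp, E]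
      rw [e1, e2] at this
      exact this
    obtain ⟨z', hz', hzz⟩ : ∃ z' : k × k, z' ≠ 0 ∧ wedge z z' ≠ 0 := by
      by_cases h1 : z.1 = 0
      · have h2 : z.2 ≠ 0 := fun h2 => hz (Prod.ext h1 h2)
        exact ⟨(1, 0), by simp, by simp [wedge, h2]⟩
      · exact ⟨(0, 1), by simp, by simp [wedge, h1]⟩
    obtain ⟨x, hx, hxz⟩ := surj_iter (a := a) (b := b) hd n z' hz'
    have h3 := all x
    rw [wedge_swap] at h3
    exact hzz (wedge_trans (hnz.iter n hx) (neg_eq_zero.1 h3) hxz)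
  have hpd : p.natDegree ≤ D := by
    have := Fm_iter_natDegree a b n
    refine (Polynomial.natDegree_sub_le _ _).trans (max_le ?_ ?_)
    · exact Polynomial.natDegree_mul_le.trans (by simpa [mp] using this.1)
    · exact Polynomial.natDegree_mul_le.trans (by simpa [mp] using this.2)
  have hspl := IsAlgClosed.splits p
  have hcard : p.roots.card = p.natDegree := hspl.natDegree_eq_card_roots.symm
  have hfac := hspl.eq_prod_roots
  have hDpos : 0 < D := Nat.pow_pos hd
  obtain ⟨γ, hγ⟩ := IsAlgClosed.exists_pow_nat_eq p.leadingCoeff hDpos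
  have hγ0 : γ ≠ 0 := by
    rintro rfl
    rw [zero_pow hDpos.ne'] at hγ
    exact hp0 (Polynomial.leadingCoeff_eq_zero.1 hγ.symm)
  let l : List (k × k) := (p.roots.toList.map fun r => (r, (1 : k))) ++
    List.replicate (D - p.natDegree) ((-1 : k), (0 : k))
  have hl : l.length = D := by
    simp [l, hcard]; omega
  have hl0 : ∀ w ∈ l, w ≠ 0 := by
    intro w hw
    simp only [l, List.mem_append, List.mem_map, List.mem_replicate] at hw
    rcases hw with ⟨r, _, rfl⟩ | ⟨_, rfl⟩ <;> simp
  have prodl : ∀ (B : Type) [CommRing B] (φ : k →+* B) (x : B × B),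
      ∏ i : Fin D, wedge x (mp φ (γ • l.get (i.cast hl.symm))) =
      φ p.leadingCoeff * (p.roots.toList.map fun r => x.1 - x.2 * φ r).prod *
        x.2 ^ (D - p.natDegree) := by
    intro B _ φ x
    have e0 : ∀ w : k × k, wedge x (mp φ (γ • w)) = φ γ * wedge x (mp φ w) := by
      intro w; rw [mp_smul, wedge_smul_right]
    simp only [e0]
    rw [Finset.prod_mul_distrib, Finset.prod_const, Finset.card_univ, Fintype.card_fin, ← map_pow, hγ]
    have e1 : ∏ i : Fin D, wedge x (mp φ (l.get (i.cast hl.symm))) =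
        (l.map fun w => wedge x (mp φ w)).prod := by
      rw [← List.prod_ofFn]
      congr 1
      apply List.ext_get
      · simp [hl]
      · intro i h1 h2
        simp
    rw [e1]
    simp only [l, List.map_append, List.prod_append, List.map_map, List.map_replicate,
      List.prod_replicate]
    rw [mul_assoc]
    congr 2
    · congr 1
      apply List.map_congr_left
      intro r _
      simp [wedge, mp]
    · congr 1; simp [wedge, mp]
  refine ⟨fun i => γ • l.get (i.cast hl.symm), ?_, ?_⟩
  · intro i
    exact smul_ne_zero hγ0 (hl0 _ (List.get_mem _ _))
  · have gen : wedge ((Fm (MvPolynomial.C ∘ a) (MvPolynomial.C ∘ b))^[n] (X0, X1))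
      (mp MvPolynomial.C z) = MvPolynomial.C p.leadingCoeff *
        (p.roots.toList.map fun r => X0 - X1 * MvPolynomial.C r).prod *
        X1 ^ (D - p.natDegree) := by
      apply hι
      rw [key]
      conv_lhs => rw [hfac]
      have hDs : ι X1 ^ D = ι X1 ^ p.natDegree * ι X1 ^ (D - p.natDegree) := by
        rw [← pow_add]; congr 1; omega
      rw [map_mul, map_mul, map_mul, hDs, map_pow]
      have e3 : θ (Polynomial.C p.leadingCoeff) = ι (MvPolynomial.C p.leadingCoeff) := by
        simp [θ, c2]
      have e4 : ι X1 ^ p.natDegree * θ (p.roots.map fun a => Polynomial.X - Polynomial.C a).prod =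
          ι (p.roots.toList.map fun r => X0 - X1 * MvPolynomial.C r).prod := by
        have : (p.roots.map fun a => Polynomial.X - Polynomial.C a).prod =
            (p.roots.toList.map fun a => Polynomial.X - Polynomial.C a).prod := by
          conv_lhs => rw [← Multiset.coe_toList p.roots]
          rw [Multiset.map_coe, Multiset.prod_coe]
        rw [this, ← hcard, ← Multiset.length_toList]
        generalize p.roots.toList = L
        induction L with
        | nil => simp
        | cons r L ih =>
          rw [List.map_cons, List.map_cons, List.prod_cons, List.prod_cons, map_mul, map_mul, ← ih,
            List.length_cons, pow_succ]
          have : ι (X0 - X1 * MvPolynomial.C r) = ι X1 * θ (Polynomial.X - Polynomial.C r) := by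
            simp [θ, c2, t, mul_sub, mul_div_cancel₀ _ hX1]
          rw [this]; ring
      rw [e3, ← e4]; ring
    intro B _ φ x
    rw [prodl]
    let E : MvPolynomial (Fin 2) k →+* B := MvPolynomial.eval₂Hom φ ![x.1, x.2]
    have h1 := congrArg E gen
    rw [wedge_map, Fm_iter_map,
      comp_C φ a E MvPolynomial.C (by ext; simp [E]),
      comp_C φ b E MvPolynomial.C (by ext; simp [E])] at h1
    have e1 : mp E (X0, X1) = x := by simp [mp, E, X0, X1]
    have e2 : mp E (mp MvPolynomial.C z) = mp φ z := by simp [mp, E]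
    rw [e1, e2] at h1
    rw [h1, map_mul, map_mul, map_pow, map_list_prod, List.map_map]
    congr 2
    · simp [E]
    · congr 2
      funext r
      simp [E, X0, X1]
    · simp [E, X1]

end BD

namespace BD

section loc
variable {k : Type} [Field k]

def mx (av : AbsoluteValue k ℝ) (x : k × k) : ℝ := max (av x.1) (av x.2)

structure LN (av : AbsoluteValue k ℝ) (κ : ℝ) (nm : Polynomial k → ℝ) : Prop where
  one_le : 1 ≤ κ
  nn : ∀ p, 0 ≤ nm p
  add : ∀ p q, nm (p + q) ≤ κ * max (nm p) (nm q)
  mul : ∀ p q, nm (p * q) ≤ nm p * nm q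
  nC : ∀ c, nm (Polynomial.C c) = av c
  nX : nm Polynomial.X ≤ 1
  prod : ∀ (D : ℕ) (α β : Fin D → k), ∏ i, max (av (α i)) (av (β i)) ≤
    nm (∏ i, (Polynomial.C (α i) + Polynomial.C (β i) * Polynomial.X))

def pm (nm : Polynomial k → ℝ) (p : Polynomial k × Polynomial k) : ℝ := max (nm p.1) (nm p.2)

variable {av : AbsoluteValue k ℝ} {κ : ℝ} {nm : Polynomial k → ℝ} {d : ℕ}

lemma mx_nonneg (x : k × k) : 0 ≤ mx av x := (av.nonneg _).trans (le_max_left _ _)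
lemma mx_pos {x : k × k} (hx : x ≠ 0) : 0 < mx av x := by
  rcases (mx_nonneg (av := av) x).lt_or_eq with h | h
  · exact h
  · exfalso; apply hx
    have h1 : av x.1 ≤ 0 := h ▸ le_max_left _ _
    have h2 : av x.2 ≤ 0 := h ▸ le_max_right _ _
    exact Prod.ext (av.eq_zero.1 (le_antisymm h1 (av.nonneg _)))
      (av.eq_zero.1 (le_antisymm h2 (av.nonneg _)))

section
variable (H : LN av κ nm)
include H
lemma LN.zero : nm 0 = 0 := by rw [← Polynomial.C_0, H.nC]; simp
lemma LN.one : nm 1 = 1 := by rw [← Polynomial.C_1, H.nC]; simp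
lemma LN.pow (p : Polynomial k) (n : ℕ) : nm (p ^ n) ≤ nm p ^ n := by
  induction n with
  | zero => simp [H.one]
  | succ n ih => rw [pow_succ, pow_succ]; exact (H.mul _ _).trans (by gcongr; exact H.nn _)
lemma LN.neg (p : Polynomial k) : nm (-p) ≤ nm p := by
  have : -p = Polynomial.C (-1) * p := by simp
  rw [this]; refine (H.mul _ _).trans ?_; rw [H.nC]; simp
lemma LN.sub (p q : Polynomial k) : nm (p - q) ≤ κ * max (nm p) (nm q) := by
  rw [sub_eq_add_neg]
  refine (H.add _ _).trans ?_
  have := H.one_le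
  gcongr; exact H.neg q
lemma LN.powle {p : Polynomial k} {R : ℝ} (h : nm p ≤ R) (n : ℕ) : nm (p ^ n) ≤ R ^ n :=
  (H.pow p n).trans (pow_le_pow_left₀ (H.nn _) h n)

lemma LN.sum_le {n : ℕ} (f : Fin n → Polynomial k) {M : ℝ} (hM : 0 ≤ M) (h : ∀ j, nm (f j) ≤ M) :
    nm (∑ j, f j) ≤ κ ^ n * M := by
  induction n with
  | zero => simpa [H.zero] using hM
  | succ n ih =>
    rw [Fin.sum_univ_succ]
    refine (H.add _ _).trans ?_
    have h1 := ih (fun j => f j.succ) (fun j => h _)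
    have k1 := H.one_le
    have : M ≤ κ ^ n * M := le_mul_of_one_le_left hM (one_le_pow₀ k1)
    rw [pow_succ', mul_assoc]
    gcongr
    exact max_le ((h 0).trans this) h1

lemma LN.ev_le {a : Fin (d + 1) → k} {p : Polynomial k × Polynomial k} {R A : ℝ}
    (hR : pm nm p ≤ R) (hA : ∀ j, av (a j) ≤ A) :
    nm (ev (Polynomial.C ∘ a) p) ≤ κ ^ (d + 1) * (A * R ^ d) := by
  have hR0 : 0 ≤ R := (H.nn p.1).trans ((le_max_left _ _).trans hR)
  have hA0 : 0 ≤ A := (av.nonneg _).trans (hA 0)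
  refine H.sum_le _ (by positivity) fun j => ?_
  have hj : R ^ d = R ^ (j : ℕ) * R ^ (d - (j : ℕ)) := by rw [← pow_add]; congr 1; omega
  rw [hj, ← mul_assoc]
  refine (H.mul _ _).trans (mul_le_mul ((H.mul _ _).trans (mul_le_mul ?_ ?_ (H.nn _) hA0)) ?_ (H.nn _) (by positivity))
  · simpa [H.nC] using hA j
  · exact H.powle ((le_max_left _ _).trans hR) _
  · exact H.powle ((le_max_right _ _).trans hR) _

lemma LN.ev_le' {a : Fin (d + 1) → k} {x : k × k} {R A : ℝ}
    (hR : mx av x ≤ R) (hA : ∀ j, av (a j) ≤ A) :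
    av (ev a x) ≤ κ ^ (d + 1) * (A * R ^ d) := by
  have := H.ev_le (a := a) (p := mp Polynomial.C x) (R := R) (by simpa [pm, mp, H.nC, mx] using hR) hA
  rwa [← ev_map, H.nC] at this

lemma LN.pow_diff {u u' : Polynomial k} {R τ : ℝ} (hτ0 : 0 ≤ τ)
    (hu : nm u ≤ R) (hu' : nm u' ≤ κ * R) (h : nm (u' - u) ≤ τ * R) (i : ℕ) :
    nm (u' ^ i - u ^ i) ≤ κ ^ (2 * i) * (τ * R ^ i) := by
  have hR0 : 0 ≤ R := (H.nn u).trans hu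
  have k1 := H.one_le
  induction i with
  | zero => simpa [H.zero] using hτ0
  | succ i ih =>
    have e : u' ^ (i + 1) - u ^ (i + 1) = (u' ^ i - u ^ i) * u' + u ^ i * (u' - u) := by ring
    rw [e]
    refine (H.add _ _).trans ?_
    have e2 : κ ^ (2 * (i + 1)) * (τ * R ^ (i + 1)) =
      κ * ((κ ^ (2 * i) * (τ * R ^ i)) * (κ * R)) := by ring
    rw [e2]
    gcongr
    refine max_le ((H.mul _ _).trans (mul_le_mul ih hu' (H.nn _) (by positivity))) ?_
    refine (H.mul _ _).trans ((mul_le_mul (H.powle hu i) h (H.nn _) (by positivity)).trans ?_)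
    have e3 : R ^ i * (τ * R) = 1 * (τ * R ^ i) * (1 * R) := by ring
    rw [e3]; gcongr
    exact one_le_pow₀ k1

lemma LN.ev_diff {a : Fin (d + 1) → k} {p p' : Polynomial k × Polynomial k} {R τ A : ℝ}
    (hτ0 : 0 ≤ τ) (hτ : τ ≤ 1) (hp : pm nm p ≤ R) (h : pm nm (p' - p) ≤ τ * R)
    (hA : ∀ j, av (a j) ≤ A) :
    nm (ev (Polynomial.C ∘ a) p' - ev (Polynomial.C ∘ a) p) ≤ κ ^ (3 * d + 2) * A * (τ * R ^ d) := by
  have hR0 : 0 ≤ R := (H.nn p.1).trans ((le_max_left _ _).trans hp)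
  have hA0 : 0 ≤ A := (av.nonneg _).trans (hA 0)
  have k1 := H.one_le
  have h1 : nm (p'.1 - p.1) ≤ τ * R := (le_max_left _ _).trans h
  have h2 : nm (p'.2 - p.2) ≤ τ * R := (le_max_right _ _).trans h
  have g1 : nm p.1 ≤ R := (le_max_left _ _).trans hp
  have g2 : nm p.2 ≤ R := (le_max_right _ _).trans hp
  have hτR : τ * R ≤ R := mul_le_of_le_one_left hR0 hτ
  have q1 : nm p'.1 ≤ κ * R := by
    have : p'.1 = p.1 + (p'.1 - p.1) := by ring
    rw [this]; refine (H.add _ _).trans ?_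
    gcongr; exact max_le g1 (h1.trans hτR)
  have q2 : nm p'.2 ≤ κ * R := by
    have : p'.2 = p.2 + (p'.2 - p.2) := by ring
    rw [this]; refine (H.add _ _).trans ?_
    gcongr; exact max_le g2 (h2.trans hτR)
  rw [ev, ev, ← Finset.sum_sub_distrib]
  have e : κ ^ (3 * d + 2) * A * (τ * R ^ d) = κ ^ (d + 1) * (A * (κ * (κ ^ (2 * d) * (τ * R ^ d)))) := by
    ring
  rw [e]
  refine H.sum_le _ (by positivity) fun j => ?_
  have hj : R ^ d = R ^ (j : ℕ) * R ^ (d - (j : ℕ)) := by rw [← pow_add]; congr 1; omega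
  have e1 : (Polynomial.C ∘ a) j * p'.1 ^ (j : ℕ) * p'.2 ^ (d - (j : ℕ)) -
      (Polynomial.C ∘ a) j * p.1 ^ (j : ℕ) * p.2 ^ (d - (j : ℕ)) =
      Polynomial.C (a j) * ((p'.1 ^ (j : ℕ) - p.1 ^ (j : ℕ)) * p'.2 ^ (d - (j : ℕ)) +
        p.1 ^ (j : ℕ) * (p'.2 ^ (d - (j : ℕ)) - p.2 ^ (d - (j : ℕ)))) := by
    simp only [Function.comp]; ring
  rw [e1]
  refine (H.mul _ _).trans (mul_le_mul (by rw [H.nC]; exact hA j) ?_ (H.nn _) hA0)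
  refine (H.add _ _).trans ?_
  gcongr
  refine max_le ?_ ?_
  · refine (H.mul _ _).trans ((mul_le_mul (H.pow_diff hτ0 g1 q1 h1 j) (H.powle q2 _) (H.nn _) (by positivity)).trans ?_)
    have : κ ^ (2 * (j : ℕ)) * (τ * R ^ (j : ℕ)) * (κ * R) ^ (d - (j : ℕ)) =
      κ ^ (2 * (j : ℕ) + (d - j)) * (τ * R ^ d) := by rw [hj]; ring
    rw [this]; gcongr; omega
  · refine (H.mul _ _).trans ((mul_le_mul (H.powle g1 _) (H.pow_diff hτ0 g2 q2 h2 _) (H.nn _) (by positivity)).trans ?_)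
    have : R ^ (j : ℕ) * (κ ^ (2 * (d - (j : ℕ))) * (τ * R ^ (d - (j : ℕ)))) =
      κ ^ (2 * (d - j)) * (τ * R ^ d) := by rw [hj]; ring
    rw [this]; gcongr; omega
end

structure LF (av : AbsoluteValue k ℝ) (κ E : ℝ) (a b : Fin (d + 1) → k) : Prop where
  kE : κ ≤ E
  ua : ∀ j, κ ^ (3 * d + 2) * av (a j) ≤ E
  ub : ∀ j, κ ^ (3 * d + 2) * av (b j) ≤ E
  low : ∀ x, κ ^ d * mx av x ^ d ≤ E * mx av (Fm a b x)

lemma LF.of_bez (H : LN av κ nm) {q : ℕ} {a b : Fin (d + 1) → k} {u v u' v' : Fin (q + 1) → k}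
    {S : k} (hS : S ≠ 0) (hb : Bez a b u v u' v' S) {A E : ℝ} (kE : κ ≤ E)
    (ua : ∀ j, κ ^ (3 * d + 2) * av (a j) ≤ E) (ub : ∀ j, κ ^ (3 * d + 2) * av (b j) ≤ E)
    (hu : ∀ j, av (u j) ≤ A) (hv : ∀ j, av (v j) ≤ A) (hu' : ∀ j, av (u' j) ≤ A)
    (hv' : ∀ j, av (v' j) ≤ A) (hA : κ ^ (q + d + 2) * A ≤ E * av S) (hd : 1 ≤ d) : LF av κ E a b := by
  refine ⟨kE, ua, ub, fun x => ?_⟩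
  have k1 := H.one_le
  by_cases hx : x = 0
  · subst hx
    have : mx av (0 : k × k) = 0 := by simp [mx]
    rw [this, zero_pow (by omega), mul_zero]
    exact mul_nonneg (by linarith) (mx_nonneg _)
  have hR := mx_pos (av := av) hx
  have hSp : 0 < av S := av.pos hS
  set R := mx av x with hRdef
  set M := mx av (Fm a b x) with hM
  have hM0 : 0 ≤ M := mx_nonneg _
  have main : ∀ (u v : Fin (q + 1) → k) (c : k), av c = R → (∀ j, av (u j) ≤ A) →
      (∀ j, av (v j) ≤ A) → ev u x * ev a x + ev v x * ev b x = S * c ^ (q + d) →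
      κ ^ d * R ^ d ≤ E * M := by
    intro u v c hc hu hv he
    have h1 := H.add (Polynomial.C (ev u x * ev a x)) (Polynomial.C (ev v x * ev b x))
    rw [← Polynomial.C_add, H.nC, H.nC, H.nC, he, av.map_mul, av.map_mul, av.map_mul, av.map_pow, hc] at h1
    have f1 : av (ev u x) * av (ev a x) ≤ κ ^ (q + 1) * (A * R ^ q) * M :=
      mul_le_mul (H.ev_le' le_rfl hu) (le_max_left _ _) (av.nonneg _)
        ((av.nonneg _).trans (H.ev_le' le_rfl hu))
    have f2 : av (ev v x) * av (ev b x) ≤ κ ^ (q + 1) * (A * R ^ q) * M :=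
      mul_le_mul (H.ev_le' le_rfl hv) (le_max_right _ _) (av.nonneg _)
        ((av.nonneg _).trans (H.ev_le' le_rfl hv))
    have h2 : av S * R ^ (q + d) ≤ κ * (κ ^ (q + 1) * (A * R ^ q) * M) :=
      h1.trans (by gcongr; exact max_le f1 f2)
    have h3 : R ^ q * (av S * R ^ d) ≤ R ^ q * (κ ^ (q + 2) * A * M) := by
      calc _ = av S * R ^ (q + d) := by ring
        _ ≤ _ := h2
        _ = _ := by ring
    have h4 := le_of_mul_le_mul_left h3 (by positivity)
    have h5 : av S * (κ ^ d * R ^ d) ≤ av S * (E * M) := by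
      calc _ = κ ^ d * (av S * R ^ d) := by ring
        _ ≤ κ ^ d * (κ ^ (q + 2) * A * M) := by gcongr
        _ = κ ^ (q + d + 2) * A * M := by ring
        _ ≤ E * av S * M := by gcongr
        _ = _ := by ring
    exact le_of_mul_le_mul_left h5 hSp
  rcases le_total (av x.1) (av x.2) with h | h
  · exact main u v x.2 (by rw [hRdef, mx, max_eq_right h]) hu hv (hb.h1 x)
  · exact main u' v' x.1 (by rw [hRdef, mx, max_eq_left h]) hu' hv' (hb.h2 x)

lemma LF.up (H : LN av κ nm) {E : ℝ} {a b : Fin (d + 1) → k} (h : LF av κ E a b)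
    (x : k × k) : κ * mx av (Fm a b x) ≤ E * mx av x ^ d := by
  have k1 := H.one_le
  have E0 : 0 ≤ E := by linarith [h.kE]
  have hp : 0 < κ ^ (3 * d + 2) := by positivity
  have h1 := H.ev_le' (a := a) (x := x) le_rfl (A := E / κ ^ (3 * d + 2))
    (fun j => by rw [le_div_iff₀ hp, mul_comm]; exact h.ua j)
  have h2 := H.ev_le' (a := b) (x := x) le_rfl (A := E / κ ^ (3 * d + 2))
    (fun j => by rw [le_div_iff₀ hp, mul_comm]; exact h.ub j)
  have h3 := max_le h1 h2
  have hm := mx_nonneg (av := av) x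
  calc _ ≤ κ * (κ ^ (d + 1) * (E / κ ^ (3 * d + 2) * mx av x ^ d)) := by
        gcongr; exact h3
    _ = κ ^ (d + 2) / κ ^ (3 * d + 2) * (E * mx av x ^ d) := by ring
    _ ≤ 1 * (E * mx av x ^ d) := by
        gcongr
        rw [div_le_one hp]
        exact pow_le_pow_right₀ k1 (by omega)
    _ = _ := one_mul _

lemma LF.pup (H : LN av κ nm) {E : ℝ} {a b : Fin (d + 1) → k} (h : LF av κ E a b)
    (p : Polynomial k × Polynomial k) :
    pm nm (Fm (Polynomial.C ∘ a) (Polynomial.C ∘ b) p) ≤ E * pm nm p ^ d := by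
  have k1 := H.one_le
  have E0 : 0 ≤ E := by linarith [h.kE]
  have hp : 0 < κ ^ (3 * d + 2) := by positivity
  have h1 := H.ev_le (a := a) (p := p) le_rfl (A := E / κ ^ (3 * d + 2))
    (fun j => by rw [le_div_iff₀ hp, mul_comm]; exact h.ua j)
  have h2 := H.ev_le (a := b) (p := p) le_rfl (A := E / κ ^ (3 * d + 2))
    (fun j => by rw [le_div_iff₀ hp, mul_comm]; exact h.ub j)
  have h3 := max_le h1 h2
  have hm : 0 ≤ pm nm p := (H.nn _).trans (le_max_left _ _)
  calc _ ≤ (κ ^ (d + 1) * (E / κ ^ (3 * d + 2) * pm nm p ^ d)) := h3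
    _ = κ ^ (d + 1) / κ ^ (3 * d + 2) * (E * pm nm p ^ d) := by ring
    _ ≤ 1 * (E * pm nm p ^ d) := by
        gcongr
        rw [div_le_one hp]
        exact pow_le_pow_right₀ k1 (by omega)
    _ = _ := one_mul _

lemma LF.pdiff (H : LN av κ nm) {E : ℝ} {a b : Fin (d + 1) → k} (h : LF av κ E a b)
    {p p' : Polynomial k × Polynomial k} {R τ : ℝ}
    (hτ0 : 0 ≤ τ) (hτ : τ ≤ 1) (hp : pm nm p ≤ R) (hh : pm nm (p' - p) ≤ τ * R) :
    pm nm (Fm (Polynomial.C ∘ a) (Polynomial.C ∘ b) p' - Fm (Polynomial.C ∘ a) (Polynomial.C ∘ b) p)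
      ≤ E * (τ * R ^ d) := by
  have k1 := H.one_le
  have hpp : 0 < κ ^ (3 * d + 2) := by positivity
  have h1 := H.ev_diff (a := a) hτ0 hτ hp hh (A := E / κ ^ (3 * d + 2))
    (fun j => by rw [le_div_iff₀ hpp, mul_comm]; exact h.ua j)
  have h2 := H.ev_diff (a := b) hτ0 hτ hp hh (A := E / κ ^ (3 * d + 2))
    (fun j => by rw [le_div_iff₀ hpp, mul_comm]; exact h.ub j)
  rw [mul_div_cancel₀ _ hpp.ne'] at h1 h2
  exact max_le h1 h2

/-- the main local estimate -/
theorem LF.main (H : LN av κ nm) {E : ℝ} {a b : Fin (d + 1) → k} (h : LF av κ E a b) (hd : 2 ≤ d)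
    {k0 n : ℕ} (hn : k0 ≤ n) (x y z : k × k) (hyx : mx av y ≤ mx av x)
    (ρ : k) (hρ : av ρ * E ^ (2 * k0) ≤ 1) (D : ℕ) (W : Fin D → k × k)
    (hW : ∀ p : Polynomial k × Polynomial k,
      wedge ((Fm (Polynomial.C ∘ a) (Polynomial.C ∘ b))^[n] p) (mp Polynomial.C z) =
        ∏ i, wedge p (mp Polynomial.C (W i))) :
    ∏ i, max (av (wedge x (W i))) (av ρ * av (wedge y (W i))) ≤
      E ^ (4 * d ^ (n - k0)) * mx av ((Fm a b)^[n] x) * mx av z := by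
  have k1 := H.one_le
  have E1 : 1 ≤ E := k1.trans h.kE
  set r := av ρ with hr
  have r0 : 0 ≤ r := av.nonneg _
  set F := Fm (Polynomial.C ∘ a) (Polynomial.C ∘ b) with hF
  set p0 : Polynomial k × Polynomial k :=
    mp Polynomial.C x + (Polynomial.C ρ * Polynomial.X) • mp Polynomial.C y with hp0
  have low : ∀ w, mx av w ^ d ≤ E * mx av (Fm a b w) := fun w =>
    (le_mul_of_one_le_left (pow_nonneg (mx_nonneg _) _) (one_le_pow₀ k1)).trans (h.low w)
  have hC : ∀ j, F^[j] (mp Polynomial.C x) = mp Polynomial.C ((Fm a b)^[j] x) := fun j =>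
    (Fm_iter_map Polynomial.C a b j x).symm
  have pmC : ∀ w : k × k, pm nm (mp Polynomial.C w) = mx av w := fun w => by
    simp [pm, mx, mp, H.nC]
  have s1 : ∀ j ≤ k0, pm nm (F^[j] p0 - F^[j] (mp Polynomial.C x)) ≤
      r * E ^ (2 * j) * mx av ((Fm a b)^[j] x) := by
    intro j
    induction j with
    | zero =>
      intro _
      simp only [Function.iterate_zero, id, mul_zero, pow_zero, mul_one, hp0, add_sub_cancel_left]
      have hq : ∀ c : k, nm (Polynomial.C ρ * Polynomial.X * Polynomial.C c) ≤ r * av c := by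
        intro c
        refine (H.mul _ _).trans ?_
        rw [H.nC]
        gcongr
        refine (H.mul _ _).trans ?_
        rw [H.nC]
        exact mul_le_of_le_one_right r0 H.nX
      calc _ ≤ r * mx av y := by
            refine max_le ((hq y.1).trans ?_) ((hq y.2).trans ?_)
            · gcongr; exact le_max_left _ _
            · gcongr; exact le_max_right _ _
        _ ≤ _ := by gcongr
    | succ j ih =>
      intro hj
      have ih := ih (by omega)
      rw [Function.iterate_succ_apply', Function.iterate_succ_apply', Function.iterate_succ_apply']
      have hle : r * E ^ (2 * j) ≤ 1 := by
        refine le_trans ?_ hρ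
        gcongr
        omega
      have := h.pdiff H (p := F^[j] (mp Polynomial.C x)) (p' := F^[j] p0)
        (R := mx av ((Fm a b)^[j] x)) (τ := r * E ^ (2 * j)) (by positivity) hle
        (by rw [hC, pmC]) ih
      refine this.trans ?_
      calc _ = E * (r * E ^ (2 * j)) * mx av ((Fm a b)^[j] x) ^ d := by ring
        _ ≤ E * (r * E ^ (2 * j)) * (E * mx av (Fm a b ((Fm a b)^[j] x))) := by
            gcongr; exact low _
        _ = _ := by ring
  have s2 : pm nm (F^[k0] p0) ≤ κ * mx av ((Fm a b)^[k0] x) := by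
    have t1 := s1 k0 le_rfl
    have hm := mx_nonneg (av := av) ((Fm a b)^[k0] x)
    have t2 : pm nm (F^[k0] p0 - F^[k0] (mp Polynomial.C x)) ≤ mx av ((Fm a b)^[k0] x) :=
      t1.trans (mul_le_of_le_one_left hm hρ)
    have t3 : pm nm (F^[k0] (mp Polynomial.C x)) ≤ mx av ((Fm a b)^[k0] x) := by rw [hC, pmC]
    refine max_le ?_ ?_
    · have e : (F^[k0] p0).1 = (F^[k0] (mp Polynomial.C x)).1 +
        (F^[k0] p0 - F^[k0] (mp Polynomial.C x)).1 := by simp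
      rw [e]; refine (H.add _ _).trans ?_
      gcongr
      exact max_le ((le_max_left _ _).trans t3) ((le_max_left _ _).trans t2)
    · have e : (F^[k0] p0).2 = (F^[k0] (mp Polynomial.C x)).2 +
        (F^[k0] p0 - F^[k0] (mp Polynomial.C x)).2 := by simp
      rw [e]; refine (H.add _ _).trans ?_
      gcongr
      exact max_le ((le_max_right _ _).trans t3) ((le_max_right _ _).trans t2)
  have s3 : ∀ i, pm nm (F^[k0 + i] p0) ≤
      E ^ (3 * d ^ i - 2) * mx av ((Fm a b)^[k0 + i] x) := by
    intro i
    induction i with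
    | zero =>
      simp only [add_zero, pow_zero]
      refine s2.trans ?_
      have hm := mx_nonneg (av := av) ((Fm a b)^[k0] x)
      norm_num
      gcongr; exact h.kE
    | succ i ih =>
      rw [← add_assoc, Function.iterate_succ_apply', Function.iterate_succ_apply']
      have hm := mx_nonneg (av := av) ((Fm a b)^[k0 + i] x)
      have hm' := mx_nonneg (av := av) (Fm a b ((Fm a b)^[k0 + i] x))
      have hpn : 0 ≤ pm nm (F^[k0 + i] p0) := (H.nn _).trans (le_max_left _ _)
      have hdi : 1 ≤ d ^ i := Nat.one_le_pow _ _ (by omega)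
      calc _ ≤ E * pm nm (F^[k0 + i] p0) ^ d := h.pup H _
        _ ≤ E * (E ^ (3 * d ^ i - 2) * mx av ((Fm a b)^[k0 + i] x)) ^ d := by gcongr
        _ = E * E ^ ((3 * d ^ i - 2) * d) * mx av ((Fm a b)^[k0 + i] x) ^ d := by
            rw [mul_pow, ← pow_mul]; ring
        _ ≤ E * E ^ ((3 * d ^ i - 2) * d) * (E * mx av (Fm a b ((Fm a b)^[k0 + i] x))) := by
            gcongr; exact low _
        _ = E ^ ((3 * d ^ i - 2) * d + 2) * mx av (Fm a b ((Fm a b)^[k0 + i] x)) := by ring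
        _ ≤ _ := by
            gcongr
            · have e1 : (3 * d ^ i - 2) * d = 3 * d ^ (i + 1) - 2 * d := by
                rw [Nat.sub_mul, pow_succ, mul_assoc]
              rw [e1]
              have : d ^ (i + 1) = d ^ i * d := pow_succ _ _
              have : d ≤ d ^ (i + 1) := by nlinarith
              omega
  have hwi : ∀ i, wedge p0 (mp Polynomial.C (W i)) =
      Polynomial.C (wedge x (W i)) + Polynomial.C (ρ * wedge y (W i)) * Polynomial.X := by
    intro i
    simp only [hp0, wedge, mp, Prod.fst_add, Prod.snd_add, Prod.smul_fst, Prod.smul_snd, smul_eq_mul,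
      Polynomial.C_mul, Polynomial.C_sub]
    ring
  have s4 := H.prod D (fun i => wedge x (W i)) (fun i => ρ * wedge y (W i))
  simp only [av.map_mul] at s4
  refine s4.trans ?_
  rw [Finset.prod_congr rfl fun i _ => (hwi i).symm, ← hW p0]
  have s5 := s3 (n - k0)
  rw [Nat.add_sub_cancel' hn] at s5
  have hmz := mx_nonneg (av := av) z
  have hpn : 0 ≤ pm nm (F^[n] p0) := (H.nn _).trans (le_max_left _ _)
  have hm := mx_nonneg (av := av) ((Fm a b)^[n] x)
  have s6 : nm (wedge (F^[n] p0) (mp Polynomial.C z)) ≤ κ * (pm nm (F^[n] p0) * mx av z) := by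
    refine (H.sub _ _).trans ?_
    gcongr
    refine max_le ((H.mul _ _).trans (mul_le_mul (le_max_left _ _) ?_ (H.nn _) hpn))
      ((H.mul _ _).trans (mul_le_mul (le_max_right _ _) ?_ (H.nn _) hpn))
    · simp only [mp, H.nC]; exact le_max_right _ _
    · simp only [mp, H.nC]; exact le_max_left _ _
  refine s6.trans ?_
  have hdi : 1 ≤ d ^ (n - k0) := Nat.one_le_pow _ _ (by omega)
  calc _ ≤ E * (E ^ (3 * d ^ (n - k0) - 2) * mx av ((Fm a b)^[n] x) * mx av z) := by
        gcongr; exact h.kE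
    _ = E ^ (3 * d ^ (n - k0) - 2 + 1) * (mx av ((Fm a b)^[n] x) * mx av z) := by ring
    _ ≤ E ^ (4 * d ^ (n - k0)) * (mx av ((Fm a b)^[n] x) * mx av z) := by
        gcongr
        omega
    _ = _ := by ring

end loc
end BD

namespace BD

section loc
variable {k : Type} [Field k]

structure Loc (av : AbsoluteValue k ℝ) (l : k × k → ℝ) (K : k × k → k × k → ℝ) (m T : ℝ) : Prop where
  m0 : 0 ≤ m
  symm : ∀ x y, K x y = K y x
  nonneg : ∀ x y, 0 ≤ K x y
  le : ∀ x y, K x y ≤ T * m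
  psd : ∀ (ι : Type) [Fintype ι] (x : ι → k × k) (c : ι → ℝ), 0 ≤ ∑ i, ∑ j, c i * c j * K (x i) (x j)
  upper : ∀ x y, wedge x y ≠ 0 → K x y ≤ - Real.log (av (wedge x y)) + l x + l y

structure LocL (av : AbsoluteValue k ℝ) (l : k × k → ℝ) : Prop where
  hom : ∀ (c : k) x, c ≠ 0 → x ≠ 0 → l (c • x) = Real.log (av c) + l x
  c1 : ∀ x : k × k, x.1 ≠ 0 → Real.log (av x.1) ≤ l x
  c2 : ∀ x : k × k, x.2 ≠ 0 → Real.log (av x.2) ≤ l x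

structure LocF (l : k × k → ℝ) (K : k × k → k × k → ℝ) (m : ℝ) (k0 : ℕ) {d : ℕ}
    (a b : Fin (d + 1) → k) : Prop where
  step : ∀ x, x ≠ 0 → |l (Fm a b x) - d * l x| ≤ m
  p4 : ∀ n, k0 ≤ n → ∀ z : k × k, z ≠ 0 → ∀ W : Fin (d ^ n) → k × k, (∀ i, W i ≠ 0) →
    (∀ p : Polynomial k × Polynomial k,
      wedge ((Fm (Polynomial.C ∘ a) (Polynomial.C ∘ b))^[n] p) (mp Polynomial.C z) =
        ∏ i, wedge p (mp Polynomial.C (W i))) →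
    ∀ x, x ≠ 0 → - l ((Fm a b)^[n] x) + (d : ℝ) ^ n * l x + ∑ i, l (W i) - l z
      - 5 * m * (1 / 2) ^ k0 * (d : ℝ) ^ n ≤ ∑ i, K x (W i)

structure LocZ (av : AbsoluteValue k ℝ) (l : k × k → ℝ) (J : ℕ) (κ : ℝ) : Prop where
  nonneg : 0 ≤ κ
  sep : ∀ p : k × k, p ≠ 0 → ∃ j0 : ℕ, ∀ j : ℕ, j < J → j ≠ j0 → wedge p ((j : k), 1) ≠ 0 ∧
    l p + l ((j : k), 1) - κ ≤ Real.log (av (wedge p ((j : k), 1)))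

variable {av : AbsoluteValue k ℝ} {κ : ℝ} {nm : Polynomial k → ℝ} {d : ℕ}

lemma LF.nz (H : LN av κ nm) {E : ℝ} {a b : Fin (d + 1) → k} (h : LF av κ E a b) : NZ a b := by
  intro x hx h0
  have := h.low x
  have k1 := H.one_le
  have hx := mx_pos (av := av) hx
  rw [h0] at this
  have e : mx av (0 : k × k) = 0 := by simp [mx]
  rw [e, mul_zero] at this
  have : 0 < κ ^ d * mx av x ^ d := by positivity
  linarith

lemma LF.step (H : LN av κ nm) {E : ℝ} {a b : Fin (d + 1) → k} (h : LF av κ E a b)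
    {N : k × k → ℝ} (hN : ∀ x, mx av x ≤ N x) (hN' : ∀ x, N x ≤ κ * mx av x) (x : k × k) (hx : x ≠ 0) :
    |Real.log (N (Fm a b x)) - d * Real.log (N x)| ≤ Real.log E := by
  have k1 := H.one_le
  have E1 : 1 ≤ E := k1.trans h.kE
  have hx0 := mx_pos (av := av) hx
  have hf0 := mx_pos (av := av) (h.nz H x hx)
  have n1 : 0 < N x := hx0.trans_le (hN x)
  have n2 : 0 < N (Fm a b x) := hf0.trans_le (hN _)
  have u1 : N (Fm a b x) ≤ E * N x ^ d := by
    refine (hN' _).trans ((h.up H x).trans ?_)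
    gcongr; exact hN x
  have u2 : N x ^ d ≤ E * N (Fm a b x) := by
    calc N x ^ d ≤ (κ * mx av x) ^ d := by gcongr; exact hN' x
      _ = κ ^ d * mx av x ^ d := mul_pow _ _ _
      _ ≤ E * mx av (Fm a b x) := h.low x
      _ ≤ _ := by gcongr; exact hN _
  have v1 := Real.log_le_log n2 u1
  have v2 := Real.log_le_log (by positivity) u2
  rw [Real.log_mul (by positivity) (by positivity), Real.log_pow] at v1
  rw [Real.log_mul (by positivity) (by positivity), Real.log_pow] at v2
  rw [abs_le]; constructor <;> linarith

lemma LF.p4 (H : LN av κ nm) {E : ℝ} {a b : Fin (d + 1) → k} (h : LF av κ E a b) (hd : 2 ≤ d)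
    {N : k × k → ℝ} (hN : ∀ x, mx av x ≤ N x)
    {K : k × k → k × k → ℝ} {k0 : ℕ} (ρ : k) (hρ : av ρ * E ^ (2 * k0) ≤ 1)
    (cmp : ∀ x : k × k, x ≠ 0 → ∃ y : k × k, mx av y ≤ mx av x ∧ ∀ W : k × k, W ≠ 0 →
      0 < max (av (wedge x W)) (av ρ * av (wedge y W)) ∧
      - Real.log (max (av (wedge x W)) (av ρ * av (wedge y W))) + Real.log (N x) + Real.log (N W)
        - (1 / 2) ^ k0 * Real.log E ≤ K x W) :
    ∀ n, k0 ≤ n → ∀ z : k × k, z ≠ 0 → ∀ W : Fin (d ^ n) → k × k, (∀ i, W i ≠ 0) →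
    (∀ p : Polynomial k × Polynomial k,
      wedge ((Fm (Polynomial.C ∘ a) (Polynomial.C ∘ b))^[n] p) (mp Polynomial.C z) =
        ∏ i, wedge p (mp Polynomial.C (W i))) →
    ∀ x, x ≠ 0 → - Real.log (N ((Fm a b)^[n] x)) + (d : ℝ) ^ n * Real.log (N x)
      + ∑ i, Real.log (N (W i)) - Real.log (N z)
      - 5 * Real.log E * (1 / 2) ^ k0 * (d : ℝ) ^ n ≤ ∑ i, K x (W i) := by
  intro n hn z hz W hW0 hW x hx
  have k1 := H.one_le
  have E1 : 1 ≤ E := k1.trans h.kE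
  obtain ⟨y, hy, hc⟩ := cmp x hx
  have main := h.main H hd hn x y z hy ρ hρ _ W hW
  have hfx := mx_pos (av := av) ((h.nz H).iter n hx)
  have hz0 := mx_pos (av := av) hz
  have pos : 0 < ∏ i, max (av (wedge x (W i))) (av ρ * av (wedge y (W i))) :=
    Finset.prod_pos fun i _ => (hc _ (hW0 i)).1
  have lg := Real.log_le_log pos main
  rw [Real.log_prod (fun i _ => (hc _ (hW0 i)).1.ne'), Real.log_mul (by positivity) (by positivity),
    Real.log_mul (by positivity) (by positivity), Real.log_pow] at lg
  have l1 := Real.log_le_log hfx (hN _)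
  have l2 := Real.log_le_log hz0 (hN _)
  have s : ∑ i, (- Real.log (max (av (wedge x (W i))) (av ρ * av (wedge y (W i)))) + Real.log (N x)
      + Real.log (N (W i)) - (1 / 2) ^ k0 * Real.log E) ≤ ∑ i, K x (W i) :=
    Finset.sum_le_sum fun i _ => (hc _ (hW0 i)).2
  simp only [Finset.sum_sub_distrib, Finset.sum_add_distrib, Finset.sum_neg_distrib,
    Finset.sum_const, Finset.card_univ, Fintype.card_fin, nsmul_eq_mul] at s
  push_cast at s lg
  have hE0 : 0 ≤ Real.log E := Real.log_nonneg E1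
  have hdd : (d : ℝ) ^ (n - k0) ≤ (1 / 2) ^ k0 * (d : ℝ) ^ n := by
    have : (d : ℝ) ^ n = (d : ℝ) ^ k0 * (d : ℝ) ^ (n - k0) := by
      rw [← pow_add]; congr 1; omega
    rw [this, ← mul_assoc, ← mul_pow]
    refine le_mul_of_one_le_left (by positivity) (one_le_pow₀ ?_)
    have : (2 : ℝ) ≤ d := by exact_mod_cast hd
    linarith
  have : 4 * (d : ℝ) ^ (n - k0) * Real.log E ≤ 4 * ((1 / 2) ^ k0 * (d : ℝ) ^ n) * Real.log E := by
    gcongr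
  linarith

end loc

/-- a min-kernel is positive semidefinite -/
lemma psd_of_rel {ι : Type} [Fintype ι] (R : ι → ι → Prop) [DecidableRel R] (hs : ∀ i j, R i j → R j i)
    (ht : ∀ i j k, R i j → R j k → R i k) (c : ι → ℝ) :
    0 ≤ ∑ i, ∑ j, c i * c j * (if R i j then 1 else 0) := by
  classical
  let φ : ι → Finset ι := fun i => Finset.univ.filter (R i)
  have key : ∀ i j, (if R i j then (1 : ℝ) else 0) =
      ∑ s : Finset ι, (if s.Nonempty then (1 : ℝ) else 0) * ((if φ i = s then 1 else 0) *
        (if φ j = s then 1 else 0)) := by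
    intro i j
    rw [Finset.sum_eq_single (φ i)]
    · by_cases h : R i j
      · have e : φ j = φ i := by
          ext k; simp only [φ, Finset.mem_filter, Finset.mem_univ, true_and]
          exact ⟨fun h' => ht _ _ _ h h', fun h' => ht _ _ _ (hs _ _ h) h'⟩
        have ne : (φ i).Nonempty := ⟨j, by simp [φ, h]⟩
        simp [h, e, ne]
      · rw [if_neg h]
        by_cases ne : (φ i).Nonempty
        · have e : φ j ≠ φ i := by
            intro e
            obtain ⟨k, hk⟩ := ne
            have hk2 : k ∈ φ j := e ▸ hk
            simp only [φ, Finset.mem_filter, Finset.mem_univ, true_and] at hk hk2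
            exact h (ht _ _ _ hk (hs _ _ hk2))
          simp [e]
        · simp [ne]
    · intro s _ hs
      simp [hs.symm]
    · simp
  have e : ∑ i, ∑ j, c i * c j * (if R i j then (1 : ℝ) else 0) =
      ∑ s : Finset ι, (if s.Nonempty then (1 : ℝ) else 0) * (∑ i, c i * (if φ i = s then 1 else 0)) ^ 2 := by
    simp_rw [key, Finset.mul_sum]
    rw [Finset.sum_comm' (t' := Finset.univ) (s' := fun _ => Finset.univ) (by simp)]
    rw [Finset.sum_congr rfl fun _ _ => Finset.sum_comm]
    rw [Finset.sum_comm]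
    refine Finset.sum_congr rfl fun s _ => ?_
    rw [sq, Finset.sum_mul_sum, Finset.mul_sum]
    rw [Finset.sum_comm]
    refine Finset.sum_congr rfl fun i _ => ?_
    rw [Finset.mul_sum]
    refine Finset.sum_congr rfl fun j _ => ?_
    ring
  rw [e]
  exact Finset.sum_nonneg fun s _ => mul_nonneg (by split_ifs <;> norm_num) (sq_nonneg _)

lemma psd_min {ι : Type} [Fintype ι] (K : ι → ι → ℝ) (hs : ∀ i j, K i j = K j i)
    (h0 : ∀ i j, 0 ≤ K i j) (ht : ∀ i j k, min (K i j) (K j k) ≤ K i k) (c : ι → ℝ) :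
    0 ≤ ∑ i, ∑ j, c i * c j * K i j := by
  obtain ⟨M, hM⟩ : ∃ M, ∀ i j, K i j ≤ M := by
    obtain ⟨M, hM⟩ := (Set.finite_range (fun p : ι × ι => K p.1 p.2)).bddAbove
    exact ⟨M, fun i j => hM ⟨(i, j), rfl⟩⟩
  have layer : ∀ i j, K i j = ∫ t in Set.Ioc 0 M, (if t < K i j then (1 : ℝ) else 0) := by
    intro i j
    have : (fun t : ℝ => if t < K i j then (1 : ℝ) else 0) = Set.indicator (Set.Iio (K i j)) 1 := by
      ext t; simp [Set.indicator]
    rw [this, MeasureTheory.integral_indicator_one measurableSet_Iio,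
      MeasureTheory.measureReal_restrict_apply measurableSet_Iio]
    have : Set.Iio (K i j) ∩ Set.Ioc 0 M = Set.Ioo 0 (K i j) := by
      ext t; simp only [Set.mem_inter_iff, Set.mem_Iio, Set.mem_Ioc, Set.mem_Ioo]
      constructor
      · rintro ⟨h1, h2, h3⟩; exact ⟨h2, h1⟩
      · rintro ⟨h1, h2⟩; exact ⟨h2, h1, (h2.trans_le (hM i j)).le⟩
    rw [this, MeasureTheory.measureReal_def, Real.volume_Ioo]
    simp [h0 i j]
  have int : ∀ i j, MeasureTheory.IntegrableOn (fun t : ℝ => if t < K i j then (1 : ℝ) else 0)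
      (Set.Ioc 0 M) := by
    intro i j
    have : (fun t : ℝ => if t < K i j then (1 : ℝ) else 0) = Set.indicator (Set.Iio (K i j)) 1 := by
      ext t; simp [Set.indicator]
    rw [this]
    refine MeasureTheory.Integrable.indicator ?_ measurableSet_Iio
    exact MeasureTheory.integrableOn_const (by simp)
  have e : ∑ i, ∑ j, c i * c j * K i j =
      ∫ t in Set.Ioc 0 M, ∑ i, ∑ j, c i * c j * (if t < K i j then (1 : ℝ) else 0) := by
    rw [MeasureTheory.integral_finset_sum]
    · refine Finset.sum_congr rfl fun i _ => ?_
      rw [MeasureTheory.integral_finset_sum]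
      · refine Finset.sum_congr rfl fun j _ => ?_
        rw [MeasureTheory.integral_const_mul, ← layer]
      · intro j _; exact (int i j).const_mul _
    · intro i _; exact MeasureTheory.integrable_finset_sum _ fun j _ => (int i j).const_mul _
  rw [e]
  refine MeasureTheory.integral_nonneg fun t => ?_
  refine psd_of_rel (fun i j => t < K i j) ?_ ?_ c
  · intro i j h; rw [hs]; exact h
  · intro i j k h h'; exact (lt_min h h').trans_le (ht i j k)

end BD

namespace BD

section na
variable {k : Type} [Field k] {av : AbsoluteValue k ℝ}

lemma LN_na (hna : IsNonarchimedean av) : LN av 1 (Polynomial.gaussNorm av 1) where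
  one_le := le_rfl
  nn p := Polynomial.gaussNorm_nonneg av p zero_le_one
  add p q := by
    rw [one_mul]; exact Polynomial.isNonarchimedean_gaussNorm av hna zero_le_one p q
  mul p q := (Polynomial.gaussNorm_mul hna zero_lt_one p q).le
  nC c := Polynomial.gaussNorm_C av 1 c
  nX := by
    rw [← Polynomial.monomial_one_one_eq_X, Polynomial.gaussNorm_monomial]; simp
  prod D α β := by
    have key : ∀ p : Fin D → Polynomial k, Polynomial.gaussNorm av 1 (∏ i, p i) =
        ∏ i, Polynomial.gaussNorm av 1 (p i) := by
      intro p
      induction (Finset.univ : Finset (Fin D)) using Finset.induction_on with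
      | empty => simp only [Finset.prod_empty]; rw [← Polynomial.C_1, Polynomial.gaussNorm_C]; simp
      | insert a s ha ih =>
        rw [Finset.prod_insert ha, Finset.prod_insert ha, Polynomial.gaussNorm_mul hna zero_lt_one, ih]
    rw [key]
    refine Finset.prod_le_prod (fun i _ => le_max_of_le_left (av.nonneg _)) fun i _ => max_le ?_ ?_
    · have := Polynomial.le_gaussNorm av (Polynomial.C (α i) + Polynomial.C (β i) * Polynomial.X) (zero_le_one' ℝ) 0
      simpa using this
    · have := Polynomial.le_gaussNorm av (Polynomial.C (α i) + Polynomial.C (β i) * Polynomial.X) (zero_le_one' ℝ) 1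
      simpa [Polynomial.coeff_C] using this

lemma na_sub (hna : IsNonarchimedean av) (x y : k) : av (x - y) ≤ max (av x) (av y) := by
  rw [sub_eq_add_neg]; simpa using hna x (-y)

lemma wedge_le_na (hna : IsNonarchimedean av) (x y : k × k) : av (wedge x y) ≤ mx av x * mx av y := by
  refine (na_sub hna _ _).trans (max_le ?_ ?_) <;> rw [map_mul]
  · exact mul_le_mul (le_max_left _ _) (le_max_right _ _) (av.nonneg _) (mx_nonneg _)
  · exact mul_le_mul (le_max_right _ _) (le_max_left _ _) (av.nonneg _) (mx_nonneg _)

lemma wedge_ultra (hna : IsNonarchimedean av) (x y z : k × k) :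
    mx av y * av (wedge x z) ≤ max (mx av x * av (wedge y z)) (mx av z * av (wedge x y)) := by
  have h1 : y.1 * wedge x z = x.1 * wedge y z + z.1 * wedge x y := by simp only [wedge]; ring
  have h2 : y.2 * wedge x z = x.2 * wedge y z + z.2 * wedge x y := by simp only [wedge]; ring
  have g1 : av y.1 * av (wedge x z) ≤ max (mx av x * av (wedge y z)) (mx av z * av (wedge x y)) := by
    rw [← map_mul, h1]
    refine (hna _ _).trans (max_le_max ?_ ?_) <;> rw [map_mul] <;>
      exact mul_le_mul_of_nonneg_right (le_max_left _ _) (av.nonneg _)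
  have g2 : av y.2 * av (wedge x z) ≤ max (mx av x * av (wedge y z)) (mx av z * av (wedge x y)) := by
    rw [← map_mul, h2]
    refine (hna _ _).trans (max_le_max ?_ ?_) <;> rw [map_mul] <;>
      exact mul_le_mul_of_nonneg_right (le_max_right _ _) (av.nonneg _)
  rw [mx, max_mul_of_nonneg _ _ (av.nonneg _)]
  exact max_le g1 g2

open Classical in
def Kna (av : AbsoluteValue k ℝ) (r : ℝ) (x y : k × k) : ℝ :=
  if x = 0 ∨ y = 0 then 0 else - Real.log (max (av (wedge x y) / (mx av x * mx av y)) r)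

lemma Kna_one (hna : IsNonarchimedean av) (x y : k × k) : Kna av 1 x y = 0 := by
  rw [Kna]; split_ifs with h
  · rfl
  · push Not at h
    have := mx_pos (av := av) h.1
    have := mx_pos (av := av) h.2
    rw [max_eq_right, Real.log_one, neg_zero]
    exact div_le_one_of_le₀ (wedge_le_na hna x y) (by positivity)

lemma Kna_symm {r : ℝ} (x y : k × k) : Kna av r x y = Kna av r y x := by
  have : av (wedge x y) = av (wedge y x) := by rw [wedge_swap, AbsoluteValue.map_neg]
  unfold Kna
  rw [this, mul_comm (mx av x)]
  by_cases hx : x = 0 <;> by_cases hy : y = 0 <;> simp [hx, hy]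

lemma Kna_nonneg (hna : IsNonarchimedean av) {r : ℝ} (hr0 : 0 < r) (hr1 : r ≤ 1) (x y : k × k) :
    0 ≤ Kna av r x y := by
  rw [Kna]; split_ifs with h
  · exact le_rfl
  · push Not at h
    have := mx_pos (av := av) h.1
    have := mx_pos (av := av) h.2
    have := div_le_one_of_le₀ (wedge_le_na hna x y) (by positivity)
    have := Real.log_nonpos (hr0.le.trans (le_max_right (av (wedge x y) / (mx av x * mx av y)) r)) (max_le this hr1)
    linarith

lemma Loc_na (hna : IsNonarchimedean av) {r m T : ℝ} (hr0 : 0 < r) (hr1 : r ≤ 1) (hm : 0 ≤ m)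
    (hT : - Real.log r ≤ T * m) :
    Loc av (fun x => Real.log (mx av x)) (Kna av r) m T where
  m0 := hm
  symm x y := Kna_symm x y
  nonneg x y := Kna_nonneg hna hr0 hr1 x y
  le x y := by
    have h0 : 0 ≤ T * m := (neg_nonneg.2 (Real.log_nonpos hr0.le hr1)).trans hT
    rw [Kna]; split_ifs with h
    · exact h0
    · have := Real.log_le_log hr0 (le_max_right (av (wedge x y) / (mx av x * mx av y)) r)
      linarith
  psd ι _ x c := by
    have symm := Kna_symm (av := av) (r := r)
    have nn := Kna_nonneg hna hr0 hr1
    refine psd_min (fun i j => Kna av r (x i) (x j)) (fun i j => symm _ _) (fun i j => nn _ _) ?_ c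
    intro i j l
    by_cases hi : x i = 0
    · refine (min_le_left _ _).trans ((?_ : _ = (0:ℝ)).le.trans (nn _ _)); simp [Kna, hi]
    by_cases hj : x j = 0
    · refine (min_le_left _ _).trans ((?_ : _ = (0:ℝ)).le.trans (nn _ _)); simp [Kna, hj]
    by_cases hl : x l = 0
    · refine (min_le_right _ _).trans ((?_ : _ = (0:ℝ)).le.trans (nn _ _)); simp [Kna, hl]
    have pi := mx_pos (av := av) hi
    have pj := mx_pos (av := av) hj
    have pl := mx_pos (av := av) hl
    simp only [Kna, hi, hj, hl, or_self, if_false]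
    rw [min_neg_neg, neg_le_neg_iff]
    have ult : av (wedge (x i) (x l)) / (mx av (x i) * mx av (x l)) ≤
        max (av (wedge (x i) (x j)) / (mx av (x i) * mx av (x j)))
          (av (wedge (x j) (x l)) / (mx av (x j) * mx av (x l))) := by
      have := wedge_ultra hna (x i) (x j) (x l)
      rcases le_max_iff.1 this with h | h
      · apply le_max_of_le_right
        rw [div_le_div_iff₀ (by positivity) (by positivity)]; nlinarith
      · apply le_max_of_le_left
        rw [div_le_div_iff₀ (by positivity) (by positivity)]; nlinarith
    rcases le_max_iff.1 ult with h | h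
    · exact le_max_of_le_left (Real.log_le_log (lt_max_of_lt_right hr0) (max_le_max h le_rfl))
    · exact le_max_of_le_right (Real.log_le_log (lt_max_of_lt_right hr0) (max_le_max h le_rfl))
  upper x y hw := by
    have hx : x ≠ 0 := by rintro rfl; simp [wedge] at hw
    have hy : y ≠ 0 := by rintro rfl; simp [wedge] at hw
    have px := mx_pos (av := av) hx
    have py := mx_pos (av := av) hy
    have pw := av.pos hw
    simp only [Kna, hx, hy, or_self, if_false]
    have := Real.log_le_log (by positivity) (le_max_left (av (wedge x y) / (mx av x * mx av y)) r)
    rw [Real.log_div (by positivity) (by positivity), Real.log_mul (by positivity) (by positivity)] at this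
    linarith

lemma LocL_na : LocL av (fun x => Real.log (mx av x)) where
  hom c x hc hx := by
    have : mx av (c • x) = av c * mx av x := by
      simp [mx, mul_max_of_nonneg _ _ (av.nonneg c)]
    simp only [this]
    exact Real.log_mul (av.pos hc).ne' (mx_pos hx).ne'
  c1 x hx := Real.log_le_log (av.pos hx) (le_max_left _ _)
  c2 x hx := Real.log_le_log (av.pos hx) (le_max_right _ _)

lemma LocF_na (hna : IsNonarchimedean av) {d q : ℕ} (hd : 2 ≤ d) {a b : Fin (d + 1) → k}
    {u v u' v' : Fin (q + 1) → k} {S : k} (hS : S ≠ 0) (hS1 : av S ≤ 1) (hb : Bez a b u v u' v' S)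
    (ha : ∀ j, av (a j) ≤ 1) (hb1 : ∀ j, av (b j) ≤ 1) (hu : ∀ j, av (u j) ≤ 1)
    (hv : ∀ j, av (v j) ≤ 1) (hu' : ∀ j, av (u' j) ≤ 1) (hv' : ∀ j, av (v' j) ≤ 1) (k0 : ℕ) :
    LocF (fun x => Real.log (mx av x)) (Kna av (av S ^ (2 * k0))) (- Real.log (av S)) k0 a b := by
  have H := LN_na hna
  have pS := av.pos hS
  have hE : 1 ≤ (av S)⁻¹ := (one_le_inv₀ pS).2 hS1
  have h : LF av 1 (av S)⁻¹ a b := LF.of_bez H hS hb hE (by simpa using fun j => (ha j).trans hE)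
    (by simpa using fun j => (hb1 j).trans hE) hu hv hu' hv' (by simp [pS.ne']) (by omega)
  rw [← Real.log_inv]
  constructor
  · intro x hx
    exact h.step H (fun _ => le_rfl) (fun x => by simp) x hx
  · refine h.p4 H hd (fun _ => le_rfl) (S ^ (2 * k0)) ?_ ?_
    · rw [map_pow, ← mul_pow, mul_inv_cancel₀ pS.ne', one_pow]
    · intro x hx
      have px := mx_pos (av := av) hx
      have hr : 0 < av S ^ (2 * k0) := by positivity
      have key : ∃ y : k × k, mx av y ≤ mx av x ∧ ∀ W : k × k,
          max (av (wedge x W)) (av (wedge y W)) = mx av x * mx av W := by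
        rcases le_total (av x.2) (av x.1) with hc | hc
        · have e : mx av x = av x.1 := max_eq_left hc
          have x1 : x.1 ≠ 0 := fun h => by rw [e, h, map_zero] at px; exact px.false
          refine ⟨(0, x.1), by simp [mx], fun W => le_antisymm (max_le (wedge_le_na hna _ _) ?_) ?_⟩
          · simp only [wedge, zero_mul, zero_sub, AbsoluteValue.map_neg, map_mul, e]
            gcongr; exact le_max_left _ _
          · have i : x.1 * W.2 = wedge x W + x.2 * W.1 := by simp [wedge]
            have w1 : av (wedge (0, x.1) W) = av x.1 * av W.1 := by simp [wedge]
            rw [e, mx, mul_max_of_nonneg _ _ (av.nonneg _), w1]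
            refine max_le (le_max_right _ _) ?_
            rw [← map_mul, i]
            refine (hna _ _).trans (max_le_max le_rfl ?_)
            rw [map_mul]; gcongr
        · have e : mx av x = av x.2 := max_eq_right hc
          refine ⟨(x.2, 0), by simp [mx], fun W => le_antisymm (max_le (wedge_le_na hna _ _) ?_) ?_⟩
          · simp only [wedge, zero_mul, sub_zero, map_mul, e]
            gcongr; exact le_max_right _ _
          · have i : x.2 * W.1 = x.1 * W.2 - wedge x W := by simp [wedge]
            have w1 : av (wedge (x.2, 0) W) = av x.2 * av W.2 := by simp [wedge]
            rw [e, mx, mul_max_of_nonneg _ _ (av.nonneg _), w1]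
            refine max_le ?_ (le_max_right _ _)
            rw [← map_mul, i, max_comm]
            refine (na_sub hna _ _).trans (max_le_max ?_ le_rfl)
            rw [map_mul]; gcongr
      obtain ⟨y, hy, hyW⟩ := key
      refine ⟨y, hy, fun W hW => ?_⟩
      have pW := mx_pos (av := av) hW
      have hk := hyW W
      have r1 : av S ^ (2 * k0) ≤ 1 := pow_le_one₀ pS.le hS1
      have lb : av S ^ (2 * k0) * (mx av x * mx av W) ≤
          max (av (wedge x W)) (av (S ^ (2 * k0)) * av (wedge y W)) := by
        rw [map_pow, ← hk, mul_max_of_nonneg _ _ hr.le]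
        exact max_le_max (mul_le_of_le_one_left (av.nonneg _) r1) le_rfl
      have pos : 0 < max (av (wedge x W)) (av (S ^ (2 * k0)) * av (wedge y W)) :=
        lt_of_lt_of_le (by positivity) lb
      refine ⟨pos, ?_⟩
      simp only [Kna, hx, hW, or_self, if_false]
      have e : max (av (wedge x W) / (mx av x * mx av W)) (av S ^ (2 * k0)) ≤
          max (av (wedge x W)) (av (S ^ (2 * k0)) * av (wedge y W)) / (mx av x * mx av W) := by
        rw [le_div_iff₀ (by positivity), max_mul_of_nonneg _ _ (by positivity)]
        refine max_le ?_ lb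
        rw [div_mul_cancel₀ _ (by positivity)]; exact le_max_left _ _
      have l := Real.log_le_log (lt_max_of_lt_right hr) e
      rw [Real.log_div pos.ne' (by positivity), Real.log_mul (by positivity) (by positivity)] at l
      have : 0 ≤ (1 / 2) ^ k0 * Real.log ((av S)⁻¹) := mul_nonneg (by positivity) (Real.log_nonneg hE)
      linarith

lemma LocZ_na [CharZero k] (hna : IsNonarchimedean av) (J : ℕ) :
    LocZ av (fun x => Real.log (mx av x)) J (- Real.log (av (J.factorial : k))) := by
  have nat : ∀ n : ℕ, av (n : k) ≤ 1 := fun n => hna.apply_natCast_le_one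
  have pc : 0 < av (J.factorial : k) := av.pos (by exact_mod_cast J.factorial_ne_zero)
  refine ⟨neg_nonneg.2 (Real.log_nonpos pc.le (nat _)), fun p hp => ?_⟩
  have pp := mx_pos (av := av) hp
  set c := av (J.factorial : k)
  have key : ∀ i j : ℕ, i < J → j < i → av (wedge p ((i : k), 1)) < c * mx av p →
      c * mx av p ≤ av (wedge p ((j : k), 1)) := by
    intro i j hi hj h1
    by_contra! h2
    obtain ⟨s, hs⟩ : (i - j) ∣ J.factorial := Nat.dvd_factorial (by omega) (by omega)
    have hsc : c ≤ av ((i - j : ℕ) : k) := by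
      simp only [c, hs, Nat.cast_mul, map_mul]
      exact mul_le_of_le_one_right (av.nonneg _) (nat s)
    have e : ((i - j : ℕ) : k) * p.2 = wedge p ((j : k), 1) - wedge p ((i : k), 1) := by
      simp only [wedge]; rw [Nat.cast_sub hj.le]; ring
    have h3 : c * av p.2 < c * mx av p := by
      calc c * av p.2 ≤ av ((i - j : ℕ) : k) * av p.2 := by gcongr
        _ = _ := (map_mul _ _ _).symm
        _ ≤ _ := by rw [e]; exact na_sub hna _ _
        _ < _ := max_lt h2 h1
    have h4 : av p.2 < mx av p := lt_of_mul_lt_mul_left h3 pc.le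
    have e2 : p.1 = wedge p ((i : k), 1) + p.2 * i := by simp [wedge]
    have h5 : av p.1 < mx av p := by
      rw [e2]
      refine (hna _ _).trans_lt (max_lt (h1.trans_le (mul_le_of_le_one_left pp.le (nat _))) ?_)
      rw [map_mul]
      exact (mul_le_of_le_one_right (av.nonneg _) (nat i)).trans_lt h4
    exact (max_lt h5 h4).false
  have fin : ∀ j : ℕ, c * mx av p ≤ av (wedge p ((j : k), 1)) → wedge p ((j : k), 1) ≠ 0 ∧
      Real.log (mx av p) + Real.log (mx av ((j : k), 1)) - (- Real.log c) ≤
        Real.log (av (wedge p ((j : k), 1))) := by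
    intro j h
    have hp : 0 < av (wedge p ((j : k), 1)) := lt_of_lt_of_le (by positivity) h
    refine ⟨fun h0 => by rw [h0, map_zero] at hp; exact hp.false, ?_⟩
    have : mx av ((j : k), 1) = 1 := by simp [mx, nat j]
    rw [this, Real.log_one]
    have := Real.log_le_log (by positivity) h
    rw [Real.log_mul pc.ne' pp.ne'] at this
    linarith
  by_cases hex : ∃ i < J, av (wedge p ((i : k), 1)) < c * mx av p
  · obtain ⟨i, hi, h⟩ := hex
    refine ⟨i, fun j hj hne => fin j ?_⟩
    rcases lt_or_gt_of_ne hne with hlt | hlt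
    · exact key i j hi hlt h
    · by_contra! h2
      exact absurd h (key j i hj hlt h2).not_gt
  · push Not at hex
    exact ⟨0, fun j hj _ => fin j (hex j hj)⟩

end na
end BD

namespace BD

section arch

def avC : AbsoluteValue ℂ ℝ := IsAbsoluteValue.toAbsoluteValue (norm : ℂ → ℝ)

lemma avC_apply (x : ℂ) : avC x = ‖x‖ := rfl

def n1 (p : Polynomial ℂ) : ℝ := p.sum fun _ a => ‖a‖

lemma n1_eq (p : Polynomial ℂ) {N : ℕ} (h : p.natDegree < N) : n1 p = ∑ i ∈ Finset.range N, ‖p.coeff i‖ :=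
  Polynomial.sum_over_range' p (by simp) N h

lemma n1_nonneg (p : Polynomial ℂ) : 0 ≤ n1 p := Finset.sum_nonneg fun _ _ => norm_nonneg _

lemma n1_add (p q : Polynomial ℂ) : n1 (p + q) ≤ n1 p + n1 q := by
  set N := max p.natDegree q.natDegree + 1
  rw [n1_eq p (N := N) (by omega), n1_eq q (N := N) (by omega),
    n1_eq (p + q) (N := N) (by have := Polynomial.natDegree_add_le p q; omega), ← Finset.sum_add_distrib]
  exact Finset.sum_le_sum fun i _ => by rw [Polynomial.coeff_add]; exact norm_add_le _ _

lemma n1_C_mul (c : ℂ) (p : Polynomial ℂ) : n1 (Polynomial.C c * p) = ‖c‖ * n1 p := by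
  rw [n1_eq p (Nat.lt_succ_self _), n1_eq (Polynomial.C c * p)
    (Nat.lt_succ_of_le (Polynomial.natDegree_C_mul_le c p)), Finset.mul_sum]
  simp

lemma n1_mul_X (p : Polynomial ℂ) : n1 (p * Polynomial.X) = n1 p := by
  rw [n1_eq p (Nat.lt_succ_self _), n1_eq (p * Polynomial.X) (N := p.natDegree + 1 + 1)
    (by have := Polynomial.natDegree_mul_le (p := p) (q := Polynomial.X)
        have := Polynomial.natDegree_X_le (R := ℂ); omega), Finset.sum_range_succ']
  simp

lemma n1_mul_X_pow (p : Polynomial ℂ) (n : ℕ) : n1 (p * Polynomial.X ^ n) = n1 p := by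
  induction n with
  | zero => simp
  | succ n ih => rw [pow_succ, ← mul_assoc, n1_mul_X, ih]

lemma n1_zero : n1 0 = 0 := by simp [n1]

lemma n1_sum {ι : Type*} (s : Finset ι) (f : ι → Polynomial ℂ) : n1 (∑ i ∈ s, f i) ≤ ∑ i ∈ s, n1 (f i) := by
  classical
  induction s using Finset.induction_on with
  | empty => simp [n1_zero]
  | insert a s ha ih =>
    rw [Finset.sum_insert ha, Finset.sum_insert ha]
    exact (n1_add _ _).trans (by linarith)

lemma n1_mul (p q : Polynomial ℂ) : n1 (p * q) ≤ n1 p * n1 q := by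
  have e : p * q = ∑ i ∈ p.support, Polynomial.C (p.coeff i) * (q * Polynomial.X ^ i) := by
    conv_lhs => rw [p.as_sum_support_C_mul_X_pow, Finset.sum_mul]
    exact Finset.sum_congr rfl fun i _ => by ring
  rw [e]
  refine (n1_sum _ _).trans ?_
  simp only [n1_C_mul, n1_mul_X_pow, ← Finset.sum_mul]
  exact le_rfl

lemma n1_C (c : ℂ) : n1 (Polynomial.C c) = ‖c‖ := by
  rw [n1_eq (N := 1) _ (by simp)]; simp

lemma LN_C : LN avC 2 n1 where
  one_le := by norm_num
  nn := n1_nonneg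
  add p q := (n1_add p q).trans (by
    have := le_max_left (n1 p) (n1 q)
    have := le_max_right (n1 p) (n1 q)
    linarith)
  mul := n1_mul
  nC c := n1_C c
  nX := by
    have := n1_mul_X 1
    rw [one_mul] at this
    rw [this, ← Polynomial.C_1, n1_C]; simp
  prod D α β := by
    refine le_trans (le_of_eq ?_) (Polynomial.mahlerMeasure_le_sum_norm_coeff _)
    have key : ∀ p : Fin D → Polynomial ℂ, (∏ i, p i).mahlerMeasure = ∏ i, (p i).mahlerMeasure := by
      intro p
      induction (Finset.univ : Finset (Fin D)) using Finset.induction_on with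
      | empty => simp
      | insert a s ha ih =>
        rw [Finset.prod_insert ha, Finset.prod_insert ha, Polynomial.mahlerMeasure_mul, ih]
    rw [key]
    refine Finset.prod_congr rfl fun i _ => ?_
    rw [avC_apply, avC_apply, add_comm]
    by_cases h : β i = 0
    · simp [h]
    · rw [Polynomial.mahlerMeasure_C_mul_X_add_C h, max_comm]

/-- Hermitian data -/
def nsq (x : ℂ × ℂ) : ℝ := Complex.normSq x.1 + Complex.normSq x.2
def NE (x : ℂ × ℂ) : ℝ := Real.sqrt (nsq x)
def hip (x y : ℂ × ℂ) : ℂ := x.1 * (starRingEnd ℂ) y.1 + x.2 * (starRingEnd ℂ) y.2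
def tt (x y : ℂ × ℂ) : ℝ := Complex.normSq (hip x y) / (nsq x * nsq y)

lemma nsq_nonneg (x : ℂ × ℂ) : 0 ≤ nsq x := add_nonneg (Complex.normSq_nonneg _) (Complex.normSq_nonneg _)
lemma nsq_pos {x : ℂ × ℂ} (h : x ≠ 0) : 0 < nsq x := by
  rcases (nsq_nonneg x).lt_or_eq with h0 | h0
  · exact h0
  · exfalso; apply h
    have := Complex.normSq_nonneg x.1
    have := Complex.normSq_nonneg x.2
    simp only [nsq] at h0
    exact Prod.ext (Complex.normSq_eq_zero.1 (by linarith)) (Complex.normSq_eq_zero.1 (by linarith))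

lemma lagr (x y : ℂ × ℂ) : Complex.normSq (wedge x y) + Complex.normSq (hip x y) = nsq x * nsq y := by
  simp only [wedge, hip, nsq, Complex.normSq_apply, Complex.add_re, Complex.add_im, Complex.sub_re, Complex.sub_im,
    Complex.mul_re, Complex.mul_im, Complex.conj_re, Complex.conj_im]
  ring

def feat (x : ℂ × ℂ) : Fin 4 → ℝ :=
  ![Complex.normSq x.1 / nsq x, Complex.normSq x.2 / nsq x,
    Real.sqrt 2 * (x.1 * (starRingEnd ℂ) x.2).re / nsq x, Real.sqrt 2 * (x.1 * (starRingEnd ℂ) x.2).im / nsq x]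

lemma tt_feat (x y : ℂ × ℂ) : tt x y = ∑ s, feat x s * feat y s := by
  have h2 : Real.sqrt 2 * Real.sqrt 2 = 2 := Real.mul_self_sqrt (by norm_num)
  have e : Complex.normSq (hip x y) = Complex.normSq x.1 * Complex.normSq y.1 + Complex.normSq x.2 * Complex.normSq y.2
    + 2 * ((x.1 * (starRingEnd ℂ) x.2).re * (y.1 * (starRingEnd ℂ) y.2).re)
    + 2 * ((x.1 * (starRingEnd ℂ) x.2).im * (y.1 * (starRingEnd ℂ) y.2).im) := by
    simp only [hip, Complex.normSq_apply, Complex.add_re, Complex.add_im,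
      Complex.mul_re, Complex.mul_im, Complex.conj_re, Complex.conj_im]
    ring
  have g : ∀ a b p q : ℝ, a / p * (b / q) = a * b / (p * q) := fun a b p q => div_mul_div_comm _ _ _ _
  rw [tt, e, Fin.sum_univ_four]
  simp only [feat, Matrix.cons_val]
  rw [g, g, g, g, ← add_div, ← add_div, ← add_div]
  congr 1
  linear_combination (-(x.1 * (starRingEnd ℂ) x.2).re * (y.1 * (starRingEnd ℂ) y.2).re
    - (x.1 * (starRingEnd ℂ) x.2).im * (y.1 * (starRingEnd ℂ) y.2).im) * h2

lemma tt_nonneg (x y : ℂ × ℂ) : 0 ≤ tt x y :=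
  div_nonneg (Complex.normSq_nonneg _) (mul_nonneg (nsq_nonneg _) (nsq_nonneg _))
lemma tt_le (x y : ℂ × ℂ) : tt x y ≤ 1 := by
  refine div_le_one_of_le₀ ?_ (mul_nonneg (nsq_nonneg _) (nsq_nonneg _))
  have := lagr x y
  have := Complex.normSq_nonneg (wedge x y)
  linarith
lemma tt_symm (x y : ℂ × ℂ) : tt x y = tt y x := by
  simp only [tt_feat, mul_comm]

lemma tt_pow_psd {ι : Type} [Fintype ι] (x : ι → ℂ × ℂ) (n : ℕ) (c : ι → ℝ) :
    0 ≤ ∑ i, ∑ j, c i * c j * tt (x i) (x j) ^ n := by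
  induction n generalizing c with
  | zero =>
    simp only [pow_zero, mul_one, ← Finset.mul_sum, ← Finset.sum_mul]
    exact mul_self_nonneg _
  | succ n ih =>
    have : ∑ i, ∑ j, c i * c j * tt (x i) (x j) ^ (n + 1) =
        ∑ s, ∑ i, ∑ j, (c i * feat (x i) s) * (c j * feat (x j) s) * tt (x i) (x j) ^ n := by
      have st : ∀ i j, c i * c j * tt (x i) (x j) ^ (n + 1) =
          ∑ s, (c i * feat (x i) s) * (c j * feat (x j) s) * tt (x i) (x j) ^ n := by
        intro i j
        rw [pow_succ, ← Finset.sum_mul]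
        have : ∑ s, (c i * feat (x i) s) * (c j * feat (x j) s) = c i * c j * tt (x i) (x j) := by
          rw [tt_feat, Finset.mul_sum]
          exact Finset.sum_congr rfl fun s _ => by ring
        rw [this]; ring
      simp_rw [st]
      exact (Finset.sum_congr rfl fun i _ => Finset.sum_comm).trans Finset.sum_comm
    rw [this]
    exact Finset.sum_nonneg fun s _ => ih _

def KC (q : ℝ) (x y : ℂ × ℂ) : ℝ := - (1 / 2) * Real.log (1 - q * tt x y)

lemma KC_psd {q : ℝ} (h0 : 0 ≤ q) (h1 : q < 1) {ι : Type} [Fintype ι] (x : ι → ℂ × ℂ) (c : ι → ℝ) :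
    0 ≤ ∑ i, ∑ j, c i * c j * KC q (x i) (x j) := by
  have hs : ∀ i j, HasSum (fun n : ℕ => c i * c j * ((1 / 2) * ((q * tt (x i) (x j)) ^ (n + 1) / (n + 1))))
      (c i * c j * KC q (x i) (x j)) := by
    intro i j
    have := tt_nonneg (x i) (x j)
    have := tt_le (x i) (x j)
    have hlt : |q * tt (x i) (x j)| < 1 := by
      rw [abs_of_nonneg (by positivity)]
      nlinarith
    have := (Real.hasSum_pow_div_log_of_abs_lt_one hlt).mul_left (1 / 2)
    have := this.mul_left (c i * c j)
    have e : c i * c j * KC q (x i) (x j) = c i * c j * (1 / 2 * -Real.log (1 - q * tt (x i) (x j))) := by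
      unfold KC; ring
    rw [e]; exact this
  have := hasSum_sum (s := Finset.univ) fun i _ => hasSum_sum (s := Finset.univ) fun j _ => hs i j
  refine this.nonneg fun n => ?_
  have e : ∑ i, ∑ j, c i * c j * ((1 / 2) * ((q * tt (x i) (x j)) ^ (n + 1) / (n + 1))) =
      (q ^ (n + 1) / (2 * (n + 1))) * ∑ i, ∑ j, c i * c j * tt (x i) (x j) ^ (n + 1) := by
    simp only [Finset.mul_sum]
    refine Finset.sum_congr rfl fun i _ => Finset.sum_congr rfl fun j _ => ?_
    rw [mul_pow]; field_simp
  rw [e]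
  exact mul_nonneg (by positivity) (tt_pow_psd _ _ _)

lemma one_sub_tt {x y : ℂ × ℂ} (hx : x ≠ 0) (hy : y ≠ 0) :
    1 - tt x y = Complex.normSq (wedge x y) / (nsq x * nsq y) := by
  have := nsq_pos hx
  have := nsq_pos hy
  have l := lagr x y
  rw [tt, eq_div_iff (by positivity), sub_mul, div_mul_cancel₀ _ (by positivity)]
  linarith

lemma log_NE (x : ℂ × ℂ) : Real.log (NE x) = 1 / 2 * Real.log (nsq x) := by
  rw [NE, Real.log_sqrt (nsq_nonneg x)]; ring
lemma log_norm (z : ℂ) : Real.log ‖z‖ = 1 / 2 * Real.log (Complex.normSq z) := by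
  rw [Complex.normSq_eq_norm_sq, Real.log_pow]; push_cast; ring

def epsC (E : ℝ) (k0 : ℕ) : ℝ := ((E ^ (2 * k0))⁻¹) ^ 2 * (1 / 2) ^ k0 / 4
def qC (E : ℝ) (k0 : ℕ) : ℝ := 1 / (1 + epsC E k0)

lemma epsC_pos {E : ℝ} (hE : 0 < E) (k0 : ℕ) : 0 < epsC E k0 := by unfold epsC; positivity

lemma qC_pos {E : ℝ} (hE : 0 < E) (k0 : ℕ) : 0 < qC E k0 := by
  have := epsC_pos hE k0
  unfold qC; positivity
lemma qC_lt {E : ℝ} (hE : 0 < E) (k0 : ℕ) : qC E k0 < 1 := by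
  have := epsC_pos hE k0
  rw [qC, div_lt_one (by linarith)]; linarith

lemma Loc_C {E : ℝ} (hE : 2 ≤ E) (k0 : ℕ) :
    Loc avC (fun x => Real.log (NE x)) (KC (qC E k0)) (Real.log E) (3 * k0 + 3) := by
  have E0 : 0 < E := by linarith
  have q0 := qC_pos E0 k0
  have q1 := qC_lt E0 k0
  have e0 := epsC_pos E0 k0
  have low : ∀ x y, 1 - qC E k0 ≤ 1 - qC E k0 * tt x y := fun x y => by
    have := tt_le x y
    nlinarith
  refine ⟨Real.log_nonneg (by linarith), fun x y => by rw [KC, KC, tt_symm], fun x y => ?_, fun x y => ?_,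
    fun ι _ x c => KC_psd q0.le q1 x c, fun x y hw => ?_⟩
  · have := tt_nonneg x y
    have := low x y
    have := Real.log_nonpos (x := 1 - qC E k0 * tt x y) (by linarith) (by nlinarith)
    rw [KC]; linarith
  · have h1 := Real.log_le_log (by linarith) (low x y)
    have h2 : (1 - qC E k0)⁻¹ = 1 + (epsC E k0)⁻¹ := by
      have : 1 - qC E k0 = epsC E k0 / (1 + epsC E k0) := by
        rw [qC, eq_div_iff (by positivity), sub_mul, one_div, inv_mul_cancel₀ (by positivity)]; ring
      rw [this, inv_div, add_div, div_self e0.ne', one_div, add_comm]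
    have h3 : (epsC E k0)⁻¹ = 4 * 2 ^ k0 * E ^ (4 * k0) := by
      have e4 : E ^ (4 * k0) = (E ^ (2 * k0)) ^ 2 := by rw [← pow_mul]; congr 1; ring
      rw [epsC, e4, one_div, inv_pow, inv_pow]
      field_simp
    have h4 : (1 - qC E k0)⁻¹ ≤ E ^ (5 * k0 + 3) := by
      rw [h2, h3]
      have g1 : (1 : ℝ) ≤ 4 * 2 ^ k0 * E ^ (4 * k0) := by
        have a1 : (1 : ℝ) ≤ 2 ^ k0 := one_le_pow₀ (by norm_num)
        have a2 : (1 : ℝ) ≤ E ^ (4 * k0) := one_le_pow₀ (by linarith)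
        nlinarith
      calc 1 + 4 * 2 ^ k0 * E ^ (4 * k0) ≤ 2 ^ 3 * 2 ^ k0 * E ^ (4 * k0) := by linarith
        _ ≤ E ^ 3 * E ^ k0 * E ^ (4 * k0) := by gcongr
        _ = _ := by ring
    have h5 := Real.log_le_log (inv_pos.2 (by linarith)) h4
    rw [Real.log_inv, Real.log_pow] at h5
    push_cast at h5
    have : 0 ≤ Real.log E := Real.log_nonneg (by linarith)
    have : 0 ≤ k0 * Real.log E := by positivity
    rw [KC]
    nlinarith
  · have hx : x ≠ 0 := by rintro rfl; simp [wedge] at hw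
    have hy : y ≠ 0 := by rintro rfl; simp [wedge] at hw
    have px := nsq_pos hx
    have py := nsq_pos hy
    have pw : 0 < Complex.normSq (wedge x y) := Complex.normSq_pos.2 hw
    have h : 1 - tt x y ≤ 1 - qC E k0 * tt x y := by
      have := tt_nonneg x y
      nlinarith
    have h' := one_sub_tt hx hy
    have h1 := Real.log_le_log (h' ▸ by positivity) h
    rw [h', Real.log_div (by positivity) (by positivity), Real.log_mul (by positivity) (by positivity)] at h1
    rw [KC, avC_apply, log_norm, log_NE, log_NE]
    linarith

lemma NE_pos {x : ℂ × ℂ} (hx : x ≠ 0) : 0 < NE x := Real.sqrt_pos.2 (nsq_pos hx)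

lemma NE_smul (c : ℂ) (x : ℂ × ℂ) : NE (c • x) = ‖c‖ * NE x := by
  have : nsq (c • x) = ‖c‖ ^ 2 * nsq x := by
    simp [nsq, Complex.normSq_eq_norm_sq]; ring
  rw [NE, this, Real.sqrt_mul (by positivity), Real.sqrt_sq (norm_nonneg _), NE]

lemma le_NE1 (x : ℂ × ℂ) : ‖x.1‖ ≤ NE x := by
  apply Real.le_sqrt_of_sq_le; simp only [nsq, Complex.normSq_eq_norm_sq]; nlinarith [sq_nonneg ‖x.2‖]
lemma le_NE2 (x : ℂ × ℂ) : ‖x.2‖ ≤ NE x := by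
  apply Real.le_sqrt_of_sq_le; simp only [nsq, Complex.normSq_eq_norm_sq]; nlinarith [sq_nonneg ‖x.1‖]
lemma NE_le (x : ℂ × ℂ) : NE x ≤ ‖x.1‖ + ‖x.2‖ := by
  rw [NE, Real.sqrt_le_left (by positivity)]
  simp only [nsq, Complex.normSq_eq_norm_sq]; nlinarith [norm_nonneg x.1, norm_nonneg x.2]

lemma LocL_C : LocL avC (fun x => Real.log (NE x)) where
  hom c x hc hx := by
    simp only [NE_smul]
    exact Real.log_mul (norm_ne_zero_iff.2 hc) (NE_pos hx).ne'
  c1 x hx := Real.log_le_log (avC.pos hx) (le_NE1 x)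
  c2 x hx := Real.log_le_log (avC.pos hx) (le_NE2 x)

lemma mx_le_NE (x : ℂ × ℂ) : mx avC x ≤ NE x := max_le (le_NE1 x) (le_NE2 x)
lemma NE_le_mx (x : ℂ × ℂ) : NE x ≤ 2 * mx avC x := by
  have := NE_le x
  have h1 : ‖x.1‖ ≤ mx avC x := le_max_left _ _
  have h2 : ‖x.2‖ ≤ mx avC x := le_max_right _ _
  linarith

lemma LocF_C {d : ℕ} (hd : 2 ≤ d) {a b : Fin (d + 1) → ℂ} {E : ℝ} (hm : 1 ≤ Real.log E) (hE : 2 ≤ E)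
    (h : LF avC 2 E a b) (k0 : ℕ) :
    LocF (fun x => Real.log (NE x)) (KC (qC E k0)) (Real.log E) k0 a b := by
  have E0 : 0 < E := by linarith
  constructor
  · intro x hx
    exact h.step LN_C mx_le_NE NE_le_mx x hx
  · set r : ℝ := (E ^ (2 * k0))⁻¹ with hr
    have r0 : 0 < r := by positivity
    have r1 : r ≤ 1 := inv_le_one_of_one_le₀ (one_le_pow₀ (by linarith))
    have avr : avC (r : ℂ) = r := by rw [avC_apply, Complex.norm_real, Real.norm_of_nonneg r0.le]
    refine h.p4 LN_C hd mx_le_NE (r : ℂ) ?_ ?_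
    · rw [avr, hr, inv_mul_cancel₀ (by positivity)]
    · intro x hx
      refine ⟨(- (starRingEnd ℂ) x.2, (starRingEnd ℂ) x.1), ?_, fun W hW => ?_⟩
      · simp only [mx, avC_apply, norm_neg, Complex.norm_conj]; rw [max_comm]
      set y : ℂ × ℂ := (- (starRingEnd ℂ) x.2, (starRingEnd ℂ) x.1) with hy
      have px := nsq_pos hx
      have pW := nsq_pos hW
      have wy : Complex.normSq (wedge y W) = tt x W * (nsq x * nsq W) := by
        rw [tt, div_mul_cancel₀ _ (by positivity)]
        have : wedge y W = - (starRingEnd ℂ) (hip x W) := by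
          simp [wedge, hip, hy]; ring
        rw [this, Complex.normSq_neg, Complex.normSq_conj]
      have wx : Complex.normSq (wedge x W) = (1 - tt x W) * (nsq x * nsq W) := by
        rw [one_sub_tt hx hW, div_mul_cancel₀ _ (by positivity)]
      set M := max (avC (wedge x W)) (avC (r : ℂ) * avC (wedge y W)) with hM
      set t := tt x W with ht
      have t0 := tt_nonneg x W
      have t1 := tt_le x W
      have M0 : 0 ≤ M := (avC.nonneg _).trans (le_max_left _ _)
      have Ma : (1 - t) * (nsq x * nsq W) ≤ M ^ 2 := by
        rw [← wx, Complex.normSq_eq_norm_sq]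
        exact pow_le_pow_left₀ (norm_nonneg _) (le_max_left _ _) 2
      have Mb : r ^ 2 * (t * (nsq x * nsq W)) ≤ M ^ 2 := by
        rw [← wy, Complex.normSq_eq_norm_sq, ← mul_pow]
        refine pow_le_pow_left₀ (by positivity) ?_ 2
        have := le_max_right (avC (wedge x W)) (avC (r : ℂ) * avC (wedge y W))
        rw [avr] at this; rw [hM, avr]; exact this
      set P := nsq x * nsq W with hP
      have pP : 0 < P := by positivity
      have hε : epsC E k0 = r ^ 2 * (1 / 2) ^ k0 / 4 := rfl
      have e0 := epsC_pos E0 k0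
      set h2 : ℝ := (1 / 2) ^ k0 with hh2
      have h20 : 0 < h2 := by positivity
      have rr : r ^ 2 ≤ 1 := pow_le_one₀ r0.le r1
      have main : (1 - qC E k0 * t) * P ≤ M ^ 2 * (1 + 2 * h2) := by
        have s1 : 1 - qC E k0 * t ≤ (1 - t) + epsC E k0 := by
          rw [qC, one_div, ← div_eq_inv_mul, sub_le_iff_le_add]
          have : t / (1 + epsC E k0) ≥ t - epsC E k0 := by
            rw [ge_iff_le, le_div_iff₀ (by linarith)]; nlinarith
          linarith
        have s2 : epsC E k0 * P ≤ M ^ 2 * (2 * h2) := by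
          rw [hε]
          rcases le_total (1 / 2) t with hc | hc
          · have : r ^ 2 * P ≤ 2 * M ^ 2 := by
              have : r ^ 2 * ((1 / 2) * P) ≤ r ^ 2 * (t * P) := by gcongr
              linarith
            have := mul_le_mul_of_nonneg_right this h20.le
            have : 0 ≤ M ^ 2 * h2 := by positivity
            nlinarith
          · have a1 : P ≤ 2 * M ^ 2 := by
              have : (1 / 2) * P ≤ (1 - t) * P := by gcongr; linarith
              linarith
            have a2 : r ^ 2 * P ≤ 2 * M ^ 2 := (mul_le_of_le_one_left pP.le rr).trans a1
            have := mul_le_mul_of_nonneg_right a2 h20.le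
            have : 0 ≤ M ^ 2 * h2 := by positivity
            nlinarith
        have s3 := mul_le_mul_of_nonneg_right s1 pP.le
        linarith
      have pq : 0 < 1 - qC E k0 * t := by
        have := qC_pos E0 k0
        have := qC_lt E0 k0
        nlinarith
      have pM2 : 0 < M ^ 2 := by
        have : 0 < (1 - qC E k0 * t) * P := by positivity
        exact pos_of_mul_pos_left (this.trans_le main) (by positivity)
      have pM : 0 < M := by
        rcases M0.lt_or_eq with h | h
        · exact h
        · rw [← h] at pM2; norm_num at pM2
      refine ⟨pM, ?_⟩
      have l := Real.log_le_log (by positivity) main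
      rw [Real.log_mul pq.ne' pP.ne', Real.log_mul pM2.ne' (by positivity),
        Real.log_pow, hP, Real.log_mul (by positivity) (by positivity)] at l
      have l2 : Real.log (1 + 2 * h2) ≤ 2 * h2 := by
        have := Real.log_le_sub_one_of_pos (x := 1 + 2 * h2) (by positivity)
        linarith
      have l3 : h2 * 1 ≤ h2 * Real.log E := by gcongr
      rw [log_NE, log_NE, KC]
      push_cast at l
      linarith

lemma LocZ_C (J : ℕ) : LocZ avC (fun x => Real.log (NE x)) J (Real.log (2 * ((J : ℝ) + 1) ^ 2)) := by
  have hJ : (0 : ℝ) ≤ J := Nat.cast_nonneg J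
  refine ⟨Real.log_nonneg (by nlinarith), fun p hp => ?_⟩
  have pp := NE_pos hp
  have key : ∀ i j : ℕ, i < J → j < i → 2 * ((J : ℝ) + 1) * ‖wedge p ((i : ℂ), 1)‖ < NE p →
      NE p ≤ 2 * ((J : ℝ) + 1) * ‖wedge p ((j : ℂ), 1)‖ := by
    intro i j hi hj h1
    by_contra! h2
    have e : ((i : ℂ) - j) * p.2 = wedge p ((j : ℂ), 1) - wedge p ((i : ℂ), 1) := by
      simp only [wedge]; ring
    have e2 : p.1 = wedge p ((i : ℂ), 1) + p.2 * i := by simp [wedge]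
    have a1 : ‖p.2‖ ≤ ‖wedge p ((j : ℂ), 1)‖ + ‖wedge p ((i : ℂ), 1)‖ := by
      refine le_trans ?_ (norm_sub_le _ _)
      rw [← e, norm_mul]
      refine le_mul_of_one_le_left (norm_nonneg _) ?_
      rw [← Nat.cast_sub hj.le, Complex.norm_natCast]
      exact_mod_cast Nat.le_sub_of_add_le (by omega)
    have a2 : ‖p.1‖ ≤ ‖wedge p ((i : ℂ), 1)‖ + ‖p.2‖ * i := by
      conv_lhs => rw [e2]
      refine (norm_add_le _ _).trans ?_
      rw [norm_mul, Complex.norm_natCast]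
    have a3 := NE_le p
    have hi' : (i : ℝ) + 1 ≤ J := by exact_mod_cast hi
    have a4 : ‖p.2‖ * i ≤ ‖p.2‖ * (J - 1) := by gcongr; linarith
    have a5 : NE p ≤ ‖wedge p ((i : ℂ), 1)‖ + ‖p.2‖ * J := by linarith
    have a6 : ‖p.2‖ * J ≤ (‖wedge p ((j : ℂ), 1)‖ + ‖wedge p ((i : ℂ), 1)‖) * J := by gcongr
    have := norm_nonneg (wedge p ((i : ℂ), 1))
    have := norm_nonneg (wedge p ((j : ℂ), 1))
    nlinarith
  have fin : ∀ j : ℕ, j < J → NE p ≤ 2 * ((J : ℝ) + 1) * ‖wedge p ((j : ℂ), 1)‖ → wedge p ((j : ℂ), 1) ≠ 0 ∧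
      Real.log (NE p) + Real.log (NE ((j : ℂ), 1)) - Real.log (2 * ((J : ℝ) + 1) ^ 2) ≤
        Real.log (avC (wedge p ((j : ℂ), 1))) := by
    intro j hj h
    have hp : 0 < ‖wedge p ((j : ℂ), 1)‖ := by
      have := pp.trans_le h
      exact pos_of_mul_pos_right this (by positivity)
    refine ⟨norm_pos_iff.1 hp, ?_⟩
    have hz : NE ((j : ℂ), 1) ≤ (J : ℝ) + 1 := by
      refine (NE_le _).trans ?_
      simp only [Complex.norm_natCast, norm_one]
      gcongr
    have hz0 : 0 < NE ((j : ℂ), 1) := NE_pos (by simp)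
    have := Real.log_le_log (by positivity) (mul_le_mul h hz hz0.le (by positivity))
    rw [Real.log_mul pp.ne' hz0.ne', show 2 * ((J : ℝ) + 1) * ‖wedge p ((j : ℂ), 1)‖ * (J + 1) =
      2 * ((J : ℝ) + 1) ^ 2 * ‖wedge p ((j : ℂ), 1)‖ by ring, Real.log_mul (by positivity) hp.ne'] at this
    rw [avC_apply]; linarith
  by_cases hex : ∃ i < J, 2 * ((J : ℝ) + 1) * ‖wedge p ((i : ℂ), 1)‖ < NE p
  · obtain ⟨i, hi, h⟩ := hex
    refine ⟨i, fun j hj hne => fin j hj ?_⟩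
    rcases lt_or_gt_of_ne hne with hlt | hlt
    · exact key i j hi hlt h
    · by_contra! h2
      exact absurd h (key j i hj hlt h2).not_gt
  · push Not at hex
    exact ⟨0, fun j hj _ => fin j hj (hex j hj)⟩

end arch
end BD

namespace BD

section glob
variable {k : Type} [Field k]

def IsFac {d : ℕ} (a b : Fin (d + 1) → k) (n : ℕ) (z : k × k) (W : Fin (d ^ n) → k × k) : Prop :=
  ∀ (B : Type) [CommRing B] (φ : k →+* B) (x : B × B),
    wedge ((Fm (φ ∘ a) (φ ∘ b))^[n] x) (mp φ z) = ∏ i, wedge x (mp φ (W i))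

lemma IsFac.self {d : ℕ} {a b : Fin (d + 1) → k} {n : ℕ} {z : k × k} {W : Fin (d ^ n) → k × k}
    (h : IsFac a b n z W) (x : k × k) : wedge ((Fm a b)^[n] x) z = ∏ i, wedge x (W i) :=
  h k (RingHom.id k) x

structure GH (h : k × k → ℝ) : Prop where
  nonneg : ∀ x, x ≠ 0 → 0 ≤ h x
  smul : ∀ (c : k) x, c ≠ 0 → x ≠ 0 → h (c • x) = h x

structure GKer (h : k × k → ℝ) (K : k × k → k × k → ℝ) (C0 T : ℝ) : Prop where
  symm : ∀ x y, K x y = K y x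
  nonneg : ∀ x y, 0 ≤ K x y
  le : ∀ x y, K x y ≤ T * C0
  psd : ∀ (ι : Type) [Fintype ι] (x : ι → k × k) (c : ι → ℝ), 0 ≤ ∑ i, ∑ j, c i * c j * K (x i) (x j)
  upper : ∀ x y, wedge x y ≠ 0 → K x y ≤ h x + h y

structure GMap (h : k × k → ℝ) (K : k × k → k × k → ℝ) (C0 T : ℝ) (k0 J : ℕ) (CJ : ℝ) {d : ℕ}
    (a b : Fin (d + 1) → k) : Prop where
  nz : NZ a b
  step : ∀ x, x ≠ 0 → |h (Fm a b x) - d * h x| ≤ C0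
  p4 : ∀ n, k0 ≤ n → ∀ z : k × k, z ≠ 0 → ∀ W : Fin (d ^ n) → k × k, (∀ i, W i ≠ 0) → IsFac a b n z W →
    ∀ x, x ≠ 0 → - h ((Fm a b)^[n] x) + (d : ℝ) ^ n * h x + ∑ i, h (W i) - h z
      - 5 * C0 * (1 / 2) ^ k0 * (d : ℝ) ^ n ≤ ∑ i, K x (W i)
  p6 : ∀ n, k0 ≤ n → ∀ W : Fin J → Fin (d ^ n) → k × k, (∀ j i, W j i ≠ 0) →
    (∀ j : Fin J, IsFac a b n (((j : ℕ) : k), 1) (W j)) → ∀ x y, x ≠ 0 → y ≠ 0 →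
    ∑ j, ∑ i, (K x (W j i) - K y (W j i)) ≤ J * (CJ + (d : ℝ) ^ n * h x - h ((Fm a b)^[n] x)
      - (d : ℝ) ^ n * h y + h ((Fm a b)^[n] y) + 5 * C0 * (1 / 2) ^ k0 * (d : ℝ) ^ n)
      + (d : ℝ) ^ n * (T + 2) * C0

/-- bilinear extension -/
def Bq {V : Type} (K : V → V → ℝ) : (V →₀ ℝ) →ₗ[ℝ] (V →₀ ℝ) →ₗ[ℝ] ℝ :=
  Finsupp.linearCombination ℝ fun x => Finsupp.linearCombination ℝ fun y => K x y

def avg {V ι : Type} [Fintype ι] (p : ι → V) : V →₀ ℝ := (Fintype.card ι : ℝ)⁻¹ • ∑ i, Finsupp.single (p i) 1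

lemma Bq_avg {V ι ι' : Type} [Fintype ι] [Fintype ι'] (K : V → V → ℝ) (p : ι → V) (p' : ι' → V) :
    Bq K (avg p) (avg p') = (Fintype.card ι : ℝ)⁻¹ * ((Fintype.card ι' : ℝ)⁻¹ * ∑ i, ∑ j, K (p i) (p' j)) := by
  simp [Bq, avg, map_sum, LinearMap.sum_apply, Finset.mul_sum]
  rw [Finset.sum_comm]
  simp only [mul_left_comm]

lemma Bq_single {V : Type} (K : V → V → ℝ) (x y : V) :
    Bq K (Finsupp.single x 1) (Finsupp.single y 1) = K x y := by
  simp [Bq]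

lemma Bq_avg_single {V ι : Type} [Fintype ι] (K : V → V → ℝ) (p : ι → V) (y : V) :
    Bq K (avg p) (Finsupp.single y 1) = (Fintype.card ι : ℝ)⁻¹ * ∑ i, K (p i) y := by
  simp [Bq, avg, map_sum, LinearMap.sum_apply]

lemma Bq_symm {V : Type} {K : V → V → ℝ} (hK : ∀ x y, K x y = K y x) (μ ν : V →₀ ℝ) : Bq K μ ν = Bq K ν μ := by
  simp only [Bq, Finsupp.linearCombination_apply, Finsupp.sum, LinearMap.sum_apply, LinearMap.smul_apply,
    smul_eq_mul, Finset.mul_sum]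
  rw [Finset.sum_comm]
  exact Finset.sum_congr rfl fun i _ => Finset.sum_congr rfl fun j _ => by rw [hK]; ring

lemma Bq_nonneg {V : Type} {K : V → V → ℝ}
    (hK : ∀ (ι : Type) [Fintype ι] (x : ι → V) (c : ι → ℝ), 0 ≤ ∑ i, ∑ j, c i * c j * K (x i) (x j))
    (μ : V →₀ ℝ) : 0 ≤ Bq K μ μ := by
  have := hK μ.support (fun i => i.1) (fun i => μ i.1)
  have e : Bq K μ μ = ∑ i : μ.support, ∑ j : μ.support, μ i.1 * μ j.1 * K i.1 j.1 := by
    simp only [Bq, Finsupp.linearCombination_apply, Finsupp.sum, LinearMap.sum_apply, LinearMap.smul_apply,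
      smul_eq_mul, Finset.mul_sum]
    rw [← Finset.sum_coe_sort μ.support]
    refine Finset.sum_congr rfl fun i _ => ?_
    rw [← Finset.sum_coe_sort μ.support]
    exact Finset.sum_congr rfl fun j _ => by ring
  rw [e]; exact this

/-- the Cauchy–Schwarz type inequality -/
lemma Bq_cs {V : Type} {K : V → V → ℝ} (hs : ∀ x y, K x y = K y x)
    (hK : ∀ (ι : Type) [Fintype ι] (x : ι → V) (c : ι → ℝ), 0 ≤ ∑ i, ∑ j, c i * c j * K (x i) (x j))
    (ν l1 l2 γ : V →₀ ℝ) {s : ℝ} (h0 : 0 < s) :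
    Bq K (l1 - l2) γ ≤ s * (Bq K (ν - l1) (ν - l1) + Bq K (ν - l2) (ν - l2)) + (2 * s)⁻¹ * Bq K γ γ := by
  have e : l1 - l2 = (ν - l2) - (ν - l1) := by abel
  rw [e]
  generalize ν - l1 = α
  generalize ν - l2 = β
  have h1 := Bq_nonneg hK (s • (β - α) - γ)
  have h2 := Bq_nonneg hK (α + β)
  simp only [map_sub, map_add, map_smul, LinearMap.sub_apply, LinearMap.add_apply, LinearMap.smul_apply,
    smul_eq_mul] at h1 h2 ⊢
  rw [Bq_symm hs γ β, Bq_symm hs γ α, Bq_symm hs α β] at h1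
  rw [Bq_symm hs α β] at h2
  have key : 2 * s * (Bq K β γ - Bq K α γ) ≤ 2 * s * (s * (Bq K α α + Bq K β β)) + Bq K γ γ := by
    have := mul_nonneg (sq_nonneg s) h2
    nlinarith
  have h3 := mul_le_mul_of_nonneg_left key (inv_nonneg.2 (by positivity : 0 ≤ 2 * s))
  rw [mul_add, inv_mul_cancel_left₀ (by positivity), inv_mul_cancel_left₀ (by positivity)] at h3
  linarith

variable {h : k × k → ℝ} {K : k × k → k × k → ℝ} {C0 T CJ : ℝ} {k0 J d : ℕ} {a b : Fin (d + 1) → k}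

lemma fac_wedge_ne [CharZero k] (hnz : NZ a b) {n : ℕ}
    {W : Fin J → Fin (d ^ n) → k × k} (hW0 : ∀ j i, W j i ≠ 0)
    (hW : ∀ j : Fin J, IsFac a b n (((j : ℕ) : k), 1) (W j)) {j j' : Fin J} (hj : j ≠ j') (i i' : Fin (d ^ n)) :
    wedge (W j i) (W j' i') ≠ 0 := by
  intro h0
  obtain ⟨c, hc⟩ := prop_of_wedge (hW0 j' i') h0
  have c0 : c ≠ 0 := by rintro rfl; exact hW0 j i (by simpa using hc)
  have z1 : wedge ((Fm a b)^[n] (W j i)) (((j : ℕ) : k), 1) = 0 := by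
    rw [(hW j).self]; exact Finset.prod_eq_zero (Finset.mem_univ i) (wedge_self _)
  have z2 : wedge ((Fm a b)^[n] (W j' i')) (((j' : ℕ) : k), 1) = 0 := by
    rw [(hW j').self]; exact Finset.prod_eq_zero (Finset.mem_univ i') (wedge_self _)
  rw [hc, Fm_iter_smul, wedge_smul_left] at z1
  have z1 := (mul_eq_zero.1 z1).resolve_left (pow_ne_zero _ c0)
  rw [wedge_swap, neg_eq_zero] at z1
  have := wedge_trans (hnz.iter n (hW0 j' i')) z1 z2
  simp only [wedge, mul_one, one_mul, sub_eq_zero, Nat.cast_inj] at this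
  exact hj (Fin.ext this)

lemma CI [CharZero k] (H : GH h) (HK : GKer h K C0 T) (HF : GMap h K C0 T k0 J CJ a b) (hd : 2 ≤ d)
    {n : ℕ} (hn : k0 ≤ n) {W : Fin J → Fin (d ^ n) → k × k} (hW0 : ∀ j i, W j i ≠ 0)
    (hW : ∀ j : Fin J, IsFac a b n (((j : ℕ) : k), 1) (W j)) {N : ℕ} (hN : 0 < N) (hJ : 0 < J)
    (x : Fin N → k × k) (hx : ∀ i, x i ≠ 0) (g : Fin N → Fin N → ℝ)
    (hg : ∀ i j, i ≠ j → K (x i) (x j) ≤ h (x i) + h (x j) - g i j) (hgd : ∀ i, g i i = 0) {H1 Hz : ℝ}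
    (h1 : ∀ i, h ((Fm a b)^[n] (x i)) ≤ H1) (hz : ∀ j : Fin J, h (((j : ℕ) : k), 1) ≤ Hz) :
    Bq K (avg x - avg fun p : Fin J × Fin (d ^ n) => W p.1 p.2)
      (avg x - avg fun p : Fin J × Fin (d ^ n) => W p.1 p.2) ≤
      T * C0 / N + T * C0 / J + 2 * H1 / (d : ℝ) ^ n + 2 * Hz / (d : ℝ) ^ n + 10 * (1 / 2) ^ k0 * C0
      - (∑ i, ∑ j, g i j) / (N : ℝ) ^ 2 := by
  have hN' : (0 : ℝ) < N := by exact_mod_cast hN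
  have hJ' : (0 : ℝ) < J := by exact_mod_cast hJ
  set D : ℝ := (d : ℝ) ^ n with hD
  have hD0 : 0 < D := by have : (0 : ℝ) < d := by exact_mod_cast (by omega : 0 < d)
                         positivity
  have hTC : 0 ≤ T * C0 := (HK.nonneg 0 0).trans (HK.le 0 0)
  simp only [map_sub, LinearMap.sub_apply]
  rw [Bq_symm HK.symm (avg fun p : Fin J × Fin (d ^ n) => W p.1 p.2) (avg x)]
  simp only [Bq_avg, Fintype.card_fin, Fintype.card_prod, Nat.cast_mul, Nat.cast_pow, ← hD]
  -- ν·ν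
  set A := ∑ i, h (x i) with hA
  set Wt := ∑ j, ∑ i, h (W j i) with hWt
  have t1 : ∑ i, ∑ j, K (x i) (x j) ≤ N * (T * C0) + 2 * N * A - ∑ i, ∑ j, g i j := by
    have : ∀ i j, K (x i) (x j) ≤ (if i = j then T * C0 else 0) + h (x i) + h (x j) - g i j := by
      intro i j
      split_ifs with hij
      · subst hij; rw [hgd]
        have := HK.le (x i) (x i); have := H.nonneg _ (hx i); linarith
      · have := hg i j hij; linarith
    refine (Finset.sum_le_sum fun i _ => Finset.sum_le_sum fun j _ => this i j).trans (le_of_eq ?_)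
    simp only [Finset.sum_sub_distrib, Finset.sum_add_distrib, Finset.sum_ite_eq, Finset.mem_univ, if_true,
      Finset.sum_const, Finset.card_univ, Fintype.card_fin, nsmul_eq_mul, ← Finset.mul_sum, ← hA]
    ring
  -- λ·λ
  have t2 : ∑ p : Fin J × Fin (d ^ n), ∑ p' : Fin J × Fin (d ^ n), K (W p.1 p.2) (W p'.1 p'.2) ≤
      J * D ^ 2 * (T * C0) + 2 * (J * D) * Wt := by
    have : ∀ p p' : Fin J × Fin (d ^ n), K (W p.1 p.2) (W p'.1 p'.2) ≤
        (if p.1 = p'.1 then T * C0 else 0) + h (W p.1 p.2) + h (W p'.1 p'.2) := by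
      intro p p'
      have e1 := H.nonneg _ (hW0 p.1 p.2)
      have e2 := H.nonneg _ (hW0 p'.1 p'.2)
      split_ifs with hij
      · have := HK.le (W p.1 p.2) (W p'.1 p'.2); linarith
      · have := HK.upper _ _ (fac_wedge_ne HF.nz hW0 hW hij p.2 p'.2); linarith
    refine (Finset.sum_le_sum fun i _ => Finset.sum_le_sum fun j _ => this i j).trans (le_of_eq ?_)
    have q0 : ∀ x : Fin J, ∑ x_2 : Fin J, ∑ _x_3 : Fin (d ^ n), (if x = x_2 then T * C0 else 0) = D * (T * C0) := by
      intro x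
      rw [Finset.sum_comm]; simp [hD]
    simp only [Finset.sum_add_distrib, Fintype.sum_prod_type, q0, Finset.sum_const, Finset.card_univ,
      nsmul_eq_mul, ← Finset.mul_sum, ← hWt, Fintype.card_prod, Fintype.card_fin, Nat.cast_mul, Nat.cast_pow, ← hD]
    ring
  -- ν·λ
  have t3 : ∀ i, - (J * H1) + J * D * h (x i) + Wt - J * Hz - 5 * C0 * (1 / 2) ^ k0 * D * J ≤
      ∑ p : Fin J × Fin (d ^ n), K (x i) (W p.1 p.2) := by
    intro i
    rw [Fintype.sum_prod_type]
    have e := Finset.sum_le_sum fun (j : Fin J) (_ : j ∈ Finset.univ) =>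
      HF.p4 n hn (((j : ℕ) : k), 1) (by simp) (W j) (hW0 j) (hW j) (x i) (hx i)
    refine le_trans ?_ e
    have e2 : ∑ j : Fin J, (- H1 + D * h (x i) + ∑ i, h (W j i) - Hz - 5 * C0 * (1 / 2) ^ k0 * D) ≤
      ∑ j : Fin J, (- h ((Fm a b)^[n] (x i)) + D * h (x i) + ∑ i, h (W j i) - h (((j : ℕ) : k), 1)
        - 5 * C0 * (1 / 2) ^ k0 * D) := by
      refine Finset.sum_le_sum fun j _ => ?_
      have := h1 i; have := hz j; linarith
    refine le_trans (le_of_eq ?_) e2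
    simp only [Finset.sum_sub_distrib, Finset.sum_add_distrib, Finset.sum_const, Finset.card_univ, Fintype.card_fin,
      nsmul_eq_mul, ← hWt]
    ring
  have t3' : N * (- (J * H1) + Wt - J * Hz - 5 * C0 * (1 / 2) ^ k0 * D * J) + J * D * A ≤
      ∑ i, ∑ p : Fin J × Fin (d ^ n), K (x i) (W p.1 p.2) := by
    refine le_trans (le_of_eq ?_) (Finset.sum_le_sum fun i _ => t3 i)
    simp only [Finset.sum_sub_distrib, Finset.sum_add_distrib, Finset.sum_const, Finset.card_univ, Fintype.card_fin,
      nsmul_eq_mul, ← Finset.mul_sum, ← hA]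
    ring
  have u1 := mul_le_mul_of_nonneg_left t1 (by positivity : 0 ≤ ((N : ℝ)⁻¹ * (N : ℝ)⁻¹))
  have u2 := mul_le_mul_of_nonneg_left t2 (by positivity : 0 ≤ ((J * D : ℝ)⁻¹ * (J * D : ℝ)⁻¹))
  have u3 := mul_le_mul_of_nonneg_left t3' (by positivity : 0 ≤ ((N : ℝ)⁻¹ * (J * D : ℝ)⁻¹))
  have v1 : ((N : ℝ)⁻¹ * (N : ℝ)⁻¹) * (N * (T * C0) + 2 * N * A - ∑ i, ∑ j, g i j) =
    T * C0 / N + 2 * (A / N) - (∑ i, ∑ j, g i j) / (N : ℝ) ^ 2 := by field_simp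
  have v2 : ((J * D : ℝ)⁻¹ * (J * D : ℝ)⁻¹) * (J * D ^ 2 * (T * C0) + 2 * (J * D) * Wt) =
    T * C0 / J + 2 * (Wt / (J * D)) := by field_simp
  have v3 : ((N : ℝ)⁻¹ * (J * D : ℝ)⁻¹) * (N * (- (J * H1) + Wt - J * Hz - 5 * C0 * (1 / 2) ^ k0 * D * J) + J * D * A) =
    - (H1 / D) + Wt / (J * D) - Hz / D - 5 * C0 * (1 / 2) ^ k0 + A / N := by field_simp
  rw [v1] at u1; rw [v2] at u2; rw [v3] at u3
  rw [mul_div_assoc 2 H1, mul_div_assoc 2 Hz]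
  rw [mul_assoc] at u1 u2 u3
  linarith

end glob
end BD

namespace BD

section
variable {k : Type} [Field k]

lemma h_iter_le {h : k × k → ℝ} {C0 : ℝ} (hC : 0 ≤ C0) {d : ℕ} (hd : 2 ≤ d) {a b : Fin (d + 1) → k} (nz : NZ a b)
    (step : ∀ x, x ≠ 0 → |h (Fm a b x) - d * h x| ≤ C0) (n : ℕ) {x : k × k} (hx : x ≠ 0) :
    h ((Fm a b)^[n] x) + C0 ≤ (d : ℝ) ^ n * (h x + C0) := by
  have hd' : (2 : ℝ) ≤ d := by exact_mod_cast hd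
  induction n with
  | zero => simp
  | succ n ih =>
    rw [Function.iterate_succ_apply']
    have := (abs_le.1 (step _ (nz.iter n hx))).2
    rw [pow_succ']
    nlinarith

lemma h_preper {h : k × k → ℝ} (H : GH h) {C0 : ℝ} (hC : 0 ≤ C0) {d : ℕ} (hd : 2 ≤ d) {a b : Fin (d + 1) → k}
    (nz : NZ a b) (step : ∀ x, x ≠ 0 → |h (Fm a b x) - d * h x| ≤ C0) {x : k × k} (hx : x ≠ 0) {m n : ℕ}
    (hmn : m < n) (hw : wedge ((Fm a b)^[n] x) ((Fm a b)^[m] x) = 0) (l : ℕ) : h ((Fm a b)^[l] x) ≤ C0 := by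
  have hd' : (2 : ℝ) ≤ d := by exact_mod_cast hd
  by_contra! hl
  have mono : ∀ j, h ((Fm a b)^[l] x) ≤ h ((Fm a b)^[l + j] x) ∧ h ((Fm a b)^[l + j] x) < h ((Fm a b)^[l + j + 1] x) := by
    have key : ∀ y, y ≠ 0 → C0 < h y → h y < h (Fm a b y) := by
      intro y hy hh
      have := (abs_le.1 (step y hy)).1
      nlinarith
    intro j
    induction j with
    | zero => exact ⟨le_rfl, by
        rw [add_zero, Function.iterate_succ_apply']
        exact key _ (nz.iter l hx) hl⟩
    | succ j ih =>
      have e : h ((Fm a b)^[l] x) ≤ h ((Fm a b)^[l + (j + 1)] x) := ih.1.trans ih.2.le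
      refine ⟨e, ?_⟩
      rw [Function.iterate_succ_apply' _ (l + (j + 1))]
      exact key _ (nz.iter _ hx) (lt_of_lt_of_le hl e)
  have sm : StrictMono fun j => h ((Fm a b)^[l + j] x) := strictMono_nat_of_lt_succ fun j => (mono j).2
  have lt := sm hmn
  simp only [Function.iterate_add_apply _ l] at lt
  obtain ⟨c, hc⟩ := prop_of_wedge (nz.iter m hx) hw
  have c0 : c ≠ 0 := by rintro rfl; exact nz.iter n hx (by simpa using hc)
  rw [hc, Fm_iter_smul, H.smul _ _ (pow_ne_zero _ c0) (nz.iter _ (nz.iter m hx))] at lt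
  exact lt_irrefl _ lt

def CJ (J : ℕ) : ℝ := Real.log (2 * ((J : ℝ) + 1) ^ 2) + Real.log (J.factorial : ℝ)

structure Glob {k : Type} [Field k] (h : k × k → ℝ) (K : ℕ → k × k → k × k → ℝ) (C0 : ℝ) {d e : ℕ}
    (a b : Fin (d + 1) → k) (a' b' : Fin (e + 1) → k) : Prop where
  H : GH h
  HK : ∀ k0 : ℕ, GKer h (K k0) C0 (3 * k0 + 3)
  HF : ∀ k0 J : ℕ, GMap h (K k0) C0 (3 * k0 + 3) k0 J (CJ J) a b
  HG : ∀ k0 J : ℕ, GMap h (K k0) C0 (3 * k0 + 3) k0 J (CJ J) a' b'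
  hz : ∀ j : ℕ, h ((j : k), 1) ≤ Real.log (j + 1)

/-- averaged p6 -/
lemma p6_avg {h : k × k → ℝ} {K : k × k → k × k → ℝ} {C0 T CJ : ℝ} {k0 J d : ℕ} {a b : Fin (d + 1) → k}
    (HF : GMap h K C0 T k0 J CJ a b) (HK : GKer h K C0 T) (hd : 2 ≤ d) (hJ : 0 < J)
    {n : ℕ} (hn : k0 ≤ n) {W : Fin J → Fin (d ^ n) → k × k} (hW0 : ∀ j i, W j i ≠ 0)
    (hW : ∀ j : Fin J, IsFac a b n (((j : ℕ) : k), 1) (W j)) {x y : k × k} (hx : x ≠ 0) (hy : y ≠ 0) :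
    Bq K (avg fun p : Fin J × Fin (d ^ n) => W p.1 p.2) (Finsupp.single x 1 - Finsupp.single y 1) ≤
      CJ / (d : ℝ) ^ n + h x - h ((Fm a b)^[n] x) / (d : ℝ) ^ n - h y + h ((Fm a b)^[n] y) / (d : ℝ) ^ n
      + 5 * C0 * (1 / 2) ^ k0 + (T + 2) * C0 / J := by
  have := HF.p6 n hn W hW0 hW x y hx hy
  have hJ' : (0 : ℝ) < J := by exact_mod_cast hJ
  set D : ℝ := (d : ℝ) ^ n with hD
  have hD0 : 0 < D := by have : (0 : ℝ) < d := by exact_mod_cast (by omega : 0 < d)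
                         positivity
  rw [map_sub, Bq_avg_single, Bq_avg_single, ← mul_sub, ← Finset.sum_sub_distrib, Fintype.sum_prod_type]
  simp only [Fintype.card_prod, Fintype.card_fin, Nat.cast_mul, Nat.cast_pow, ← hD]
  simp only [HK.symm _ x, HK.symm _ y]
  refine (mul_le_mul_of_nonneg_left this (by positivity)).trans (le_of_eq ?_)
  field_simp

theorem thmA_core {h : k × k → ℝ} {K : ℕ → k × k → k × k → ℝ} {C0 : ℝ} [CharZero k] {d e : ℕ} (hd : 2 ≤ d) (he : 2 ≤ e)
    {a b : Fin (d + 1) → k} {a' b' : Fin (e + 1) → k} (hC : 0 ≤ C0) (G : Glob h K C0 a b a' b') {k0 J n : ℕ}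
    (hk0 : 0 < k0) (hJ : 0 < J) (hn : k0 ≤ n) {W : Fin J → Fin (d ^ n) → k × k} (hW0 : ∀ j i, W j i ≠ 0)
    (hW : ∀ j : Fin J, IsFac a b n (((j : ℕ) : k), 1) (W j)) {W' : Fin J → Fin (e ^ n) → k × k}
    (hW0' : ∀ j i, W' j i ≠ 0) (hW' : ∀ j : Fin J, IsFac a' b' n (((j : ℕ) : k), 1) (W' j))
    (x : Fin J → k × k) (hx : ∀ i, x i ≠ 0) (hxx : ∀ i j, i ≠ j → wedge (x i) (x j) ≠ 0)
    (hxf : ∀ i, h ((Fm a b)^[n] (x i)) ≤ C0) (hxg : ∀ i, h ((Fm a' b')^[n] (x i)) ≤ C0)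
    {y : k × k} (hy : y ≠ 0) (hyf : h ((Fm a b)^[n] y) ≤ C0) :
    h ((Fm a' b')^[n] y) / (e : ℝ) ^ n ≤ (C0 * (1 / k0) + 10 * C0 * (1 / 2) ^ k0
      + 20 * C0 * ((3 * k0 + 3) * k0 * (1 / 2) ^ k0))
      + (2 * (3 * k0 + 5) * C0 + 4 * (3 * k0 + 3) ^ 2 * k0 * C0) / J
      + (2 * C0 + 2 * CJ J + 4 * (3 * k0 + 3) * k0 * (C0 + Real.log (J + 1))) / 2 ^ n := by
  have hk0' : (0 : ℝ) < k0 := by exact_mod_cast hk0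
  have hJ' : (0 : ℝ) < J := by exact_mod_cast hJ
  have hlJ : 0 ≤ Real.log (J + 1) := Real.log_nonneg (by linarith)
  have hCJ : 0 ≤ CJ J := by
    refine add_nonneg (Real.log_nonneg ?_) (Real.log_nonneg (by exact_mod_cast J.factorial_pos))
    nlinarith
  set T : ℝ := 3 * k0 + 3 with hT
  have hT0 : 0 < T := by positivity
  have p2 : (0 : ℝ) < 2 ^ n := by positivity
  have Df : (2 : ℝ) ^ n ≤ (d : ℝ) ^ n := pow_le_pow_left₀ (by norm_num) (by exact_mod_cast hd) n
  have Dg : (2 : ℝ) ^ n ≤ (e : ℝ) ^ n := pow_le_pow_left₀ (by norm_num) (by exact_mod_cast he) n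
  have dv : ∀ {c D : ℝ}, 0 ≤ c → (2 : ℝ) ^ n ≤ D → c / D ≤ c / 2 ^ n := fun hc hD =>
    div_le_div_of_nonneg_left hc p2 hD
  have x0 := hx ⟨0, hJ⟩
  set X0 := x ⟨0, hJ⟩ with hX0
  have i1 := p6_avg (G.HG k0 J) (G.HK k0) he hJ hn hW0' hW' hy x0
  have i2 := p6_avg (G.HF k0 J) (G.HK k0) hd hJ hn hW0 hW x0 hy
  have hzJ : ∀ j : Fin J, h (((j : ℕ) : k), 1) ≤ Real.log (J + 1) := fun j =>
    (G.hz j).trans (Real.log_le_log (by positivity) (by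
      have : ((j : ℕ) : ℝ) ≤ J := by exact_mod_cast j.2.le
      linarith))
  have gg : ∀ i j, i ≠ j → K k0 (x i) (x j) ≤ h (x i) + h (x j) - (fun _ _ => (0 : ℝ) : Fin J → Fin J → ℝ) i j := by
    intro i j hij
    have := (G.HK k0).upper _ _ (hxx i j hij)
    simpa using this
  have q1 := CI G.H (G.HK k0) (G.HF k0 J) hd hn hW0 hW hJ hJ x hx _ gg (fun _ => rfl) hxf hzJ
  have q2 := CI G.H (G.HK k0) (G.HG k0 J) he hn hW0' hW' hJ hJ x hx _ gg (fun _ => rfl) hxg hzJ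
  simp only [Finset.sum_const_zero, zero_div, sub_zero] at q1 q2
  have s0 : 0 < T * k0 := by positivity
  have cs := Bq_cs (G.HK k0).symm (G.HK k0).psd (avg x) (avg fun p : Fin J × Fin (e ^ n) => W' p.1 p.2)
    (avg fun p : Fin J × Fin (d ^ n) => W p.1 p.2) (Finsupp.single X0 1 - Finsupp.single y 1) s0
  have gm : Bq (K k0) (Finsupp.single X0 1 - Finsupp.single y 1) (Finsupp.single X0 1 - Finsupp.single y 1) ≤
      2 * (T * C0) := by
    simp only [map_sub, LinearMap.sub_apply, Bq_single]
    have := (G.HK k0).le X0 X0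
    have := (G.HK k0).le y y
    have := (G.HK k0).nonneg X0 y
    have := (G.HK k0).nonneg y X0
    linarith
  have e1 : Bq (K k0) ((avg fun p : Fin J × Fin (e ^ n) => W' p.1 p.2) - (avg fun p : Fin J × Fin (d ^ n) => W p.1 p.2))
      (Finsupp.single X0 1 - Finsupp.single y 1) =
      - Bq (K k0) (avg fun p : Fin J × Fin (e ^ n) => W' p.1 p.2) (Finsupp.single y 1 - Finsupp.single X0 1)
      - Bq (K k0) (avg fun p : Fin J × Fin (d ^ n) => W p.1 p.2) (Finsupp.single X0 1 - Finsupp.single y 1) := by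
    simp only [map_sub, LinearMap.sub_apply]; ring
  rw [e1] at cs
  have gm' : (2 * (T * k0))⁻¹ * Bq (K k0) (Finsupp.single X0 1 - Finsupp.single y 1) (Finsupp.single X0 1 - Finsupp.single y 1)
      ≤ C0 * (1 / k0) := by
    refine (mul_le_mul_of_nonneg_left gm (by positivity)).trans (le_of_eq ?_)
    field_simp
  have qq := mul_le_mul_of_nonneg_left (add_le_add q2 q1) s0.le
  have a1 : h ((Fm a' b')^[n] X0) / (e : ℝ) ^ n ≤ C0 / 2 ^ n :=
    (div_le_div_of_nonneg_right (hxg _) (by positivity)).trans (dv hC Dg)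
  have a2 : h ((Fm a b)^[n] y) / (d : ℝ) ^ n ≤ C0 / 2 ^ n :=
    (div_le_div_of_nonneg_right hyf (by positivity)).trans (dv hC Df)
  have a3 : 0 ≤ h ((Fm a b)^[n] X0) / (d : ℝ) ^ n :=
    div_nonneg (G.H.nonneg _ ((G.HF k0 J).nz.iter n x0)) (by positivity)
  have a4 := dv hCJ Df
  have a5 := dv hCJ Dg
  have b1 := dv (by positivity : 0 ≤ 2 * C0) Df
  have b2 := dv (by positivity : 0 ≤ 2 * C0) Dg
  have b3 := dv (by positivity : 0 ≤ 2 * Real.log (J + 1)) Df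
  have b4 := dv (by positivity : 0 ≤ 2 * Real.log (J + 1)) Dg
  have qq2 : T * k0 * (T * C0 / J + T * C0 / J + 2 * C0 / (e : ℝ) ^ n + 2 * Real.log (J + 1) / (e : ℝ) ^ n + 10 * (1 / 2) ^ k0 * C0 +
      (T * C0 / J + T * C0 / J + 2 * C0 / (d : ℝ) ^ n + 2 * Real.log (J + 1) / (d : ℝ) ^ n + 10 * (1 / 2) ^ k0 * C0)) ≤
      T * k0 * (4 * (T * C0 / J) + 2 * (2 * C0 / 2 ^ n) + 2 * (2 * Real.log (J + 1) / 2 ^ n) + 20 * (1 / 2) ^ k0 * C0) :=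
    mul_le_mul_of_nonneg_left (by linarith) s0.le
  have fin : h ((Fm a' b')^[n] y) / (e : ℝ) ^ n ≤ 2 * (C0 / 2 ^ n) + 2 * (CJ J / 2 ^ n) + 10 * C0 * (1 / 2) ^ k0
     + 2 * ((T + 2) * C0 / J) + C0 * (1 / k0) +
     T * k0 * (4 * (T * C0 / J) + 2 * (2 * C0 / 2 ^ n) + 2 * (2 * Real.log (J + 1) / 2 ^ n) + 20 * (1 / 2) ^ k0 * C0) := by
    linarith
  refine fin.trans (le_of_eq ?_)
  rw [show (3 * (k0 : ℝ) + 5) = T + 2 by rw [hT]; ring]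
  generalize (1 / 2 : ℝ) ^ k0 = r
  field_simp
  ring

open Filter Topology in
lemma params (C0 : ℝ) {η : ℝ} (hη : 0 < η) (k1 J1 : ℕ) : ∃ k0 J n0 : ℕ, 0 < k0 ∧ k1 ≤ k0 ∧ 0 < J ∧ J1 ≤ J ∧ k0 ≤ n0 ∧
    ∀ n, n0 ≤ n → (C0 * (1 / k0) + 10 * C0 * (1 / 2) ^ k0
      + 20 * C0 * ((3 * k0 + 3) * k0 * (1 / 2) ^ k0))
      + (2 * (3 * k0 + 5) * C0 + 4 * (3 * k0 + 3) ^ 2 * k0 * C0) / J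
      + (2 * C0 + 2 * CJ J + 4 * (3 * k0 + 3) * k0 * (C0 + Real.log (J + 1))) / 2 ^ n ≤ η := by
  have t1 : Tendsto (fun k0 : ℕ => C0 * (1 / (k0 : ℝ)) + 10 * C0 * (1 / 2) ^ k0
      + 20 * C0 * ((3 * k0 + 3) * k0 * (1 / 2) ^ k0)) atTop (𝓝 0) := by
    have e0 := (tendsto_one_div_atTop_nhds_zero_nat (𝕜 := ℝ)).const_mul C0
    have e1 := (tendsto_pow_atTop_nhds_zero_of_lt_one (r := (1 / 2 : ℝ)) (by norm_num) (by norm_num)).const_mul (10 * C0)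
    have e2 := (tendsto_pow_const_mul_const_pow_of_abs_lt_one 2 (r := (1 / 2 : ℝ)) (by norm_num [abs_of_pos])).const_mul (60 * C0)
    have e3 := (tendsto_pow_const_mul_const_pow_of_abs_lt_one 1 (r := (1 / 2 : ℝ)) (by norm_num [abs_of_pos])).const_mul (60 * C0)
    have := ((e0.add e1).add e2).add e3
    simp only [mul_zero, add_zero] at this
    refine this.congr fun k => ?_
    ring
  obtain ⟨k0, hk0, hk1⟩ := ((t1.eventually (gt_mem_nhds (by linarith : (0 : ℝ) < η / 3))).and
    (eventually_ge_atTop (k1 + 1))).exists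
  obtain ⟨J, hJ, hJ1⟩ := (((tendsto_const_div_atTop_nhds_zero_nat (2 * (3 * (k0 : ℝ) + 5) * C0 + 4 * (3 * k0 + 3) ^ 2 * k0 * C0)).eventually
    (gt_mem_nhds (by linarith : (0 : ℝ) < η / 3))).and (eventually_ge_atTop (J1 + 1))).exists
  have t3 : Tendsto (fun n : ℕ => (2 * C0 + 2 * CJ J + 4 * (3 * k0 + 3) * k0 * (C0 + Real.log (J + 1))) / (2 : ℝ) ^ n) atTop (𝓝 0) :=
    Tendsto.div_atTop tendsto_const_nhds (tendsto_pow_atTop_atTop_of_one_lt (by norm_num))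
  obtain ⟨n0, hn0⟩ := eventually_atTop.1 (t3.eventually (gt_mem_nhds (by linarith : (0 : ℝ) < η / 3)))
  refine ⟨k0, J, max n0 k0, by omega, by omega, by omega, by omega, le_max_right _ _, fun n hn => ?_⟩
  have := hn0 n ((le_max_left _ _).trans hn)
  linarith

lemma class_count {M Wc : ℕ} (cls : Fin M → Fin Wc) (hW : 0 < Wc) {l : ℝ} (hl : 0 ≤ l) :
    l * ((M : ℝ) ^ 2 / Wc - M) ≤ ∑ i, ∑ j, (if i ≠ j ∧ cls i = cls j then l else 0) := by
  classical
  have e1 : ∑ i, ∑ j, (if i ≠ j ∧ cls i = cls j then l else 0) =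
      l * ((∑ c : Fin Wc, ((Finset.univ.filter fun i => cls i = c).card : ℝ) ^ 2) - M) := by
    have : ∀ i j, (if i ≠ j ∧ cls i = cls j then l else 0) =
        l * ((∑ c : Fin Wc, (if cls i = c then 1 else 0) * (if cls j = c then 1 else 0)) - (if i = j then 1 else 0)) := by
      intro i j
      simp only [ite_mul, one_mul, zero_mul, Finset.sum_ite_eq, Finset.mem_univ, if_true]
      by_cases h1 : i = j
      · subst h1; simp
      · by_cases h2 : cls i = cls j
        · simp [h1, h2]
        · simp [h1, h2, Ne.symm h2]
    simp only [this, ← Finset.mul_sum, Finset.sum_sub_distrib]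
    congr 2
    · rw [Finset.sum_congr rfl fun i _ => Finset.sum_comm, Finset.sum_comm]
      refine Finset.sum_congr rfl fun c _ => ?_
      rw [sq, Finset.card_filter]
      push_cast
      rw [Finset.sum_mul_sum]
    · simp
  rw [e1]
  refine mul_le_mul_of_nonneg_left (sub_le_sub_right ?_ _) hl
  have hW' : (0 : ℝ) < Wc := by exact_mod_cast hW
  rw [div_le_iff₀ hW']
  have := sq_sum_le_card_mul_sum_sq (s := (Finset.univ : Finset (Fin Wc)))
    (f := fun c => ((Finset.univ.filter fun i => cls i = c).card : ℝ))
  have c : ∑ c : Fin Wc, ((Finset.univ.filter fun i => cls i = c).card : ℝ) = M := by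
    rw [← Nat.cast_sum, ← Finset.card_eq_sum_card_fiberwise (fun i _ => Finset.mem_univ _)]
    simp
  rw [c] at this
  simpa [mul_comm] using this

open Filter Topology in
theorem contra (C0 : ℝ) (hC : 0 ≤ C0) {l : ℝ} (hl : 0 < l) {Wc : ℕ} (hWc : 0 < Wc) {d e : ℕ} (hd : 2 ≤ d) (he : 2 ≤ e) :
    ∃ M J n : ℕ, ∀ (k : Type) [Field k] [CharZero k] (h : k × k → ℝ) (K : ℕ → k × k → k × k → ℝ)
    (a b : Fin (d + 1) → k) (a' b' : Fin (e + 1) → k), Glob h K C0 a b a' b' →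
    ∀ (W : Fin J → Fin (d ^ n) → k × k) (W' : Fin J → Fin (e ^ n) → k × k), (∀ j i, W j i ≠ 0) →
    (∀ j : Fin J, IsFac a b n (((j : ℕ) : k), 1) (W j)) → (∀ j i, W' j i ≠ 0) →
    (∀ j : Fin J, IsFac a' b' n (((j : ℕ) : k), 1) (W' j)) →
    ∀ (x : Fin J → k × k), (∀ i, x i ≠ 0) → (∀ i j, i ≠ j → wedge (x i) (x j) ≠ 0) →
    (∀ i, ∃ m n, m < n ∧ wedge ((Fm a b)^[n] (x i)) ((Fm a b)^[m] (x i)) = 0) →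
    (∀ i, ∃ m n, m < n ∧ wedge ((Fm a' b')^[n] (x i)) ((Fm a' b')^[m] (x i)) = 0) →
    ∀ (y : k × k), y ≠ 0 → (∃ m n, m < n ∧ wedge ((Fm a b)^[n] y) ((Fm a b)^[m] y) = 0) →
    ∀ (cls : Fin M → Fin Wc), (∀ i j : Fin M, i ≠ j → wedge ((Fm a' b')^[i] y) ((Fm a' b')^[j] y) ≠ 0) →
    (∀ k1, ∀ i j : Fin M, i ≠ j → cls i = cls j →
      K k1 ((Fm a' b')^[i] y) ((Fm a' b')^[j] y) ≤ h ((Fm a' b')^[i] y) + h ((Fm a' b')^[j] y) - l) → False := by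
  classical
  have hW' : (0 : ℝ) < Wc := by exact_mod_cast hWc
  have he' : (2 : ℝ) ≤ e := by exact_mod_cast he
  set g : ℝ := l / Wc with hg
  have g0 : 0 < g := by positivity
  have small : ∀ c : ℝ, ∃ n0 : ℕ, ∀ n, n0 ≤ n → c / (2 : ℝ) ^ n < g / 8 := fun c => by
    have t3 : Tendsto (fun n : ℕ => c / (2 : ℝ) ^ n) atTop (𝓝 0) :=
      Tendsto.div_atTop tendsto_const_nhds (tendsto_pow_atTop_atTop_of_one_lt (by norm_num))
    exact eventually_atTop.1 (t3.eventually (gt_mem_nhds (by linarith : (0 : ℝ) < g / 8)))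
  have small' : ∀ c : ℝ, ∃ n0 : ℕ, ∀ n : ℕ, n0 ≤ n → c / (n : ℝ) < g / 8 := fun c =>
    eventually_atTop.1 ((tendsto_const_div_atTop_nhds_zero_nat c).eventually
      (gt_mem_nhds (by linarith : (0 : ℝ) < g / 8)))
  obtain ⟨k1, hk1⟩ := small (10 * C0)
  have hk1 := hk1 k1 le_rfl
  set T1 : ℝ := 3 * k1 + 3 with hT1
  obtain ⟨M1, hM1⟩ := small' (T1 * C0)
  obtain ⟨M2, hM2⟩ := small' l
  set M := max (M1 + 1) M2 with hM
  have M0 : 0 < M := by omega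
  have hM1' := hM1 M (by omega)
  have hM2 := hM2 M (by omega)
  have eM : (0 : ℝ) < (e : ℝ) ^ M := by positivity
  obtain ⟨k0, J, n0, hk0, hk10, hJ, hJ1, hkn, hp⟩ := params C0 (by positivity : 0 < g / (16 * (e : ℝ) ^ M)) k1 M1
  obtain ⟨n1, hn1⟩ := small (2 * (e : ℝ) ^ M * C0)
  obtain ⟨n2, hn2⟩ := small (2 * Real.log (J + 1))
  set n := max n0 (max n1 n2) with hn
  have hn1 := hn1 n (by omega)
  have hn2 := hn2 n (by omega)
  have hp := hp n (by omega)
  refine ⟨M, J, n, ?_⟩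
  intro k _ _ h K a b a' b' G W W' hW0 hW hW0' hW' x hx hxx hxf hxg y hy hyf cls hu hgain
  have F0 := G.HF 0 0
  have G0 := G.HG 0 0
  have A := thmA_core hd he hC G hk0 hJ (by omega : k0 ≤ n) hW0 hW hW0' hW' x hx hxx
    (fun i => by obtain ⟨m', n', h1, h2⟩ := hxf i; exact h_preper G.H hC hd F0.nz F0.step (hx i) h1 h2 n)
    (fun i => by obtain ⟨m', n', h1, h2⟩ := hxg i; exact h_preper G.H hC he G0.nz G0.step (hx i) h1 h2 n) hy
    (by obtain ⟨m', n', h1, h2⟩ := hyf; exact h_preper G.H hC hd F0.nz F0.step hy h1 h2 n)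
  have A := A.trans hp
  have hzJ : ∀ j : Fin J, h (((j : ℕ) : k), 1) ≤ Real.log (J + 1) := fun j =>
    (G.hz j).trans (Real.log_le_log (by positivity) (by
      have : ((j : ℕ) : ℝ) ≤ J := by exact_mod_cast j.2.le
      linarith))
  have en : (0 : ℝ) < (e : ℝ) ^ n := by positivity
  have hH1 : ∀ i : Fin M, h ((Fm a' b')^[n] ((Fm a' b')^[i] y)) ≤ (e : ℝ) ^ M * (h ((Fm a' b')^[n] y) + C0) := by
    intro i
    rw [← Function.iterate_add_apply, add_comm, Function.iterate_add_apply]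
    have := h_iter_le hC he G0.nz G0.step i (G0.nz.iter n hy)
    have h0 := G.H.nonneg _ (G0.nz.iter n hy)
    have : (e : ℝ) ^ (i : ℕ) * (h ((Fm a' b')^[n] y) + C0) ≤ (e : ℝ) ^ M * (h ((Fm a' b')^[n] y) + C0) :=
      mul_le_mul_of_nonneg_right (pow_le_pow_right₀ (by linarith) i.2.le) (by linarith)
    linarith
  have Q := CI G.H (G.HK k1) (G.HG k1 J) he (by omega : k1 ≤ n) hW0' hW' M0 hJ (fun i : Fin M => (Fm a' b')^[i] y)
    (fun i => G0.nz.iter i hy) (fun i j => if i ≠ j ∧ cls i = cls j then l else 0) (by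
      intro i j hij
      by_cases hc : cls i = cls j
      · rw [if_pos ⟨hij, hc⟩]; exact hgain k1 i j hij hc
      · rw [if_neg (fun h => hc h.2), sub_zero]; exact (G.HK k1).upper _ _ (hu i j hij)) (by simp) hH1 hzJ
  have Q0 := (Bq_nonneg (G.HK k1).psd _).trans Q
  have cc := class_count cls hWc hl.le
  have M0' : (0 : ℝ) < M := by exact_mod_cast M0
  have cc2 := div_le_div_of_nonneg_right cc (by positivity : (0 : ℝ) ≤ (M : ℝ) ^ 2)
  have cc3 : l * ((M : ℝ) ^ 2 / Wc - M) / (M : ℝ) ^ 2 = g - l / M := by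
    rw [hg]; field_simp
  rw [cc3] at cc2
  have pe : (2 : ℝ) ^ n ≤ (e : ℝ) ^ n := pow_le_pow_left₀ (by norm_num) he' n
  have dv : ∀ {c : ℝ}, 0 ≤ c → c / (e : ℝ) ^ n ≤ c / 2 ^ n := fun hc =>
    div_le_div_of_nonneg_left hc (by positivity) pe
  have z1 : 2 * ((e : ℝ) ^ M * (h ((Fm a' b')^[n] y) + C0)) / (e : ℝ) ^ n ≤ g / 8 + g / 8 := by
    have : 2 * ((e : ℝ) ^ M * (h ((Fm a' b')^[n] y) + C0)) / (e : ℝ) ^ n =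
        2 * (e : ℝ) ^ M * (h ((Fm a' b')^[n] y) / (e : ℝ) ^ n) + (2 * (e : ℝ) ^ M * C0) / (e : ℝ) ^ n := by
      field_simp
    rw [this]
    refine add_le_add ?_ ((dv (by positivity)).trans hn1.le)
    refine (mul_le_mul_of_nonneg_left A (by positivity)).trans (le_of_eq ?_)
    field_simp
    norm_num
  have z2 : 2 * Real.log (J + 1) / (e : ℝ) ^ n ≤ g / 8 :=
    (dv (mul_nonneg (by norm_num) (Real.log_nonneg (by
      have : (0 : ℝ) ≤ J := by positivity
      linarith)))).trans hn2.le
  have z3 : T1 * C0 / J ≤ g / 8 := (hM1 J hJ1).le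
  have z4 : 10 * (1 / 2 : ℝ) ^ k1 * C0 ≤ g / 8 := by
    refine le_trans (le_of_eq ?_) hk1.le
    rw [one_div, inv_pow]; field_simp
  linarith

end
end BD

namespace BD

section locglob
variable {k : Type} [Field k]

structure LocF' (l : k × k → ℝ) (K : k × k → k × k → ℝ) (m : ℝ) (k0 : ℕ) {d : ℕ}
    (a b : Fin (d + 1) → k) : Prop where
  step : ∀ x, x ≠ 0 → |l (Fm a b x) - d * l x| ≤ m
  p4 : ∀ n, k0 ≤ n → ∀ z : k × k, z ≠ 0 → ∀ W : Fin (d ^ n) → k × k, (∀ i, W i ≠ 0) → IsFac a b n z W →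
    ∀ x, x ≠ 0 → - l ((Fm a b)^[n] x) + (d : ℝ) ^ n * l x + ∑ i, l (W i) - l z
      - 5 * m * (1 / 2) ^ k0 * (d : ℝ) ^ n ≤ ∑ i, K x (W i)

section pull
variable {k' : Type} [Field k'] (σ : k →+* k') {av : AbsoluteValue k' ℝ} {l : k' × k' → ℝ}
  {K : k' × k' → k' × k' → ℝ} {m T κ : ℝ} {k0 J d : ℕ} {a b : Fin (d + 1) → k}

lemma mp_ne {x : k × k} (hx : x ≠ 0) : mp σ x ≠ 0 := fun h =>
  hx (mp_inj σ.injective (h.trans (mp_zero σ).symm))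

lemma Loc.pull (h : Loc av l K m T) : Loc (av.comp σ.injective) (fun x => l (mp σ x))
    (fun x y => K (mp σ x) (mp σ y)) m T :=
  ⟨h.m0, fun _ _ => h.symm _ _, fun _ _ => h.nonneg _ _, fun _ _ => h.le _ _,
    fun ι _ x c => h.psd ι (fun i => mp σ (x i)) c, fun x y hxy => by
      have := h.upper (mp σ x) (mp σ y) (by rw [← wedge_map]; exact (map_ne_zero σ).2 hxy)
      rw [← wedge_map] at this
      exact this⟩

lemma LocL.pull (h : LocL av l) : LocL (av.comp σ.injective) (fun x => l (mp σ x)) :=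
  ⟨fun c x hc hx => by
      rw [mp_smul]; exact h.hom _ _ ((map_ne_zero σ).2 hc) (mp_ne σ hx),
    fun x hx => h.c1 (mp σ x) ((map_ne_zero σ).2 hx), fun x hx => h.c2 (mp σ x) ((map_ne_zero σ).2 hx)⟩

lemma mp_nat (j : ℕ) : mp σ ((j : k), 1) = ((j : k'), 1) := by simp [mp]

lemma LocZ.pull (h : LocZ av l J κ) : LocZ (av.comp σ.injective) (fun x => l (mp σ x)) J κ :=
  ⟨h.nonneg, fun p hp => by
    obtain ⟨j0, hj⟩ := h.sep (mp σ p) (mp_ne σ hp)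
    refine ⟨j0, fun j h1 h2 => ?_⟩
    obtain ⟨e1, e2⟩ := hj j h1 h2
    rw [← mp_nat σ, ← wedge_map] at e1 e2
    exact ⟨(map_ne_zero σ).1 e1, e2⟩⟩

lemma LocF.pull (h : LocF l K m k0 (σ ∘ a) (σ ∘ b)) :
    LocF' (fun x => l (mp σ x)) (fun x y => K (mp σ x) (mp σ y)) m k0 a b :=
  ⟨fun x hx => by
    have := h.step (mp σ x) (mp_ne σ hx)
    rw [← Fm_map] at this
    exact this,
   fun n hn z hz W hW hf x hx => by
    have := h.p4 n hn (mp σ z) (mp_ne σ hz) (fun i => mp σ (W i)) (fun i => mp_ne σ (hW i))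
      (fun p => hf (Polynomial k') (Polynomial.C.comp σ) p) (mp σ x) (mp_ne σ hx)
    rw [← Fm_iter_map] at this
    exact this⟩
end pull

lemma LocF'.iter {l : k × k → ℝ} {K : k × k → k × k → ℝ} {m : ℝ} {k0 d : ℕ} (hd : 2 ≤ d)
    {a b : Fin (d + 1) → k} (h : LocF' l K m k0 a b) (nz : NZ a b) (hm : 0 ≤ m) (n : ℕ) {x : k × k} (hx : x ≠ 0) :
    |l ((Fm a b)^[n] x) - (d : ℝ) ^ n * l x| ≤ ((d : ℝ) ^ n - 1) * m := by
  have hd' : (2 : ℝ) ≤ d := by exact_mod_cast hd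
  induction n with
  | zero => simp
  | succ n ih =>
    rw [Function.iterate_succ_apply', pow_succ']
    have := abs_le.1 (h.step _ (nz.iter n hx))
    have := abs_le.1 ih
    rw [abs_le]
    constructor <;> nlinarith

lemma loc_p6 {av : AbsoluteValue k ℝ} {l : k × k → ℝ} {K : k × k → k × k → ℝ} {m T κ : ℝ} {k0 J d : ℕ} (hd : 2 ≤ d)
    {a b : Fin (d + 1) → k} (nz : NZ a b) (hF : LocF' l K m k0 a b) (hK : Loc av l K m T) (hZ : LocZ av l J κ)
    {n : ℕ} (hn : k0 ≤ n) {W : Fin J → Fin (d ^ n) → k × k} (hW0 : ∀ j i, W j i ≠ 0)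
    (hW : ∀ j : Fin J, IsFac a b n (((j : ℕ) : k), 1) (W j)) {x y : k × k} (hx : x ≠ 0) (hy : y ≠ 0) :
    ∑ j, ∑ i, (K x (W j i) - K y (W j i)) ≤ J * (κ + (d : ℝ) ^ n * l x - l ((Fm a b)^[n] x)
      - (d : ℝ) ^ n * l y + l ((Fm a b)^[n] y) + 5 * m * (1 / 2) ^ k0 * (d : ℝ) ^ n)
      + (d : ℝ) ^ n * (T + 2) * m := by
  classical
  set D : ℝ := (d : ℝ) ^ n with hD
  have hd' : (2 : ℝ) ≤ d := by exact_mod_cast hd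
  have D0 : 0 < D := by positivity
  have m0 := hK.m0
  have Tm : 0 ≤ T * m := (hK.nonneg 0 0).trans (hK.le 0 0)
  set R : ℝ := κ + D * l x - l ((Fm a b)^[n] x) - D * l y + l ((Fm a b)^[n] y) + 5 * m * (1 / 2) ^ k0 * D with hR
  have R0 : - (2 * D * m) ≤ R := by
    have e1 := abs_le.1 (hF.iter hd nz m0 n hx)
    have e2 := abs_le.1 (hF.iter hd nz m0 n hy)
    have : 0 ≤ 5 * m * (1 / 2) ^ k0 * D := by positivity
    have := hZ.nonneg
    rw [← hD] at e1 e2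
    nlinarith
  obtain ⟨j0, hj0⟩ := hZ.sep ((Fm a b)^[n] x) (nz.iter n hx)
  have key : ∀ j : Fin J, ∑ i, (K x (W j i) - K y (W j i)) ≤ R + (if (j : ℕ) = j0 then D * (T + 2) * m else 0) := by
    intro j
    rw [Finset.sum_sub_distrib]
    split_ifs with hj
    · have e1 : ∑ i, K x (W j i) ≤ ∑ i : Fin (d ^ n), T * m := Finset.sum_le_sum fun i _ => hK.le _ _
      have e2 : 0 ≤ ∑ i, K y (W j i) := Finset.sum_nonneg fun i _ => hK.nonneg _ _
      simp only [Finset.sum_const, Finset.card_univ, Fintype.card_fin, nsmul_eq_mul, Nat.cast_pow, ← hD] at e1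
      nlinarith
    · obtain ⟨w0, w1⟩ := hj0 j j.2 hj
      rw [(hW j).self] at w0 w1
      have e1 : ∑ i, K x (W j i) ≤ ∑ i, (- Real.log (av (wedge x (W j i))) + l x + l (W j i)) :=
        Finset.sum_le_sum fun i _ => hK.upper _ _ (Finset.prod_ne_zero_iff.1 w0 i (Finset.mem_univ i))
      have e2 := hF.p4 n hn (((j : ℕ) : k), 1) (by simp) (W j) (hW0 j) (hW j) y hy
      rw [map_prod, Real.log_prod (fun i _ => av.ne_zero (Finset.prod_ne_zero_iff.1 w0 i (Finset.mem_univ i)))] at w1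
      simp only [Finset.sum_add_distrib, Finset.sum_neg_distrib, Finset.sum_const, Finset.card_univ, Fintype.card_fin,
        nsmul_eq_mul, Nat.cast_pow, ← hD] at e1
      rw [← hD] at e2
      linarith
  refine (Finset.sum_le_sum fun j _ => key j).trans ?_
  rw [Finset.sum_add_distrib]
  have B0 : 0 ≤ D * (T + 2) * m := by nlinarith [mul_nonneg D0.le Tm, mul_nonneg D0.le m0]
  refine add_le_add (by simp) ?_
  by_cases h : j0 < J
  · rw [Finset.sum_eq_single (⟨j0, h⟩ : Fin J)]
    · simp
    · intro j _ hj
      rw [if_neg]; intro h; exact hj (Fin.ext h)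
    · simp
  · rw [Finset.sum_eq_zero]
    · exact B0
    · intro j _; rw [if_neg]; intro h'; exact h (h' ▸ j.2)

variable {Ω : Type} {w : Ω → ℝ} {av : Ω → AbsoluteValue k ℝ} {l : Ω → k × k → ℝ} {h : k × k → ℝ}

lemma GH_of (w0 : ∀ v, 0 ≤ w v) (hl : ∀ x, x ≠ 0 → HasSum (fun v => w v * l v x) (h x))
    (pf : ∀ c : k, c ≠ 0 → HasSum (fun v => w v * Real.log (av v c)) 0) (hL : ∀ v, LocL (av v) (l v)) : GH h := by
  refine ⟨fun x hx => ?_, fun c x hc hx => ?_⟩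
  · by_cases h1 : x.1 = 0
    · have h2 : x.2 ≠ 0 := fun h2 => hx (Prod.ext h1 h2)
      exact hasSum_le (fun v => mul_le_mul_of_nonneg_left ((hL v).c2 x h2) (w0 v)) (pf _ h2) (hl x hx)
    · exact hasSum_le (fun v => mul_le_mul_of_nonneg_left ((hL v).c1 x h1) (w0 v)) (pf _ h1) (hl x hx)
  · have e1 := (pf c hc).add (hl x hx)
    rw [zero_add] at e1
    refine (hl (c • x) (smul_ne_zero hc hx)).unique ?_
    convert e1 using 2 with v
    rw [(hL v).hom c x hc hx]; ring

variable {K : Ω → k × k → k × k → ℝ} {Kt : k × k → k × k → ℝ} {m κ : Ω → ℝ} {C0 T CJ : ℝ}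

lemma upper_of (w0 : ∀ v, 0 ≤ w v) (hl : ∀ x, x ≠ 0 → HasSum (fun v => w v * l v x) (h x))
    (pf : ∀ c : k, c ≠ 0 → HasSum (fun v => w v * Real.log (av v c)) 0)
    (hKs : ∀ x y, HasSum (fun v => w v * K v x y) (Kt x y)) {e : Ω → ℝ} {E : ℝ} (he : HasSum (fun v => w v * e v) E)
    {x y : k × k} (hxy : wedge x y ≠ 0)
    (hu : ∀ v, K v x y ≤ - Real.log (av v (wedge x y)) + l v x + l v y + e v) : Kt x y ≤ h x + h y + E := by
  have hx : x ≠ 0 := by rintro rfl; exact hxy (by simp [wedge])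
  have hy : y ≠ 0 := by rintro rfl; exact hxy (by simp [wedge])
  have e1 := (((pf _ hxy).neg.add (hl x hx)).add (hl y hy)).add he
  rw [neg_zero, zero_add] at e1
  refine hasSum_le (fun v => ?_) (hKs x y) e1
  have := mul_le_mul_of_nonneg_left (hu v) (w0 v)
  linarith

lemma GKer_of (w0 : ∀ v, 0 ≤ w v) (hl : ∀ x, x ≠ 0 → HasSum (fun v => w v * l v x) (h x))
    (pf : ∀ c : k, c ≠ 0 → HasSum (fun v => w v * Real.log (av v c)) 0)
    (hKs : ∀ x y, HasSum (fun v => w v * K v x y) (Kt x y)) (hm : HasSum (fun v => w v * m v) C0)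
    (hK : ∀ v, Loc (av v) (l v) (K v) (m v) T) : GKer h Kt C0 T := by
  refine ⟨fun x y => ?_, fun x y => ?_, fun x y => ?_, fun ι _ x c => ?_, fun x y hxy => ?_⟩
  · refine (hKs x y).unique ?_
    convert hKs y x using 3 with v
    exact (hK v).symm x y
  · exact (hKs x y).nonneg fun v => mul_nonneg (w0 v) ((hK v).nonneg _ _)
  · refine hasSum_le (fun v => ?_) (hKs x y) (hm.mul_left T)
    have := mul_le_mul_of_nonneg_left ((hK v).le x y) (w0 v)
    linarith
  · have : HasSum (fun v => ∑ i, ∑ j, c i * c j * (w v * K v (x i) (x j))) (∑ i, ∑ j, c i * c j * Kt (x i) (x j)) :=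
      hasSum_sum fun i _ => hasSum_sum fun j _ => (hKs _ _).mul_left _
    refine this.nonneg fun v => ?_
    have e := mul_nonneg (w0 v) ((hK v).psd ι x c)
    simp only [Finset.mul_sum] at e
    refine e.trans (le_of_eq ?_)
    exact Finset.sum_congr rfl fun i _ => Finset.sum_congr rfl fun j _ => by ring
  · have := upper_of w0 hl pf hKs (e := 0) (E := 0) (by simp) hxy
      (fun v => by simpa using (hK v).upper x y hxy)
    simpa using this

lemma GMap_of {k0 J d : ℕ} (hd : 2 ≤ d) {a b : Fin (d + 1) → k} (nz : NZ a b)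
    (w0 : ∀ v, 0 ≤ w v) (hl : ∀ x, x ≠ 0 → HasSum (fun v => w v * l v x) (h x))
    (hKs : ∀ x y, HasSum (fun v => w v * K v x y) (Kt x y)) (hm : HasSum (fun v => w v * m v) C0)
    (hκ : HasSum (fun v => w v * κ v) CJ)
    (hK : ∀ v, Loc (av v) (l v) (K v) (m v) T) (hZ : ∀ v, LocZ (av v) (l v) J (κ v))
    (hF : ∀ v, LocF' (l v) (K v) (m v) k0 a b) : GMap h Kt C0 T k0 J CJ a b := by
  refine ⟨nz, fun x hx => ?_, fun n hn z hz W hW hf x hx => ?_, fun n hn W hW0 hW x y hx hy => ?_⟩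
  · have e1 := (hl _ (nz x hx)).sub ((hl x hx).mul_left (d : ℝ))
    rw [abs_le]
    constructor
    · refine hasSum_le (fun v => ?_) hm.neg e1
      have := mul_le_mul_of_nonneg_left (abs_le.1 ((hF v).step x hx)).1 (w0 v)
      linarith
    · refine hasSum_le (fun v => ?_) e1 hm
      have := mul_le_mul_of_nonneg_left (abs_le.1 ((hF v).step x hx)).2 (w0 v)
      linarith
  · have e1 := ((((hl _ (nz.iter n hx)).neg.add ((hl x hx).mul_left ((d : ℝ) ^ n))).add
      (hasSum_sum fun i (_ : i ∈ Finset.univ) => hl _ (hW i))).sub (hl z hz)).sub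
      (hm.mul_left (5 * (1 / 2) ^ k0 * (d : ℝ) ^ n))
    have e2 := hasSum_sum fun i (_ : i ∈ Finset.univ) => hKs x (W i)
    have := hasSum_le (fun v => ?_) e1 e2
    · linarith
    have := mul_le_mul_of_nonneg_left ((hF v).p4 n hn z hz W hW hf x hx) (w0 v)
    rw [← Finset.mul_sum, ← Finset.mul_sum]
    linarith
  · have e1 := hasSum_sum fun j (_ : j ∈ Finset.univ) => hasSum_sum fun i (_ : i ∈ Finset.univ) =>
      (hKs x (W j i)).sub (hKs y (W j i))
    have e2 := ((((((hκ.add ((hl x hx).mul_left ((d : ℝ) ^ n))).sub (hl _ (nz.iter n hx))).sub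
      ((hl y hy).mul_left ((d : ℝ) ^ n))).add (hl _ (nz.iter n hy))).add
      (hm.mul_left (5 * (1 / 2) ^ k0 * (d : ℝ) ^ n))).mul_left (J : ℝ)).add (hm.mul_left ((d : ℝ) ^ n * (T + 2)))
    have := hasSum_le (fun v => ?_) e1 e2
    · linarith
    have := mul_le_mul_of_nonneg_left (loc_p6 hd nz (hF v) (hK v) (hZ v) hn hW0 hW hx hy) (w0 v)
    simp only [← mul_sub, ← Finset.mul_sum]
    linarith

end locglob
end BD

namespace BD

def UBez {R : Type} [CommRing R] {q d : ℕ} (a b : Fin (d + 1) → R)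
    (u v u' v' : Fin (q + 1) → R) (S : R) : Prop :=
  ∀ (B : Type) [CommRing B] (φ : R →+* B), Bez (φ ∘ a) (φ ∘ b) (φ ∘ u) (φ ∘ v) (φ ∘ u') (φ ∘ v') (φ S)

/-- size conditions on `C0` and the data -/
structure Sz {L : Type} [Field L] (C0 A : ℝ) (S : L) (d q : ℕ) (a b : Fin (d + 1) → L) (u v u' v' : Fin (q + 1) → L) : Prop where
  ia : ∀ j, IsIntegral ℤ (a j)
  ib : ∀ j, IsIntegral ℤ (b j)
  iu : ∀ j, IsIntegral ℤ (u j)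
  iv : ∀ j, IsIntegral ℤ (v j)
  iu' : ∀ j, IsIntegral ℤ (u' j)
  iv' : ∀ j, IsIntegral ℤ (v' j)
  na : ∀ (σ : L →+* ℂ) j, ‖σ (a j)‖ ≤ A
  nb : ∀ (σ : L →+* ℂ) j, ‖σ (b j)‖ ≤ A
  nu : ∀ (σ : L →+* ℂ) j, ‖σ (u j)‖ ≤ A
  nv : ∀ (σ : L →+* ℂ) j, ‖σ (v j)‖ ≤ A
  nu' : ∀ (σ : L →+* ℂ) j, ‖σ (u' j)‖ ≤ A
  nv' : ∀ (σ : L →+* ℂ) j, ‖σ (v' j)‖ ≤ A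
  c2 : 2 ^ (3 * d + 2) * A * A ≤ Real.exp C0
  c3 : 2 ^ (q + d + 2) * A ≤ Real.exp C0
  bez : UBez a b u v u' v' S

section nf
open NumberField
variable (L : Type) [Field L] [NumberField L]

abbrev Om := InfinitePlace L ⊕ FinitePlace L

variable {L}

def wt : Om L → ℝ := Sum.elim (fun v => (v.mult : ℝ) * (Module.finrank ℚ L : ℝ)⁻¹) (fun _ => (Module.finrank ℚ L : ℝ)⁻¹)
def avO : Om L → AbsoluteValue L ℝ := Sum.elim (fun v => avC.comp v.embedding.injective) (fun v => v.1)
def lO : Om L → L × L → ℝ :=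
  Sum.elim (fun v x => Real.log (NE (mp v.embedding x))) (fun v x => Real.log (mx v.1 x))
def EO (C0 : ℝ) (S : L) (v : InfinitePlace L) : ℝ := Real.exp C0 / ‖v.embedding S‖
def mO (C0 : ℝ) (S : L) : Om L → ℝ := Sum.elim (fun v => Real.log (EO C0 S v)) (fun v => - Real.log (v.1 S))
def KO (C0 : ℝ) (S : L) (k0 : ℕ) : Om L → L × L → L × L → ℝ :=
  Sum.elim (fun v x y => KC (qC (EO C0 S v) k0) (mp v.embedding x) (mp v.embedding y))
    (fun v => Kna v.1 (v.1 S ^ (2 * k0)))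
def kO (J : ℕ) : Om L → ℝ :=
  Sum.elim (fun _ => Real.log (2 * ((J : ℝ) + 1) ^ 2)) (fun v => - Real.log (v.1 (J.factorial : L)))

lemma _root_.HasSum.congr_fun' {ι : Type} {f g : ι → ℝ} {a : ℝ} (h : HasSum f a) (e : ∀ i, g i = f i) : HasSum g a := by
  rw [funext e]; exact h

lemma wt_nonneg (v : Om L) : 0 ≤ wt v := by
  rcases v with v | v <;> simp only [wt, Sum.elim_inl, Sum.elim_inr] <;> positivity

lemma fin_na (v : FinitePlace L) : IsNonarchimedean v.1 := fun x y => FinitePlace.add_le v x y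

lemma fin_le {x : L} (hx : IsIntegral ℤ x) (v : FinitePlace L) : v.1 x ≤ 1 := by
  have := FinitePlace.norm_le_one (K := L) v.maximalIdeal (⟨x, hx⟩ : 𝓞 L)
  rw [FinitePlace.norm_embedding_eq] at this
  exact this

lemma sm_Om {F : Om L → ℝ} (h : {v : FinitePlace L | F (Sum.inr v) ≠ 0}.Finite) : Summable (fun v => wt v * F v) := by
  refine summable_of_finite_support (((Set.toFinite (Set.range Sum.inl : Set (Om L))).union (h.image Sum.inr)).subset ?_)
  rintro (v | v) hv
  · exact Or.inl ⟨v, rfl⟩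
  · refine Or.inr ⟨v, ?_, rfl⟩
    intro h0
    exact hv (by simp [h0])

lemma fin_supp {c : L} (hc : c ≠ 0) : {v : FinitePlace L | v.1 c ≠ 1}.Finite := FinitePlace.hasFiniteMulSupport hc

lemma pf_Om (c : L) (hc : c ≠ 0) : HasSum (fun v : Om L => wt v * Real.log (avO v c)) 0 := by
  have hfin := fin_supp hc
  set s := hfin.toFinset with hs
  have e := prod_abs_eq_one hc
  rw [finprod_eq_prod_of_mulSupport_subset (s := s) _ (by intro v hv; exact Finset.mem_coe.2 (hfin.mem_toFinset.2 hv))] at e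
  have e2 := congrArg Real.log e
  rw [Real.log_one, Real.log_mul, Real.log_prod, Real.log_prod] at e2
  rotate_left
  · intro v _; exact (FinitePlace.pos_iff.2 hc).ne'
  · intro v _; exact pow_ne_zero _ (InfinitePlace.pos_iff.2 hc).ne'
  · exact Finset.prod_ne_zero_iff.2 fun v _ => pow_ne_zero _ (InfinitePlace.pos_iff.2 hc).ne'
  · exact Finset.prod_ne_zero_iff.2 fun v _ => (FinitePlace.pos_iff.2 hc).ne'
  have h1 : HasSum ((fun v : Om L => wt v * Real.log (avO v c)) ∘ Sum.inl)
      ((Module.finrank ℚ L : ℝ)⁻¹ * ∑ v : InfinitePlace L, Real.log (v c ^ v.mult)) := by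
    rw [Finset.mul_sum]
    convert hasSum_fintype _ using 2 with v
    rename_i v _
    simp only [Function.comp, wt, avO, Sum.elim_inl, Real.log_pow]
    rw [← InfinitePlace.norm_embedding_eq v c]
    change _ = _ * Real.log ‖v.embedding c‖
    ring
  have h2 : HasSum ((fun v : Om L => wt v * Real.log (avO v c)) ∘ Sum.inr)
      ((Module.finrank ℚ L : ℝ)⁻¹ * ∑ v ∈ s, Real.log (v c)) := by
    rw [Finset.mul_sum]
    refine hasSum_sum_of_ne_finset_zero fun v hv => ?_
    have : v.1 c = 1 := by
      by_contra h; exact hv (by simpa [hs] using h)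
    simp [avO, this]
  have := HasSum.sum h1 h2
  rwa [← mul_add, e2, mul_zero] at this

lemma inf_Om (c : ℝ) : HasSum (fun v : Om L => wt v * Sum.elim (fun _ => c) (fun _ => 0) v) c := by
  have h1 : HasSum ((fun v : Om L => wt v * Sum.elim (fun _ => c) (fun _ => 0) v) ∘ Sum.inl) c := by
    convert hasSum_fintype _ using 1
    simp only [Function.comp, wt, Sum.elim_inl]
    rw [← Finset.sum_mul, ← Finset.sum_mul, ← Nat.cast_sum, InfinitePlace.sum_mult_eq, mul_inv_cancel₀, one_mul]
    exact_mod_cast (Module.finrank_pos (R := ℚ) (M := L)).ne'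
  have h2 : HasSum ((fun v : Om L => wt v * Sum.elim (fun _ => c) (fun _ => 0) v) ∘ Sum.inr) 0 := by
    convert hasSum_zero using 2 with v
    simp
  simpa using HasSum.sum h1 h2

lemma hm_Om (C0 : ℝ) {S : L} (hS : S ≠ 0) : HasSum (fun v : Om L => wt v * mO C0 S v) C0 := by
  have := (inf_Om (L := L) C0).sub (pf_Om S hS)
  rw [sub_zero] at this
  refine this.congr_fun' fun v => ?_
  rw [← mul_sub]
  congr 1
  rcases v with v | v
  · simp only [mO, Sum.elim_inl, EO, avO]
    rw [Real.log_div (Real.exp_ne_zero _) (by simpa using hS), Real.log_exp]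
    rfl
  · simp [mO, avO]

lemma hk_Om (J : ℕ) : HasSum (fun v : Om L => wt v * kO J v) (CJ J) := by
  have hc : (J.factorial : L) ≠ 0 := by exact_mod_cast J.factorial_ne_zero
  have := ((inf_Om (L := L) (Real.log (2 * ((J : ℝ) + 1) ^ 2))).add (inf_Om (Real.log (J.factorial : ℝ)))).sub (pf_Om _ hc)
  rw [sub_zero] at this
  refine this.congr_fun' fun v => ?_
  rw [← mul_add, ← mul_sub]
  congr 1
  rcases v with v | v
  · simp only [kO, Sum.elim_inl, avO]
    change _ = _ + _ - Real.log ‖v.embedding (J.factorial : L)‖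
    simp
  · simp [kO, avO]

lemma hl_Om (x : L × L) (hx : x ≠ 0) : HasSum (fun v : Om L => wt v * lO v x) (∑' v : Om L, wt v * lO v x) := by
  refine (sm_Om ?_).hasSum
  simp only [lO, Sum.elim_inr]
  by_cases h1 : x.1 = 0
  · have h2 : x.2 ≠ 0 := fun h2 => hx (Prod.ext h1 h2)
    refine (fin_supp h2).subset fun v hv hv' => hv ?_
    simp [mx, h1, hv']
  · by_cases h2 : x.2 = 0
    · refine (fin_supp h1).subset fun v hv hv' => hv ?_
      simp [mx, h2, hv']
    · refine ((fin_supp h1).union (fin_supp h2)).subset fun v hv => ?_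
      by_contra hn
      simp only [Set.mem_union, Set.mem_setOf_eq, not_or, not_not] at hn
      exact hv (by simp [mx, hn.1, hn.2])

lemma LocL_Om (v : Om L) : LocL (avO v) (lO v) := by
  rcases v with v | v
  · exact LocL_C.pull v.embedding
  · exact LocL_na

lemma LocZ_Om (J : ℕ) (v : Om L) : LocZ (avO v) (lO v) J (kO J v) := by
  rcases v with v | v
  · exact (LocZ_C J).pull v.embedding
  · exact LocZ_na (fin_na v) J

variable {C0 A : ℝ} {S : L}

lemma EO_ge (hS : S ≠ 0) (nS : ∀ σ : L →+* ℂ, ‖σ S‖ ≤ A) (c1 : 3 * A ≤ Real.exp C0) (v : InfinitePlace L) :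
    3 ≤ EO C0 S v := by
  have : 0 < ‖v.embedding S‖ := by simpa using hS
  rw [EO, le_div_iff₀ this]
  have := nS v.embedding
  linarith

lemma Loc_Om (hS : S ≠ 0) (iS : IsIntegral ℤ S) (nS : ∀ σ : L →+* ℂ, ‖σ S‖ ≤ A) (c1 : 3 * A ≤ Real.exp C0)
    (k0 : ℕ) (v : Om L) : Loc (avO v) (lO v) (KO C0 S k0 v) (mO C0 S v) (3 * k0 + 3) := by
  rcases v with v | v
  · exact (Loc_C (by have := EO_ge hS nS c1 v; linarith) k0).pull v.embedding
  · have h0 : 0 < v.1 S := v.1.pos hS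
    have h1 := fin_le iS v
    have hm : 0 ≤ - Real.log (v.1 S) := neg_nonneg.2 (Real.log_nonpos h0.le h1)
    refine Loc_na (fin_na v) (pow_pos h0 _) (pow_le_one₀ h0.le h1) hm ?_
    rw [Real.log_pow]
    have : (0 : ℝ) ≤ k0 := by positivity
    push_cast
    change _ ≤ (3 * (k0 : ℝ) + 3) * (-Real.log (v.1 S))
    nlinarith

lemma LocF_Om (hS : S ≠ 0) (iS : IsIntegral ℤ S) (nS : ∀ σ : L →+* ℂ, ‖σ S‖ ≤ A) (c1 : 3 * A ≤ Real.exp C0)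
    {d q : ℕ} (hd : 2 ≤ d) {a b : Fin (d + 1) → L} {u v u' v' : Fin (q + 1) → L} (hz : Sz C0 A S d q a b u v u' v')
    (k0 : ℕ) (p : Om L) : LocF' (lO p) (KO C0 S k0 p) (mO C0 S p) k0 a b := by
  rcases p with p | p
  · have E3 := EO_ge hS nS c1 p
    have pS : 0 < ‖p.embedding S‖ := by simpa using hS
    have A0 : 0 ≤ A := (norm_nonneg _).trans (nS p.embedding)
    have ab : ∀ t : ℂ, ‖t‖ ≤ A → (2 : ℝ) ^ (3 * d + 2) * avC t ≤ EO C0 S p := by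
      intro t ht
      rw [EO, le_div_iff₀ pS]
      refine le_trans ?_ hz.c2
      exact mul_le_mul (mul_le_mul_of_nonneg_left ht (by positivity)) (nS _) pS.le (by positivity)
    refine LocF.pull p.embedding (LocF_C hd ?_ (by linarith) (LF.of_bez LN_C (S := p.embedding S) (by simpa using hS)
      (hz.bez ℂ p.embedding) (by linarith) (fun j => ab _ (hz.na _ j)) (fun j => ab _ (hz.nb _ j))
      (hz.nu _) (hz.nv _) (hz.nu' _) (hz.nv' _) ?_ (by omega)) k0)
    · rw [Real.le_log_iff_exp_le (by linarith)]
      have := Real.exp_one_lt_d9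
      linarith
    · have : EO C0 S p * avC (p.embedding S) = Real.exp C0 := div_mul_cancel₀ _ pS.ne'
      rw [this]; exact hz.c3
  · have := LocF_na (fin_na p) hd hS (fin_le iS p) (hz.bez L (RingHom.id L)) (fun j => fin_le (hz.ia j) p)
      (fun j => fin_le (hz.ib j) p) (fun j => fin_le (hz.iu j) p) (fun j => fin_le (hz.iv j) p)
      (fun j => fin_le (hz.iu' j) p) (fun j => fin_le (hz.iv' j) p) k0
    exact LocF.pull (RingHom.id L) this

def hO (x : L × L) : ℝ := ∑' v : Om L, wt v * lO v x
def KtO (C0 : ℝ) (S : L) (k0 : ℕ) (x y : L × L) : ℝ := ∑' v : Om L, wt v * KO C0 S k0 v x y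

lemma hK_Om (hS : S ≠ 0) (iS : IsIntegral ℤ S) (nS : ∀ σ : L →+* ℂ, ‖σ S‖ ≤ A) (c1 : 3 * A ≤ Real.exp C0)
    (k0 : ℕ) (x y : L × L) : HasSum (fun v : Om L => wt v * KO C0 S k0 v x y) (KtO C0 S k0 x y) := by
  refine (Summable.of_nonneg_of_le (fun v => mul_nonneg (wt_nonneg v) ((Loc_Om hS iS nS c1 k0 v).nonneg x y))
    (fun v => ?_) ((hm_Om C0 hS).summable.mul_left (3 * (k0 : ℝ) + 3))).hasSum
  have := mul_le_mul_of_nonneg_left ((Loc_Om hS iS nS c1 k0 v).le x y) (wt_nonneg v)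
  linarith

theorem Glob_nf (hS : S ≠ 0) (iS : IsIntegral ℤ S) (nS : ∀ σ : L →+* ℂ, ‖σ S‖ ≤ A) (c1 : 3 * A ≤ Real.exp C0)
    {d q : ℕ} (hd : 2 ≤ d) {a b : Fin (d + 1) → L} {u v u' v' : Fin (q + 1) → L} (hz : Sz C0 A S d q a b u v u' v')
    {e r : ℕ} (he : 2 ≤ e) {a1 b1 : Fin (e + 1) → L} {u1 v1 u1' v1' : Fin (r + 1) → L}
    (hz1 : Sz C0 A S e r a1 b1 u1 v1 u1' v1') : Glob hO (KtO C0 S) C0 a b a1 b1 where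
  H := GH_of wt_nonneg hl_Om pf_Om LocL_Om
  HK k0 := GKer_of wt_nonneg hl_Om pf_Om (hK_Om hS iS nS c1 k0) (hm_Om C0 hS) (Loc_Om hS iS nS c1 k0)
  HF k0 J := GMap_of hd (Bez.nz (hz.bez L (RingHom.id L)) hS) wt_nonneg hl_Om (hK_Om hS iS nS c1 k0) (hm_Om C0 hS)
    (hk_Om J) (Loc_Om hS iS nS c1 k0) (LocZ_Om J) (LocF_Om hS iS nS c1 hd hz k0)
  HG k0 J := GMap_of he (Bez.nz (hz1.bez L (RingHom.id L)) hS) wt_nonneg hl_Om (hK_Om hS iS nS c1 k0) (hm_Om C0 hS)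
    (hk_Om J) (Loc_Om hS iS nS c1 k0) (LocZ_Om J) (LocF_Om hS iS nS c1 he hz1 k0)
  hz j := by
    refine hasSum_le (fun v => mul_le_mul_of_nonneg_left ?_ (wt_nonneg v)) (hl_Om ((j : L), 1) (by simp)) (inf_Om _)
    rcases v with v | v
    · simp only [lO, Sum.elim_inl]
      refine Real.log_le_log (NE_pos (by simp [mp])) ((NE_le _).trans ?_)
      simp [mp]
    · simp only [lO, Sum.elim_inr]
      have : v.1 (j : L) ≤ 1 := (fin_na v).apply_natCast_le_one
      simp [mx, this]

lemma gain_nf (hS : S ≠ 0) (iS : IsIntegral ℤ S) (nS : ∀ σ : L →+* ℂ, ‖σ S‖ ≤ A) (c1 : 3 * A ≤ Real.exp C0)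
    {e r : ℕ} (he : 2 ≤ e) {a1 b1 : Fin (e + 1) → L} {u1 v1 u1' v1' : Fin (r + 1) → L}
    (hz1 : Sz C0 A S e r a1 b1 u1 v1 u1' v1') {p : ℕ} (hp : p ≠ 0) {r0 s0 : L} (hr0 : IsIntegral ℤ r0) (hs0 : IsIntegral ℤ s0)
    (hrs : r0 * S + s0 * p = 1) {y : L × L} (hy1 : IsIntegral ℤ y.1) (hy2 : IsIntegral ℤ y.2) (hyS : y.1 = S ∨ y.2 = S)
    {i j : ℕ} {c : L} (hc : IsIntegral ℤ c) (hw : wedge ((Fm a1 b1)^[i] y) ((Fm a1 b1)^[j] y) = p * c)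
    (hw0 : wedge ((Fm a1 b1)^[i] y) ((Fm a1 b1)^[j] y) ≠ 0) (k1 : ℕ) :
    KtO C0 S k1 ((Fm a1 b1)^[i] y) ((Fm a1 b1)^[j] y) ≤ hO ((Fm a1 b1)^[i] y) + hO ((Fm a1 b1)^[j] y) - Real.log p := by
  have hpL : (p : L) ≠ 0 := by exact_mod_cast hp
  have hE := (pf_Om (p : L) hpL).sub (inf_Om (L := L) (Real.log p))
  simp only [← mul_sub, zero_sub] at hE
  rw [sub_eq_add_neg]
  refine upper_of (e := fun v => Real.log (avO v (p : L)) - Sum.elim (fun _ => Real.log p) (fun _ => 0) v)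
    wt_nonneg hl_Om pf_Om (hK_Om hS iS nS c1 k1) hE hw0 fun v => ?_
  have up := (Loc_Om hS iS nS c1 k1 v).upper _ _ hw0
  rcases v with v | v
  · have : avO (Sum.inl v) (p : L) = p := by
      change ‖v.embedding (p : L)‖ = p
      simp
    simp only [Sum.elim_inl, this, sub_self, add_zero]
    exact up
  · by_cases h1 : v.1 (p : L) = 1
    · have : avO (Sum.inr v) (p : L) = 1 := h1
      simp only [Sum.elim_inr, this, Real.log_one, sub_self, add_zero]
      exact up
    · have hp1 : v.1 (p : L) < 1 := lt_of_le_of_ne (fin_na v).apply_natCast_le_one h1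
      have vS : v.1 S = 1 := by
        by_contra hne
        have hlt : v.1 S < 1 := lt_of_le_of_ne (fin_le iS v) hne
        have : v.1 (r0 * S + s0 * p) < 1 := by
          refine lt_of_le_of_lt (fin_na v _ _) (max_lt ?_ ?_)
          · rw [map_mul]; exact mul_lt_one_of_nonneg_of_lt_one_right (fin_le hr0 v) (v.1.nonneg _) hlt
          · rw [map_mul]; exact mul_lt_one_of_nonneg_of_lt_one_right (fin_le hs0 v) (v.1.nonneg _) hp1
        rw [hrs, map_one] at this
        exact lt_irrefl _ this
      have l0 : lO (Sum.inr v) y = 0 := by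
        simp only [lO, Sum.elim_inr]
        have e1 := fin_le hy1 v
        have e2 := fin_le hy2 v
        have : mx v.1 y = 1 := by
          refine le_antisymm (max_le e1 e2) ?_
          rcases hyS with h | h
          · rw [← vS, ← h]; exact le_max_left _ _
          · rw [← vS, ← h]; exact le_max_right _ _
        rw [this, Real.log_one]
      have y0 : y ≠ 0 := by
        rintro rfl
        rcases hyS with h | h <;> exact hS h.symm
      have nz := Bez.nz (hz1.bez L (RingHom.id L)) hS
      have li : ∀ n, lO (Sum.inr v) ((Fm a1 b1)^[n] y) = 0 := by
        intro n
        have hm0 : mO C0 S (Sum.inr v) = 0 := by simp [mO, vS]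
        have := (LocF_Om hS iS nS c1 he hz1 k1 (Sum.inr v)).iter he nz (by rw [hm0]) n y0
        rw [hm0, mul_zero, l0, mul_zero, sub_zero] at this
        exact abs_nonpos_iff.1 this
      have hc0 : c ≠ 0 := by
        rintro rfl
        rw [mul_zero] at hw
        exact hw0 hw
      have K0 : KO C0 S k1 (Sum.inr v) ((Fm a1 b1)^[i] y) ((Fm a1 b1)^[j] y) = 0 := by
        simp only [KO, Sum.elim_inr, vS, one_pow]
        exact Kna_one (fin_na v) _ _
      rw [K0, li, li, hw]
      simp only [Sum.elim_inr, avO, map_mul, sub_zero, add_zero]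
      rw [Real.log_mul (v.1.ne_zero hpL) (v.1.ne_zero hc0)]
      have := Real.log_nonpos (v.1.nonneg c) (fin_le hc v)
      linarith

end nf
end BD

namespace BD

section descend
variable {R R' : Type} [CommRing R] [CommRing R'] {d q : ℕ}

lemma fac_map {B C : Type} [CommRing B] [CommRing C] (η : B →+* C) (φ : R →+* B) (a b : Fin (d + 1) → R) (n : ℕ)
    (z : R × R) (x : B × B) : η (wedge ((Fm (φ ∘ a) (φ ∘ b))^[n] x) (mp φ z)) =
      wedge ((Fm ((η.comp φ) ∘ a) ((η.comp φ) ∘ b))^[n] (mp η x)) (mp (η.comp φ) z) := by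
  rw [wedge_map, Fm_iter_map]; rfl

lemma fac_map' {B C : Type} [CommRing B] [CommRing C] (η : B →+* C) (φ : R →+* B) {N : ℕ} (W : Fin N → R × R)
    (x : B × B) : η (∏ i, wedge x (mp φ (W i))) = ∏ i, wedge (mp η x) (mp (η.comp φ) (W i)) := by
  rw [map_prod]; simp only [wedge_map]; rfl

def gX (R : Type) [CommRing R] : MvPolynomial (Fin 2) R × MvPolynomial (Fin 2) R := (X 0, X 1)

lemma gX_ev {B : Type} [CommRing B] (φ : R →+* B) (x : B × B) : mp (eval₂Hom φ ![x.1, x.2]) (gX R) = x := by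
  simp [mp, gX]
lemma gX_C {B : Type} [CommRing B] (φ : R →+* B) (x : B × B) : (eval₂Hom φ ![x.1, x.2]).comp C = φ := by
  ext; simp
lemma gX_map (ι : R →+* R') : mp (MvPolynomial.map ι) (gX R) = gX R' := by
  simp [mp, gX]
lemma gC_map (ι : R →+* R') : (MvPolynomial.map ι).comp C = (C : R' →+* MvPolynomial (Fin 2) R').comp ι := by
  ext; simp

lemma IsFac.descend {L k : Type} [Field L] [Field k] (ι : L →+* k) {a b : Fin (d + 1) → L} {n : ℕ} {z : L × L}
    {W : Fin (d ^ n) → L × L} (h : IsFac (ι ∘ a) (ι ∘ b) n (mp ι z) (fun i => mp ι (W i))) : IsFac a b n z W := by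
  have key : wedge ((Fm (C ∘ a) (C ∘ b))^[n] (gX L)) (mp C z) = ∏ i, wedge (gX L) (mp C (W i)) := by
    apply MvPolynomial.map_injective ι ι.injective
    rw [fac_map, fac_map', gX_map, gC_map]
    exact h _ C (gX k)
  intro B _ φ x
  have := congrArg (eval₂Hom φ ![x.1, x.2]) key
  rwa [fac_map, fac_map', gX_ev, gX_C] at this

lemma bez_map {B C : Type} [CommRing B] [CommRing C] (η : B →+* C) (φ : R →+* B) (a b : Fin (d + 1) → R)
    (u v : Fin (q + 1) → R) (x : B × B) :
    η (ev (φ ∘ u) x * ev (φ ∘ a) x + ev (φ ∘ v) x * ev (φ ∘ b) x) =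
      ev ((η.comp φ) ∘ u) (mp η x) * ev ((η.comp φ) ∘ a) (mp η x) +
      ev ((η.comp φ) ∘ v) (mp η x) * ev ((η.comp φ) ∘ b) (mp η x) := by
  simp only [map_add, map_mul, ev_map]; rfl

lemma UBez.descend (ι : R →+* R') (hι : Function.Injective ι) {a b : Fin (d + 1) → R}
    {u v u' v' : Fin (q + 1) → R} {S : R} (h : UBez (ι ∘ a) (ι ∘ b) (ι ∘ u) (ι ∘ v) (ι ∘ u') (ι ∘ v') (ι S)) :
    UBez a b u v u' v' S := by
  have key1 : ev (C ∘ u) (gX R) * ev (C ∘ a) (gX R) + ev (C ∘ v) (gX R) * ev (C ∘ b) (gX R) =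
      C S * (gX R).2 ^ (q + d) := by
    apply MvPolynomial.map_injective ι hι
    rw [bez_map, gX_map, gC_map]
    refine ((h _ C).h1 (gX R')).trans ?_
    simp [gX]
  have key2 : ev (C ∘ u') (gX R) * ev (C ∘ a) (gX R) + ev (C ∘ v') (gX R) * ev (C ∘ b) (gX R) =
      C S * (gX R).1 ^ (q + d) := by
    apply MvPolynomial.map_injective ι hι
    rw [bez_map, gX_map, gC_map]
    refine ((h _ C).h2 (gX R')).trans ?_
    simp [gX]
  intro B _ φ
  constructor
  · intro x
    have := congrArg (eval₂Hom φ ![x.1, x.2]) key1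
    rw [bez_map, gX_ev, gX_C] at this
    rw [this]; simp [gX]
  · intro x
    have := congrArg (eval₂Hom φ ![x.1, x.2]) key2
    rw [bez_map, gX_ev, gX_C] at this
    rw [this]; simp [gX]

lemma UBez.map (ι : R →+* R') {a b : Fin (d + 1) → R}
    {u v u' v' : Fin (q + 1) → R} {S : R} (h : UBez a b u v u' v' S) :
    UBez (ι ∘ a) (ι ∘ b) (ι ∘ u) (ι ∘ v) (ι ∘ u') (ι ∘ v') (ι S) :=
  fun B _ φ => h B (φ.comp ι)

lemma UBez.smul (c : R) {a b : Fin (d + 1) → R}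
    {u v u' v' : Fin (q + 1) → R} {S : R} (h : UBez a b u v u' v' S) :
    UBez (c • a) (c • b) (c • u) (c • v) (c • u') (c • v') (c * c * S) := by
  intro B _ φ
  have e : ∀ {N : ℕ} (w : Fin (N + 1) → R) (x : B × B), ev (φ ∘ (c • w)) x = φ c * ev (φ ∘ w) x := by
    intro N w x
    simp [ev, Finset.mul_sum, mul_assoc]
  constructor
  · intro x
    have := (h B φ).h1 x
    simp only [e, map_mul]
    linear_combination (φ c * φ c) * this
  · intro x
    have := (h B φ).h2 x
    simp only [e, map_mul]
    linear_combination (φ c * φ c) * this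
end descend

section bez
variable {k : Type} [Field k] {d : ℕ}

lemma ev_hom {B : Type} [CommRing B] (φ : k →+* B) (P : Polynomial k) (n : ℕ) (x : B × B) :
    eval₂Hom φ ![x.1, x.2] (P.homogenize n) = ev (φ ∘ fun j : Fin (n + 1) => P.coeff j) x := by
  rw [Polynomial.homogenize, map_sum, Finset.Nat.sum_antidiagonal_eq_sum_range_succ_mk, Finset.sum_range, ev]
  refine Finset.sum_congr rfl fun j _ => ?_
  simp [eval₂_monomial, mul_assoc]

def toPol (a : Fin (d + 1) → k) : Polynomial k := ∑ j : Fin (d + 1), Polynomial.monomial j (a j)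

lemma toPol_coeff (a : Fin (d + 1) → k) (j : Fin (d + 1)) : (toPol a).coeff j = a j := by
  simp only [toPol, Polynomial.finsetSum_coeff, Polynomial.coeff_monomial]
  rw [Finset.sum_eq_single j] <;> simp +contextual [Fin.ext_iff]

lemma toPol_deg (a : Fin (d + 1) → k) : (toPol a).natDegree ≤ d :=
  Polynomial.natDegree_sum_le_of_forall_le _ _ fun j _ =>
    (Polynomial.natDegree_monomial_le _).trans (Nat.le_of_lt_succ j.2)

lemma toPol_eval (a : Fin (d + 1) → k) (t : k) : (toPol a).eval t = ev a (t, 1) := by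
  simp [toPol, ev, Polynomial.eval_finsetSum]

lemma half_bez [IsAlgClosed k] {a b : Fin (d + 1) → k} (hnz : NZ a b) : ∃ q0 : ℕ, ∀ q, q0 ≤ q →
    ∃ u v : Fin (q + 1) → k, ∀ (B : Type) [CommRing B] (φ : k →+* B) (x : B × B),
      ev (φ ∘ u) x * ev (φ ∘ a) x + ev (φ ∘ v) x * ev (φ ∘ b) x = x.2 ^ (q + d) := by
  have hc : IsCoprime (toPol a) (toPol b) := by
    rw [Polynomial.isCoprime_iff_aeval_ne_zero_of_isAlgClosed k k]
    intro t
    by_contra! h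
    simp only [Polynomial.coe_aeval_eq_eval, toPol_eval] at h
    exact hnz (t, 1) (by simp) (Prod.ext h.1 h.2)
  obtain ⟨U, V, hUV⟩ := hc
  refine ⟨max U.natDegree V.natDegree, fun q hq => ⟨fun j => U.coeff j, fun j => V.coeff j, fun B _ φ x => ?_⟩⟩
  have h := congrArg (fun P => Polynomial.homogenize P (q + d)) hUV
  simp only [Polynomial.homogenize_add, Polynomial.homogenize_one] at h
  rw [Polynomial.homogenize_mul _ _ ((le_max_left _ _).trans hq) (toPol_deg a),
    Polynomial.homogenize_mul _ _ ((le_max_right _ _).trans hq) (toPol_deg b)] at h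
  have h2 := congrArg (eval₂Hom φ ![x.1, x.2]) h
  simp only [map_add, map_mul, ev_hom, toPol_coeff] at h2
  rw [h2]; simp

lemma ev_rev {B : Type} [CommRing B] {n : ℕ} (a : Fin (n + 1) → B) (x : B × B) : ev (a ∘ Fin.rev) x = ev a x.swap := by
  simp only [ev]
  rw [← Equiv.sum_comp Fin.revPerm]
  refine Finset.sum_congr rfl fun j _ => ?_
  have : n - (n - (j : ℕ)) = j := by omega
  simp [Fin.val_rev, this]
  ring

lemma exists_UBez [IsAlgClosed k] {a b : Fin (d + 1) → k} (hnz : NZ a b) :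
    ∃ q : ℕ, ∃ u v u' v' : Fin (q + 1) → k, UBez a b u v u' v' 1 := by
  obtain ⟨q0, h0⟩ := half_bez hnz
  have hnz' : NZ (a ∘ Fin.rev) (b ∘ Fin.rev) := by
    intro x hx h
    refine hnz x.swap (fun h' => hx ?_) ?_
    · have := congrArg Prod.swap h'
      simpa using this
    · simpa [Fm, ev_rev] using h
  obtain ⟨q1, h1⟩ := half_bez hnz'
  obtain ⟨u, v, h⟩ := h0 (max q0 q1) (le_max_left _ _)
  obtain ⟨u', v', h'⟩ := h1 (max q0 q1) (le_max_right _ _)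
  refine ⟨max q0 q1, u, v, u' ∘ Fin.rev, v' ∘ Fin.rev, fun B _ φ => ⟨fun x => ?_, fun x => ?_⟩⟩
  · rw [map_one, one_mul]; exact h B φ x
  · have := h' B φ x.swap
    rw [map_one, one_mul]
    simp only [← Function.comp_assoc, ev_rev, Prod.swap_swap] at this ⊢
    exact this
end bez
end BD

namespace BD

abbrev Qb : Type := AlgebraicClosure ℚ

instance alg_Qb : Algebra.IsAlgebraic ℚ Qb := by
  have h := AlgebraicClosure.isAlgebraic ℚ
  have e : (AlgebraicClosure.instAlgebra ℚ : Algebra ℚ Qb) = DivisionRing.toRatAlgebra := Subsingleton.elim _ _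
  rw [e] at h
  exact h

def PP {R : Type} [CommRing R] {d : ℕ} (a b : Fin (d + 1) → R) (x : R × R) : Prop :=
  ∃ m n : ℕ, m < n ∧ wedge ((Fm a b)^[n] x) ((Fm a b)^[m] x) = 0

lemma iw_map {R R' : Type} [CommRing R] [CommRing R'] {d : ℕ} (ι : R →+* R') (a b : Fin (d + 1) → R) (x : R × R) (n m : ℕ) :
    wedge ((Fm (ι ∘ a) (ι ∘ b))^[n] (mp ι x)) ((Fm (ι ∘ a) (ι ∘ b))^[m] (mp ι x)) =
      ι (wedge ((Fm a b)^[n] x) ((Fm a b)^[m] x)) := by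
  rw [wedge_map, Fm_iter_map, Fm_iter_map]

lemma PP.map {R R' : Type} [CommRing R] [CommRing R'] {d : ℕ} (ι : R →+* R') {a b : Fin (d + 1) → R} {x : R × R}
    (h : PP a b x) : PP (ι ∘ a) (ι ∘ b) (mp ι x) := by
  obtain ⟨m, n, hmn, h⟩ := h
  exact ⟨m, n, hmn, by rw [iw_map, h, map_zero]⟩

lemma PP.descend {R R' : Type} [CommRing R] [CommRing R'] {d : ℕ} {ι : R →+* R'} (hι : Function.Injective ι)
    {a b : Fin (d + 1) → R} {x : R × R} (h : PP (ι ∘ a) (ι ∘ b) (mp ι x)) : PP a b x := by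
  obtain ⟨m, n, hmn, h⟩ := h
  rw [iw_map] at h
  exact ⟨m, n, hmn, hι (h.trans (map_zero ι).symm)⟩

lemma exists_nf {T : Set Qb} (hT : T.Finite) : ∃ (L : Type) (_ : Field L) (_ : NumberField L) (ι : L →+* Qb),
    T ⊆ Set.range ι := by
  have := hT.to_subtype
  have fd : FiniteDimensional ℚ (IntermediateField.adjoin ℚ T) :=
    IntermediateField.finiteDimensional_adjoin fun x _ => (Algebra.IsAlgebraic.isAlgebraic x).isIntegral
  refine ⟨IntermediateField.adjoin ℚ T, inferInstance, { to_charZero := inferInstance, to_finiteDimensional := fd },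
    (IntermediateField.adjoin ℚ T).val.toRingHom, fun x hx => ⟨⟨x, IntermediateField.subset_adjoin _ _ hx⟩, rfl⟩⟩

lemma ext_emb {L : Type} [Field L] (ι : L →+* Qb) (σ : L →+* ℂ) : ∃ τ : Qb →+* ℂ, τ.comp ι = σ := by
  have : CharZero L := (RingHom.charZero_iff (ϕ := ι) ι.injective).2 inferInstance
  let := ι.toAlgebra
  let := σ.toAlgebra
  have : IsScalarTower ℚ L Qb := IsScalarTower.of_algebraMap_eq' (Subsingleton.elim _ _)
  have : Algebra.IsAlgebraic L Qb := Algebra.IsAlgebraic.tower_top (K := ℚ) L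
  let τ : Qb →ₐ[L] ℂ := IsAlgClosed.lift
  refine ⟨τ.toRingHom, ?_⟩
  ext x
  exact τ.commutes x

lemma int_iff {L : Type} [Field L] (ι : L →+* Qb) {x : L} : IsIntegral ℤ (ι x) ↔ IsIntegral ℤ x :=
  isIntegral_algHom_iff ι.toIntAlgHom ι.injective

lemma norm_desc {L : Type} [Field L] (ι : L →+* Qb) {x : L} {A : ℝ} (h : ∀ σ : Qb →+* ℂ, ‖σ (ι x)‖ ≤ A) (σ : L →+* ℂ) :
    ‖σ x‖ ≤ A := by
  obtain ⟨τ, rfl⟩ := ext_emb ι σ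
  exact h τ

lemma Sz.descend {L : Type} [Field L] (ι : L →+* Qb) {C0 A : ℝ} {S : L} {d q : ℕ} {a b : Fin (d + 1) → L}
    {u v u' v' : Fin (q + 1) → L} (h : Sz C0 A (ι S) d q (ι ∘ a) (ι ∘ b) (ι ∘ u) (ι ∘ v) (ι ∘ u') (ι ∘ v')) :
    Sz C0 A S d q a b u v u' v' where
  ia j := (int_iff ι).1 (h.ia j)
  ib j := (int_iff ι).1 (h.ib j)
  iu j := (int_iff ι).1 (h.iu j)
  iv j := (int_iff ι).1 (h.iv j)
  iu' j := (int_iff ι).1 (h.iu' j)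
  iv' j := (int_iff ι).1 (h.iv' j)
  na σ j := norm_desc ι (fun τ => h.na τ j) σ
  nb σ j := norm_desc ι (fun τ => h.nb τ j) σ
  nu σ j := norm_desc ι (fun τ => h.nu τ j) σ
  nv σ j := norm_desc ι (fun τ => h.nv τ j) σ
  nu' σ j := norm_desc ι (fun τ => h.nu' τ j) σ
  nv' σ j := norm_desc ι (fun τ => h.nv' τ j) σ
  c2 := h.c2
  c3 := h.c3
  bez := h.bez.descend ι ι.injective

lemma lift1 {L k I : Type} [Field L] [Field k] (ι : L →+* k) (f : I → k) (h : Set.range f ⊆ Set.range ι) :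
    ∃ f0 : I → L, ι ∘ f0 = f := by
  obtain ⟨f0, h⟩ := Set.range_subset_range_iff_exists_comp.1 h
  exact ⟨f0, h.symm⟩

lemma lift2 {L k I : Type} [Field L] [Field k] (ι : L →+* k) (f : I → k × k) (h1 : Set.range (Prod.fst ∘ f) ⊆ Set.range ι)
    (h2 : Set.range (Prod.snd ∘ f) ⊆ Set.range ι) : ∃ f0 : I → L × L, f = fun i => mp ι (f0 i) := by
  obtain ⟨f1, h1⟩ := lift1 ι _ h1
  obtain ⟨f2, h2⟩ := lift1 ι _ h2
  exact ⟨fun i => (f1 i, f2 i), funext fun i => Prod.ext (congrFun h1 i).symm (congrFun h2 i).symm⟩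

theorem qb_contra {C0 A : ℝ} (hC : 0 ≤ C0) (c1 : 3 * A ≤ Real.exp C0) {p : ℕ} (hp : 2 ≤ p) {Wc : ℕ} (hWc : 0 < Wc)
    {d e q r : ℕ} (hd : 2 ≤ d) (he : 2 ≤ e) : ∃ M J : ℕ, ∀ (S : Qb), S ≠ 0 → IsIntegral ℤ S →
    (∀ σ : Qb →+* ℂ, ‖σ S‖ ≤ A) → ∀ (a b : Fin (d + 1) → Qb) (u v u' v' : Fin (q + 1) → Qb),
    Sz C0 A S d q a b u v u' v' → ∀ (a1 b1 : Fin (e + 1) → Qb) (u1 v1 u1' v1' : Fin (r + 1) → Qb),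
    Sz C0 A S e r a1 b1 u1 v1 u1' v1' → ∀ r0 s0 : Qb, IsIntegral ℤ r0 → IsIntegral ℤ s0 → r0 * S + s0 * p = 1 →
    ∀ x : Fin J → Qb × Qb, (∀ i, x i ≠ 0) → (∀ i j, i ≠ j → wedge (x i) (x j) ≠ 0) →
    (∀ i, PP a b (x i)) → (∀ i, PP a1 b1 (x i)) →
    ∀ y : Qb × Qb, IsIntegral ℤ y.1 → IsIntegral ℤ y.2 → (y.1 = S ∨ y.2 = S) → PP a b y →
    ∀ cls : Fin M → Fin Wc, (∀ i j : Fin M, i ≠ j → wedge ((Fm a1 b1)^[i] y) ((Fm a1 b1)^[j] y) ≠ 0) →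
    (∀ i j : Fin M, i ≠ j → cls i = cls j → ∃ c, IsIntegral ℤ c ∧ wedge ((Fm a1 b1)^[i] y) ((Fm a1 b1)^[j] y) = p * c) →
    False := by
  have hp' : (2 : ℝ) ≤ p := by exact_mod_cast hp
  obtain ⟨M, J, n, H⟩ := contra C0 hC (Real.log_pos (by linarith : (1 : ℝ) < p)) hWc hd he
  refine ⟨M, J, ?_⟩
  intro S hS iS nS a b u v u' v' hz a1 b1 u1 v1 u1' v1' hz1 r0 s0 hr0 hs0 hrs x hx hxx hxf hxg y hy1 hy2 hyS hyf cls hw hcl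
  have F1 : ∀ j : Fin J, ∃ W : Fin (d ^ n) → Qb × Qb, (∀ i, W i ≠ 0) ∧ IsFac a b n (((j : ℕ) : Qb), 1) W := fun j =>
    factor (by omega) a b (Bez.nz (hz.bez _ (RingHom.id _)) hS) n _ (by simp)
  have F2 : ∀ j : Fin J, ∃ W : Fin (e ^ n) → Qb × Qb, (∀ i, W i ≠ 0) ∧ IsFac a1 b1 n (((j : ℕ) : Qb), 1) W := fun j =>
    factor (by omega) a1 b1 (Bez.nz (hz1.bez _ (RingHom.id _)) hS) n _ (by simp)
  choose W hW hWf using F1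
  choose W' hW' hWf' using F2
  let Wu : Fin J × Fin (d ^ n) → Qb × Qb := fun t => W t.1 t.2
  let Wu' : Fin J × Fin (e ^ n) → Qb × Qb := fun t => W' t.1 t.2
  let T : List (Set Qb) := [{S}, {r0}, {s0}, {y.1}, {y.2}, Set.range a, Set.range b, Set.range u, Set.range v, Set.range u',
    Set.range v', Set.range a1, Set.range b1, Set.range u1, Set.range v1, Set.range u1', Set.range v1',
    Set.range (Prod.fst ∘ x), Set.range (Prod.snd ∘ x), Set.range (Prod.fst ∘ Wu), Set.range (Prod.snd ∘ Wu),
    Set.range (Prod.fst ∘ Wu'), Set.range (Prod.snd ∘ Wu')]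
  have hTf : {z | ∃ t ∈ T, z ∈ t}.Finite := by
    have : {z | ∃ t ∈ T, z ∈ t} = ⋃ t ∈ {t | t ∈ T}, t := by ext; simp
    rw [this]
    refine (List.finite_toSet T).biUnion fun t ht => ?_
    simp only [T, Set.mem_setOf_eq, List.mem_cons, List.not_mem_nil, or_false] at ht
    rcases ht with rfl | rfl | rfl | rfl | rfl | rfl | rfl | rfl | rfl | rfl | rfl | rfl | rfl | rfl | rfl | rfl | rfl | rfl
      | rfl | rfl | rfl | rfl | rfl <;> first | exact Set.finite_singleton _ | exact Set.finite_range _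
  obtain ⟨L, _, _, ι, hι⟩ := exists_nf hTf
  have hι' : ∀ t ∈ T, t ⊆ Set.range ι := fun t ht z hz => hι ⟨t, ht, hz⟩
  obtain ⟨x, rfl⟩ := lift2 ι x (hι' _ (by simp [T])) (hι' _ (by simp [T]))
  obtain ⟨V, hV⟩ := lift2 ι Wu (hι' _ (by simp [T])) (hι' _ (by simp [T]))
  obtain ⟨V', hV'⟩ := lift2 ι Wu' (hι' _ (by simp [T])) (hι' _ (by simp [T]))
  have eW : ∀ j, W j = fun i => mp ι (V (j, i)) := fun j => funext fun i => congrFun hV (j, i)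
  have eW' : ∀ j, W' j = fun i => mp ι (V' (j, i)) := fun j => funext fun i => congrFun hV' (j, i)
  obtain ⟨y10, hy10⟩ := hι' {y.1} (by simp [T]) rfl
  obtain ⟨y20, hy20⟩ := hι' {y.2} (by simp [T]) rfl
  have ey : y = mp ι (y10, y20) := Prod.ext hy10.symm hy20.symm
  have l1 : ∀ {N : ℕ} {f : Fin N → Qb}, Set.range f ∈ T → ∃ f0 : Fin N → L, ι ∘ f0 = f := fun h => lift1 ι _ (hι' _ h)
  obtain ⟨a, rfl⟩ := l1 (f := a) (by simp [T])
  obtain ⟨b, rfl⟩ := l1 (f := b) (by simp [T])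
  obtain ⟨u, rfl⟩ := l1 (f := u) (by simp [T])
  obtain ⟨v, rfl⟩ := l1 (f := v) (by simp [T])
  obtain ⟨u', rfl⟩ := l1 (f := u') (by simp [T])
  obtain ⟨v', rfl⟩ := l1 (f := v') (by simp [T])
  obtain ⟨a1, rfl⟩ := l1 (f := a1) (by simp [T])
  obtain ⟨b1, rfl⟩ := l1 (f := b1) (by simp [T])
  obtain ⟨u1, rfl⟩ := l1 (f := u1) (by simp [T])
  obtain ⟨v1, rfl⟩ := l1 (f := v1) (by simp [T])
  obtain ⟨u1', rfl⟩ := l1 (f := u1') (by simp [T])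
  obtain ⟨v1', rfl⟩ := l1 (f := v1') (by simp [T])
  obtain ⟨S, rfl⟩ := hι' {S} (by simp [T]) rfl
  obtain ⟨r0, rfl⟩ := hι' {r0} (by simp [T]) rfl
  obtain ⟨s0, rfl⟩ := hι' {s0} (by simp [T]) rfl
  clear_value T
  have inj := ι.injective
  have hS' : S ≠ 0 := (map_ne_zero ι).1 hS
  have iS' := (int_iff ι).1 iS
  have nS' : ∀ σ : L →+* ℂ, ‖σ S‖ ≤ A := norm_desc ι nS
  have z := Sz.descend ι hz
  have z1 := Sz.descend ι hz1
  have mpn : ∀ w : L × L, mp ι w ≠ 0 → w ≠ 0 := by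
    rintro w h rfl; exact h (mp_zero ι)
  have hpL : (p : L) ≠ 0 := by
    have : p ≠ 0 := by omega
    exact_mod_cast this
  have y0 : y ≠ 0 := by
    rintro rfl
    rcases hyS with h | h <;> exact hS h.symm
  have hwL : ∀ i j : Fin M, i ≠ j → wedge ((Fm a1 b1)^[i] (y10, y20)) ((Fm a1 b1)^[j] (y10, y20)) ≠ 0 := by
    intro i j hij h0
    refine hw i j hij ?_
    rw [ey, iw_map, h0, map_zero]
  refine H L hO (KtO C0 S) a b a1 b1 (Glob_nf hS' iS' nS' c1 hd z he z1) (fun j i => V (j, i)) (fun j i => V' (j, i))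
    (fun j i => mpn _ ?_) (fun j => IsFac.descend ι ?_) (fun j i => mpn _ ?_) (fun j => IsFac.descend ι ?_) x
    (fun i => mpn _ (hx i)) (fun i j hij h0 => hxx i j hij ?_) (fun i => (hxf i).descend inj) (fun i => (hxg i).descend inj)
    (y10, y20) (mpn _ (ey ▸ y0)) (PP.descend inj (ey ▸ hyf)) cls hwL fun k1 i j hij hc => ?_
  · have := hW j i; rw [eW] at this; exact this
  · have := hWf j; rw [eW] at this; rwa [mp_nat]
  · have := hW' j i; rw [eW'] at this; exact this
  · have := hWf' j; rw [eW'] at this; rwa [mp_nat]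
  · rw [← wedge_map, h0, map_zero]
  · obtain ⟨c, ic, hcw⟩ := hcl i j hij hc
    rw [ey, iw_map] at hcw
    set w := wedge ((Fm a1 b1)^[i] (y10, y20)) ((Fm a1 b1)^[j] (y10, y20)) with hwd
    have hcc : ι (w / p) = c := by
      rw [map_div₀, hcw, map_natCast]
      have : (p : Qb) ≠ 0 := by simpa using (map_ne_zero ι).2 hpL
      field_simp
    refine gain_nf hS' iS' nS' c1 he z1 (by omega) ((int_iff ι).1 hr0) ((int_iff ι).1 hs0) (inj ?_)
      (by rw [← int_iff ι]; simpa [hy10] using hy1) (by rw [← int_iff ι]; simpa [hy20] using hy2) ?_ (c := w / p)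
      (by rw [← int_iff ι, hcc]; exact ic) (by rw [← hwd]; field_simp) (hwL i j hij) k1
    · simpa using hrs
    · rw [← hy10, ← hy20] at hyS
      exact hyS.imp (fun h => inj h) (fun h => inj h)

end BD

namespace BD

lemma hom_ext_int {A O K : Type} [CommRing A] [IsDomain A] [CommRing O] [IsDomain O] [Algebra A O] [Algebra.IsIntegral A O]
    [FaithfulSMul A O] [Field K] [IsAlgClosed K] (θ : A →+* K) : ∃ ψ : O →+* K, ψ.comp (algebraMap A O) = θ := by
  have hP : (RingHom.ker θ).IsPrime := RingHom.ker_isPrime θ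
  obtain ⟨Q, hQ, hQP⟩ := Ideal.exists_ideal_over_prime_of_isIntegral_of_isDomain (S := O) (RingHom.ker θ)
    (by rw [(RingHom.injective_iff_ker_eq_bot _).1 (FaithfulSMul.algebraMap_injective A O)]; exact bot_le)
  have hl : Q.LiesOver (RingHom.ker θ) := ⟨hQP.symm⟩
  let : Algebra (A ⧸ RingHom.ker θ) K := (RingHom.kerLift θ).toAlgebra
  have i1 : Function.Injective (algebraMap (A ⧸ RingHom.ker θ) K) := RingHom.kerLift_injective θ
  have : Module.IsTorsionFree (A ⧸ RingHom.ker θ) K := by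
    have : FaithfulSMul (A ⧸ RingHom.ker θ) K := (faithfulSMul_iff_algebraMap_injective _ _).2 i1
    infer_instance
  have : Algebra.IsIntegral (A ⧸ RingHom.ker θ) (O ⧸ Q) := inferInstance
  have : FaithfulSMul (A ⧸ RingHom.ker θ) (O ⧸ Q) := inferInstance
  have : Module.IsTorsionFree (A ⧸ RingHom.ker θ) (O ⧸ Q) :=
    Module.isTorsionFree_iff_algebraMap_injective.mpr (FaithfulSMul.algebraMap_injective _ _)
  let f : (O ⧸ Q) →ₐ[A ⧸ RingHom.ker θ] K := IsAlgClosed.lift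
  refine ⟨f.toRingHom.comp (Ideal.Quotient.mk Q), ?_⟩
  ext x
  have := f.commutes (Ideal.Quotient.mk _ x)
  exact this

lemma ru_inf : {z : Qb | ∃ n, 0 < n ∧ z ^ n = 1}.Infinite := by
  have h : ∀ n : ℕ, ∃ z : Qb, IsPrimitiveRoot z (n + 1) := fun n => by
    have : NeZero ((n + 1 : ℕ) : Qb) := ⟨by exact_mod_cast n.succ_ne_zero⟩
    exact HasEnoughRootsOfUnity.exists_primitiveRoot Qb (n + 1)
  choose z hz using h
  refine Set.infinite_of_injective_forall_mem (f := z) ?_ (fun n => ⟨n + 1, n.succ_pos, (hz n).pow_eq_one⟩)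
  intro m n hmn
  have := (hmn ▸ hz m).unique (hz n)
  omega

section spec
variable {s O : Type} [CommRing O] [IsDomain O] [Algebra (MvPolynomial s ℤ) O] [Algebra.IsIntegral (MvPolynomial s ℤ) O]
  [FaithfulSMul (MvPolynomial s ℤ) O]

theorem spec (t0 : s → ℤ) {p : ℕ} (hp : p ≠ 0) (T : Finset O) (hT : ∀ r ∈ T, r ≠ 0) : ∃ ψ : O →+* Qb,
    (∀ c, IsIntegral ℤ (ψ c)) ∧ (∀ r ∈ T, ψ r ≠ 0) ∧
    (∀ m : MvPolynomial s ℤ, ∃ c, IsIntegral ℤ c ∧ ψ (algebraMap _ O m) = (eval t0 m : ℤ) + p * c) ∧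
    ∀ (σ : Qb →+* ℂ) (i : s), ‖σ (ψ (algebraMap (MvPolynomial s ℤ) O (X i)))‖ ≤ |(t0 i : ℝ)| + p := by
  classical
  have h1 : ∀ r : O, ∃ m : MvPolynomial s ℤ, m ≠ 0 ∧ (r ≠ 0 → r ∣ algebraMap _ O m) := by
    intro r
    by_cases hr : r = 0
    · exact ⟨1, one_ne_zero, fun h => (h hr).elim⟩
    · obtain ⟨m, hm, h⟩ := (Algebra.IsAlgebraic.isAlgebraic (R := MvPolynomial s ℤ) r).exists_nonzero_dvd
        (mem_nonZeroDivisors_of_ne_zero hr)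
      exact ⟨m, hm, fun _ => h⟩
  choose m hm hmd using h1
  let P := ∏ r ∈ T, m r
  have hP : P ≠ 0 := Finset.prod_ne_zero_iff.2 fun r _ => hm r
  let bx : s → Set Qb := fun i => (fun z => (t0 i : Qb) + p * z) '' {z : Qb | ∃ n, 0 < n ∧ z ^ n = 1}
  have hbx : ∀ i, (bx i).Infinite := fun i => ru_inf.image (fun x _ y _ h => by
    have hp' : (p : Qb) ≠ 0 := by exact_mod_cast hp
    simpa [hp'] using h)
  have h2 : ∃ x ∈ Set.pi Set.univ bx, eval x (MvPolynomial.map (Int.castRingHom Qb) P) ≠ 0 := by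
    by_contra! h
    refine hP (MvPolynomial.map_injective (Int.castRingHom Qb) Int.cast_injective ?_)
    rw [map_zero]
    exact funext_set bx hbx (fun x hx => by rw [h x hx, map_zero])
  obtain ⟨x, hx, hPx⟩ := h2
  have hx' : ∀ i, ∃ z : Qb, (∃ n, 0 < n ∧ z ^ n = 1) ∧ (t0 i : Qb) + p * z = x i := fun i => hx i trivial
  choose z hz hzx using hx'
  have iz : ∀ i, IsIntegral ℤ (z i) := fun i => by
    obtain ⟨n, hn, h⟩ := hz i
    exact IsIntegral.of_pow hn (h ▸ isIntegral_one)
  let zz : s → integralClosure ℤ Qb := fun i => ⟨z i, iz i⟩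
  let θ' : MvPolynomial s ℤ →+* integralClosure ℤ Qb := eval₂Hom (Int.castRingHom _) (fun i => (t0 i : integralClosure ℤ Qb) + p * zz i)
  let j : integralClosure ℤ Qb →+* Qb := algebraMap _ _
  obtain ⟨ψ, hψ⟩ := hom_ext_int (O := O) (j.comp θ')
  have hψ' : ∀ m, ψ (algebraMap _ O m) = j (θ' m) := fun m => RingHom.congr_fun hψ m
  have jx : ∀ i, j (θ' (X i)) = x i := fun i => by
    rw [← hzx]
    simp only [θ', coe_eval₂Hom, eval₂_X, map_add, map_mul, map_intCast, map_natCast]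
    rfl
  have hPj : j (θ' P) ≠ 0 := by
    have : (j.comp θ') = (eval x).comp (MvPolynomial.map (Int.castRingHom Qb)) := by
      refine MvPolynomial.ringHom_ext (fun r => by simp) (fun i => ?_)
      have := jx i
      simp only [RingHom.comp_apply, this]; simp
    have h3 := RingHom.congr_fun this P
    simp only [RingHom.comp_apply] at h3
    rw [h3]; exact hPx
  refine ⟨ψ, fun c => ?_, fun r hr h0 => hPj ?_, fun m => ?_, fun σ i => ?_⟩
  · obtain ⟨Q, hQ, hQ0⟩ := Algebra.IsIntegral.isIntegral (R := MvPolynomial s ℤ) c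
    have h4 := congrArg ψ hQ0
    rw [Polynomial.hom_eval₂, hψ, map_zero] at h4
    have : IsIntegral (integralClosure ℤ Qb) (ψ c) := ⟨Q.map θ', hQ.map _, by rw [Polynomial.eval₂_map]; exact h4⟩
    exact isIntegral_trans _ this
  · have h5 := map_dvd ψ (hmd r (hT r hr))
    rw [h0, zero_dvd_iff, hψ'] at h5
    rw [map_prod, map_prod]
    exact Finset.prod_eq_zero hr h5
  · have h6 : (Ideal.Quotient.mk (Ideal.span {(p : integralClosure ℤ Qb)})).comp θ' =
        (Int.castRingHom _).comp (eval t0) := by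
      refine MvPolynomial.ringHom_ext (fun r => by simp) (fun i => ?_)
      have hp0 : Ideal.Quotient.mk (Ideal.span {(p : integralClosure ℤ Qb)}) (p : integralClosure ℤ Qb) = 0 :=
        Ideal.Quotient.eq_zero_iff_mem.2 (Ideal.mem_span_singleton_self _)
      simp only [θ', RingHom.comp_apply, coe_eval₂Hom, eval₂_X, map_add, map_mul, hp0, zero_mul, add_zero, map_intCast, eval_X]
      simp
    have h7 := RingHom.congr_fun h6 m
    simp only [RingHom.comp_apply] at h7
    have h8 : Ideal.Quotient.mk (Ideal.span {(p : integralClosure ℤ Qb)}) (θ' m) =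
      Ideal.Quotient.mk (Ideal.span {(p : integralClosure ℤ Qb)}) ((eval t0 m : ℤ) : integralClosure ℤ Qb) := by
      rw [h7]; simp
    rw [Ideal.Quotient.eq, Ideal.mem_span_singleton] at h8
    obtain ⟨c, hc⟩ := h8
    refine ⟨c, c.2, ?_⟩
    rw [hψ', eq_add_of_sub_eq' hc, map_add, map_mul, map_intCast, map_natCast]
    rfl
  · rw [hψ', jx, ← hzx, map_add, map_mul, map_intCast, map_natCast]
    obtain ⟨n, hn, h⟩ := hz i
    have : ‖σ (z i)‖ = 1 := Complex.norm_eq_one_of_pow_eq_one (n := n) (by rw [← map_pow, h, map_one]) hn.ne'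
    refine (norm_add_le _ _).trans ?_
    rw [norm_mul, this]
    simp

lemma bdd_A (ρ : s → ℝ) (c : MvPolynomial s ℤ) : ∃ A : ℝ, ∀ ψ : MvPolynomial s ℤ →+* ℂ,
    (∀ i, ‖ψ (X i)‖ ≤ ρ i) → ‖ψ c‖ ≤ A := by
  induction c using MvPolynomial.induction_on with
  | C a => exact ⟨|(a : ℝ)|, fun ψ _ => by rw [show (C a : MvPolynomial s ℤ) = (a : MvPolynomial s ℤ) by simp]; simp⟩
  | add p q hp hq =>
    obtain ⟨A, hA⟩ := hp
    obtain ⟨B, hB⟩ := hq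
    exact ⟨A + B, fun ψ h => by
      rw [map_add]; exact (norm_add_le _ _).trans (add_le_add (hA ψ h) (hB ψ h))⟩
  | mul_X p i hp =>
    obtain ⟨A, hA⟩ := hp
    exact ⟨A * ρ i, fun ψ h => by
      rw [map_mul, norm_mul]
      exact mul_le_mul (hA ψ h) (h i) (norm_nonneg _) ((norm_nonneg _).trans (hA ψ h))⟩

lemma bdd_O (ρ : s → ℝ) (c : O) : ∃ A : ℝ, ∀ ψ : O →+* ℂ,
    (∀ i, ‖ψ (algebraMap (MvPolynomial s ℤ) O (X i))‖ ≤ ρ i) → ‖ψ c‖ ≤ A := by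
  obtain ⟨Q, hQ, hQ0⟩ := Algebra.IsIntegral.isIntegral (R := MvPolynomial s ℤ) c
  choose A hA using fun n => bdd_A ρ (Q.coeff n)
  refine ⟨∑ n ∈ Finset.range Q.natDegree, |A n| + 1, fun ψ h => ?_⟩
  have h4 := congrArg ψ hQ0
  rw [Polynomial.hom_eval₂, map_zero] at h4
  set φ := ψ.comp (algebraMap (MvPolynomial s ℤ) O) with hφ
  have hr : (Q.map φ).IsRoot (ψ c) := by rw [Polynomial.IsRoot, Polynomial.eval_map]; exact h4
  have hm : (Q.map φ).Monic := hQ.map _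
  have := hr.norm_lt_cauchyBound hm.ne_zero
  have h5 : ‖ψ c‖ < ((Q.map φ).cauchyBound : ℝ) := this
  refine h5.le.trans ?_
  rw [Polynomial.cauchyBound, hm.leadingCoeff, nnnorm_one, div_one, hQ.natDegree_map, NNReal.coe_add, NNReal.coe_one]
  gcongr
  have : (Finset.range Q.natDegree).sup (fun n => ‖(Q.map φ).coeff n‖₊) ≤ ∑ n ∈ Finset.range Q.natDegree, ‖(Q.map φ).coeff n‖₊ :=
    Finset.sup_le fun n hn => Finset.single_le_sum (f := fun n => ‖(Q.map φ).coeff n‖₊) (fun _ _ => zero_le) hn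
  refine (NNReal.coe_le_coe.2 this).trans ?_
  rw [NNReal.coe_sum]
  refine Finset.sum_le_sum fun n _ => ?_
  rw [Polynomial.coeff_map, coe_nnnorm]
  exact (hA n φ h).trans (le_abs_self _)

end spec
end BD

namespace BD

section cls
variable {s O : Type} [CommRing O] [IsDomain O] [Algebra (MvPolynomial s ℤ) O] [Algebra.IsIntegral (MvPolynomial s ℤ) O]
  [FaithfulSMul (MvPolynomial s ℤ) O]

lemma iter_mem {e : ℕ} (P : Subring O) (a b : Fin (e + 1) → O) (Y : O × O) (ha : ∀ j, a j ∈ P) (hb : ∀ j, b j ∈ P)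
    (h1 : Y.1 ∈ P) (h2 : Y.2 ∈ P) (k : ℕ) : ((Fm a b)^[k] Y).1 ∈ P ∧ ((Fm a b)^[k] Y).2 ∈ P := by
  induction k with
  | zero => exact ⟨h1, h2⟩
  | succ k ih =>
    rw [Function.iterate_succ_apply']
    simp only [Fm, ev]
    exact ⟨Subring.sum_mem _ fun j _ => P.mul_mem (P.mul_mem (ha j) (P.pow_mem ih.1 _)) (P.pow_mem ih.2 _),
      Subring.sum_mem _ fun j _ => P.mul_mem (P.mul_mem (hb j) (P.pow_mem ih.1 _)) (P.pow_mem ih.2 _)⟩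

lemma cls_exists (t0 : s → ℤ) {p : ℕ} (hp : p ≠ 0) {e : ℕ} (a b : Fin (e + 1) → O) (Y : O × O) :
    ∃ (Wc : ℕ) (_ : 0 < Wc) (cls : ℕ → Fin Wc), ∀ i j, cls i = cls j → ∀ ψ : O →+* Qb, (∀ c, IsIntegral ℤ (ψ c)) →
    (∀ m : MvPolynomial s ℤ, ∃ c, IsIntegral ℤ c ∧ ψ (algebraMap _ O m) = (eval t0 m : ℤ) + p * c) →
    ∃ c, IsIntegral ℤ c ∧ ψ (wedge ((Fm a b)^[i] Y) ((Fm a b)^[j] Y)) = p * c := by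
  classical
  let G : Set O := Set.range a ∪ Set.range b ∪ {Y.1, Y.2}
  have hG : G.Finite := ((Set.finite_range a).union (Set.finite_range b)).union (by simp)
  have hfg := fg_adjoin_of_finite (R := MvPolynomial s ℤ) hG (fun x _ => Algebra.IsIntegral.isIntegral x)
  obtain ⟨n, g, hg⟩ := Submodule.fg_iff_exists_fin_generating_family.1 hfg
  have hsub : G ⊆ Algebra.adjoin (MvPolynomial s ℤ) G := Algebra.subset_adjoin
  have hm := iter_mem (Algebra.adjoin (MvPolynomial s ℤ) G).toSubring a b Y
    (fun j => hsub (Or.inl (Or.inl ⟨j, rfl⟩))) (fun j => hsub (Or.inl (Or.inr ⟨j, rfl⟩)))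
    (hsub (Or.inr (by simp))) (hsub (Or.inr (by simp)))
  have hx : ∀ x ∈ Algebra.adjoin (MvPolynomial s ℤ) G, ∃ c : Fin n → MvPolynomial s ℤ, ∑ l, c l • g l = x := by
    intro x hx
    rw [← Submodule.mem_span_range_iff_exists_fun, hg]
    exact hx
  choose c hc using fun k => hx _ (hm k).1
  choose c' hc' using fun k => hx _ (hm k).2
  have : NeZero p := ⟨hp⟩
  let Ty := (Fin n → ZMod p) × (Fin n → ZMod p)
  let cl : ℕ → Ty := fun k => (fun l => ((eval t0 (c k l) : ℤ) : ZMod p), fun l => ((eval t0 (c' k l) : ℤ) : ZMod p))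
  refine ⟨Fintype.card Ty, Fintype.card_pos, fun k => Fintype.equivFin Ty (cl k), ?_⟩
  intro i j hij ψ hψ hψ3
  have hij' : cl i = cl j := (Fintype.equivFin Ty).injective hij
  have key : ∀ m m' : MvPolynomial s ℤ, ((eval t0 m : ℤ) : ZMod p) = ((eval t0 m' : ℤ) : ZMod p) →
      ∃ z, IsIntegral ℤ z ∧ ψ (algebraMap _ O m) - ψ (algebraMap _ O m') = p * z := by
    intro m m' h
    obtain ⟨q, hq, h1⟩ := hψ3 m
    obtain ⟨q', hq', h2⟩ := hψ3 m'
    rw [ZMod.intCast_eq_intCast_iff_dvd_sub] at h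
    obtain ⟨z, hz⟩ := h
    refine ⟨q - q' - (z : ℤ), (hq.sub hq').sub (isIntegral_algebraMap (R := ℤ) (x := z)), ?_⟩
    have hz' : ((eval t0 m' : ℤ) : Qb) - ((eval t0 m : ℤ) : Qb) = p * (z : Qb) := by exact_mod_cast congrArg (Int.cast : ℤ → Qb) hz
    rw [h1, h2]
    linear_combination -hz'
  have key2 : ∀ f f' : Fin n → MvPolynomial s ℤ, (∀ l, ((eval t0 (f l) : ℤ) : ZMod p) = ((eval t0 (f' l) : ℤ) : ZMod p)) →
      ∃ z, IsIntegral ℤ z ∧ ψ (∑ l, f l • g l) - ψ (∑ l, f' l • g l) = p * z := by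
    intro f f' h
    choose z hz hz' using fun l => key _ _ (h l)
    refine ⟨∑ l, z l * ψ (g l), IsIntegral.sum _ fun l _ => (hz l).mul (hψ _), ?_⟩
    simp only [map_sum, Algebra.smul_def, map_mul, Finset.mul_sum, ← Finset.sum_sub_distrib]
    exact Finset.sum_congr rfl fun l _ => by linear_combination ψ (g l) * hz' l
  obtain ⟨z, hz, h1⟩ := key2 (c i) (c j) (fun l => congrFun (congrArg Prod.fst hij') l)
  obtain ⟨z', hz', h2⟩ := key2 (c' i) (c' j) (fun l => congrFun (congrArg Prod.snd hij') l)
  rw [hc, hc] at h1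
  rw [hc', hc'] at h2
  refine ⟨z * ψ ((Fm a b)^[j] Y).2 - z' * ψ ((Fm a b)^[j] Y).1, (hz.mul (hψ _)).sub (hz'.mul (hψ _)), ?_⟩
  simp only [wedge, map_sub, map_mul]
  linear_combination ψ ((Fm a b)^[j] Y).2 * h1 - ψ ((Fm a b)^[j] Y).1 * h2

lemma bdd_fam (ρ : s → ℝ) {I : Type} [Fintype I] (c : I → O) : ∃ A : ℝ, 0 ≤ A ∧ ∀ ψ : O →+* ℂ,
    (∀ i, ‖ψ (algebraMap (MvPolynomial s ℤ) O (X i))‖ ≤ ρ i) → ∀ j, ‖ψ (c j)‖ ≤ A := by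
  choose A hA using fun j => bdd_O ρ (c j)
  refine ⟨∑ j, |A j|, Finset.sum_nonneg fun j _ => abs_nonneg _, fun ψ h j => ?_⟩
  exact ((hA j ψ h).trans (le_abs_self _)).trans
    (Finset.single_le_sum (f := fun j => |A j|) (fun j _ => abs_nonneg _) (Finset.mem_univ j))

lemma exists_int_pt (m : MvPolynomial s ℤ) (hm : m ≠ 0) : ∃ t0 : s → ℤ, eval t0 m ≠ 0 := by
  by_contra! h
  exact hm (MvPolynomial.funext fun x => by simpa using h x)

lemma Sz_of {C0 A : ℝ} {d q : ℕ} (ψ : O →+* Qb) (hψ : ∀ c, IsIntegral ℤ (ψ c)) {S : O} {a b : Fin (d + 1) → O}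
    {u v u' v' : Fin (q + 1) → O} (hB : UBez a b u v u' v' S)
    (hA : ∀ (σ : Qb →+* ℂ) (j), ‖σ (ψ (Sum.elim (Sum.elim a b) (Sum.elim (Sum.elim u v) (Sum.elim u' v')) j))‖ ≤ A)
    (c2 : 2 ^ (3 * d + 2) * A * A ≤ Real.exp C0) (c3 : 2 ^ (q + d + 2) * A ≤ Real.exp C0) :
    Sz C0 A (ψ S) d q (ψ ∘ a) (ψ ∘ b) (ψ ∘ u) (ψ ∘ v) (ψ ∘ u') (ψ ∘ v') where
  ia _ := hψ _
  ib _ := hψ _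
  iu _ := hψ _
  iv _ := hψ _
  iu' _ := hψ _
  iv' _ := hψ _
  na σ j := hA σ (Sum.inl (Sum.inl j))
  nb σ j := hA σ (Sum.inl (Sum.inr j))
  nu σ j := hA σ (Sum.inr (Sum.inl (Sum.inl j)))
  nv σ j := hA σ (Sum.inr (Sum.inl (Sum.inr j)))
  nu' σ j := hA σ (Sum.inr (Sum.inr (Sum.inl j)))
  nv' σ j := hA σ (Sum.inr (Sum.inr (Sum.inr j)))
  c2 := c2
  c3 := c3
  bez := hB.map ψ

theorem O_contra {d e q r : ℕ} (hd : 2 ≤ d) (he : 2 ≤ e) {SA : MvPolynomial s ℤ} (hSA : SA ≠ 0)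
    {a b : Fin (d + 1) → O} {u v u' v' : Fin (q + 1) → O} (hB : UBez a b u v u' v' (algebraMap _ O SA))
    {a1 b1 : Fin (e + 1) → O} {u1 v1 u1' v1' : Fin (r + 1) → O} (hB1 : UBez a1 b1 u1 v1 u1' v1' (algebraMap _ O SA))
    {Y : O × O} (hY : Y.1 = algebraMap _ O SA ∨ Y.2 = algebraMap _ O SA) (hYP : PP a b Y) (hYN : ¬ PP a1 b1 Y)
    (hx : ∀ J : ℕ, ∃ x : Fin J → O × O, (∀ i, x i ≠ 0) ∧ (∀ i j, i ≠ j → wedge (x i) (x j) ≠ 0) ∧ (∀ i, PP a b (x i)) ∧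
      ∀ i, PP a1 b1 (x i)) : False := by
  classical
  obtain ⟨t0, ht0⟩ := exists_int_pt SA hSA
  obtain ⟨p, hpN, hp⟩ := Nat.exists_infinite_primes ((eval t0 SA).natAbs + 1)
  have hcop : IsCoprime (eval t0 SA) (p : ℤ) := by
    rw [Int.isCoprime_iff_gcd_eq_one, Int.gcd_comm, Int.gcd_eq_natAbs, Int.natAbs_natCast]
    exact (Nat.Prime.coprime_iff_not_dvd hp).2 fun h =>
      absurd (Nat.le_of_dvd (Int.natAbs_pos.2 ht0) h) (by omega)
  obtain ⟨α, β, hαβ⟩ := hcop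
  let ρ : s → ℝ := fun i => |(t0 i : ℝ)| + p
  obtain ⟨A1, hA1, bA1⟩ := bdd_fam ρ (Sum.elim (Sum.elim a b) (Sum.elim (Sum.elim u v) (Sum.elim u' v')))
  obtain ⟨A2, hA2, bA2⟩ := bdd_fam ρ (Sum.elim (Sum.elim a1 b1) (Sum.elim (Sum.elim u1 v1) (Sum.elim u1' v1')))
  obtain ⟨A3, hA3, bA3⟩ := bdd_fam ρ (fun _ : Unit => algebraMap (MvPolynomial s ℤ) O SA)
  let A := A1 + A2 + A3
  have hA0 : 0 ≤ A := by positivity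
  let E := 3 * A + 2 ^ (3 * d + 2) * A * A + 2 ^ (q + d + 2) * A + 2 ^ (3 * e + 2) * A * A + 2 ^ (r + e + 2) * A
  have hE : E ≤ Real.exp E := by linarith [Real.add_one_le_exp E]
  have e1 : 0 ≤ 3 * A := by positivity
  have e2 : 0 ≤ 2 ^ (3 * d + 2) * A * A := by positivity
  have e3 : 0 ≤ 2 ^ (q + d + 2) * A := by positivity
  have e4 : 0 ≤ 2 ^ (3 * e + 2) * A * A := by positivity
  have e5 : 0 ≤ 2 ^ (r + e + 2) * A := by positivity
  have hEd : E = 3 * A + 2 ^ (3 * d + 2) * A * A + 2 ^ (q + d + 2) * A + 2 ^ (3 * e + 2) * A * A + 2 ^ (r + e + 2) * A := rfl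
  obtain ⟨Wc, hWc, cls, hcls⟩ := cls_exists t0 hp.ne_zero a1 b1 Y
  obtain ⟨M, J, hMJ⟩ := qb_contra (C0 := E) (A := A) (by linarith) (by linarith) hp.two_le hWc (q := q) (r := r) hd he
  obtain ⟨x, x0, xw, xa, xb⟩ := hx J
  have hco : ∀ i, ∃ c : O, c ≠ 0 ∧ (c = (x i).1 ∨ c = (x i).2) := by
    intro i
    by_contra! h
    refine x0 i (Prod.ext ?_ ?_)
    · by_contra h1; exact (h _ h1).1 rfl
    · by_contra h1; exact (h _ h1).2 rfl
  choose cc cc0 hcc using hco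
  let T : Finset O := {algebraMap _ O SA} ∪ Finset.univ.image cc ∪
    (Finset.univ.filter fun ij : Fin J × Fin J => ij.1 ≠ ij.2).image (fun ij => wedge (x ij.1) (x ij.2)) ∪
    (Finset.univ.filter fun ij : Fin M × Fin M => ij.1 ≠ ij.2).image
      (fun ij => wedge ((Fm a1 b1)^[(ij.1 : ℕ)] Y) ((Fm a1 b1)^[(ij.2 : ℕ)] Y))
  have hS0 : algebraMap (MvPolynomial s ℤ) O SA ≠ 0 := by
    rw [map_ne_zero_iff _ (FaithfulSMul.algebraMap_injective _ _)]; exact hSA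
  have hw : ∀ i j : Fin M, i ≠ j → wedge ((Fm a1 b1)^[(i : ℕ)] Y) ((Fm a1 b1)^[(j : ℕ)] Y) ≠ 0 := by
    intro i j hij h
    rcases lt_or_gt_of_ne hij with hl | hl
    · exact hYN ⟨i, j, hl, by rw [wedge_swap, h, neg_zero]⟩
    · exact hYN ⟨j, i, hl, h⟩
  obtain ⟨ψ, hψ, hT, h3, hn⟩ := spec t0 hp.ne_zero T (by
    intro c hc
    simp only [T, Finset.mem_union, Finset.mem_singleton, Finset.mem_image, Finset.mem_filter, Finset.mem_univ, true_and] at hc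
    rcases hc with ((rfl | ⟨i, rfl⟩) | ⟨ij, h, rfl⟩) | ⟨ij, h, rfl⟩
    · exact hS0
    · exact cc0 i
    · exact xw _ _ h
    · exact hw _ _ h)
  have hTS : ψ (algebraMap _ O SA) ≠ 0 := hT _ (by simp [T])
  have hTc : ∀ i, ψ (cc i) ≠ 0 := fun i => hT _ (by
    simp only [T, Finset.mem_union]; exact Or.inl (Or.inl (Or.inr (by simp))))
  have hTx : ∀ i j, i ≠ j → ψ (wedge (x i) (x j)) ≠ 0 := fun i j h => hT _ (by
    simp only [T, Finset.mem_union]; exact Or.inl (Or.inr (Finset.mem_image.2 ⟨(i, j), by simpa using h, rfl⟩)))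
  have hTY : ∀ i j : Fin M, i ≠ j → ψ (wedge ((Fm a1 b1)^[(i : ℕ)] Y) ((Fm a1 b1)^[(j : ℕ)] Y)) ≠ 0 := fun i j h => hT _ (by
    simp only [T, Finset.mem_union]; exact Or.inr (Finset.mem_image.2 ⟨(i, j), by simpa using h, rfl⟩))
  obtain ⟨c, hc, hcS⟩ := h3 SA
  have A1A : A1 ≤ A := by simp only [A]; linarith
  have A2A : A2 ≤ A := by simp only [A]; linarith
  have A3A : A3 ≤ A := by simp only [A]; linarith
  refine hMJ (ψ (algebraMap _ O SA)) hTS (hψ _) (fun σ => (bA3 (σ.comp ψ) (hn σ) ()).trans A3A)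
    _ _ _ _ _ _ (Sz_of ψ hψ hB (fun σ j => (bA1 (σ.comp ψ) (hn σ) j).trans A1A) (by linarith) (by linarith))
    _ _ _ _ _ _ (Sz_of ψ hψ hB1 (fun σ j => (bA2 (σ.comp ψ) (hn σ) j).trans A2A) (by linarith) (by linarith))
    (α : ℤ) ((β : ℤ) - (α : ℤ) * c) (isIntegral_algebraMap (R := ℤ) (x := α))
    ((isIntegral_algebraMap (R := ℤ) (x := β)).sub ((isIntegral_algebraMap (R := ℤ) (x := α)).mul hc)) ?_
    (fun i => mp ψ (x i)) ?_ ?_ (fun i => (xa i).map ψ) (fun i => (xb i).map ψ) (mp ψ Y) (hψ _) (hψ _)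
    (hY.imp (fun h => congrArg ψ h) (fun h => congrArg ψ h)) (hYP.map ψ) (fun i => cls i) ?_ ?_
  · have := congrArg (Int.cast : ℤ → Qb) hαβ
    push_cast at this
    rw [hcS]
    linear_combination this
  · intro i h
    rcases hcc i with h1 | h1
    · exact hTc i (by rw [h1]; exact congrArg Prod.fst h)
    · exact hTc i (by rw [h1]; exact congrArg Prod.snd h)
  · intro i j h
    rw [← wedge_map]; exact hTx i j h
  · intro i j h
    rw [iw_map]; exact hTY i j h
  · intro i j _ h
    obtain ⟨c, hc, hc'⟩ := hcls i j h ψ hψ h3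
    exact ⟨c, hc, by rw [iw_map]; exact hc'⟩
end cls

end BD

namespace BD

section scl
variable {K : Type} [Field K] {d : ℕ}

lemma Fm_coef_smul (c : K) (a b : Fin (d + 1) → K) (x : K × K) : Fm (c • a) (c • b) x = c • Fm a b x := by
  simp only [Fm, ev, Prod.smul_mk, smul_eq_mul, Finset.mul_sum, Pi.smul_apply, mul_assoc]

lemma iter_scl {c : K} (hc : c ≠ 0) (a b : Fin (d + 1) → K) {t : K} (ht : t ≠ 0) (x : K × K) (n : ℕ) :
    ∃ t' : K, t' ≠ 0 ∧ (Fm (c • a) (c • b))^[n] (t • x) = t' • (Fm a b)^[n] x := by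
  induction n with
  | zero => exact ⟨t, ht, rfl⟩
  | succ n ih =>
    obtain ⟨t', ht', h⟩ := ih
    refine ⟨c * t' ^ d, mul_ne_zero hc (pow_ne_zero _ ht'), ?_⟩
    rw [Function.iterate_succ_apply', Function.iterate_succ_apply', h, Fm_coef_smul, Fm_smul, smul_smul]

lemma PP_scl {c : K} (hc : c ≠ 0) (a b : Fin (d + 1) → K) {t : K} (ht : t ≠ 0) (x : K × K) :
    PP (c • a) (c • b) (t • x) ↔ PP a b x := by
  unfold PP
  refine exists_congr fun m => exists_congr fun n => and_congr_right fun _ => ?_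
  obtain ⟨t1, h1, e1⟩ := iter_scl hc a b ht x n
  obtain ⟨t2, h2, e2⟩ := iter_scl hc a b ht x m
  rw [e1, e2, wedge_smul_left, wedge_smul_right]
  simp [h1, h2]

end scl

section K
theorem K_contra (s : Type) {K : Type} [Field K] [IsAlgClosed K] [Algebra (MvPolynomial s ℤ) K]
    [Algebra.IsAlgebraic (MvPolynomial s ℤ) K] [FaithfulSMul (MvPolynomial s ℤ) K] {d e : ℕ} (hd : 2 ≤ d) (he : 2 ≤ e) {a b : Fin (d + 1) → K} (hnz : NZ a b)
    {a1 b1 : Fin (e + 1) → K} (hnz1 : NZ a1 b1) {y : K × K} (hy : y.1 = 1 ∨ y.2 = 1) (hyP : PP a b y) (hyN : ¬ PP a1 b1 y)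
    (hx : ∀ J : ℕ, ∃ x : Fin J → K × K, (∀ i, x i ≠ 0) ∧ (∀ i j, i ≠ j → wedge (x i) (x j) ≠ 0) ∧ (∀ i, PP a b (x i)) ∧
      ∀ i, PP a1 b1 (x i)) : False := by
  classical
  obtain ⟨q, u, v, u', v', hB⟩ := exists_UBez hnz
  obtain ⟨r, u1, v1, u1', v1', hB1⟩ := exists_UBez hnz1
  let F1 := Sum.elim (Sum.elim a b) (Sum.elim (Sum.elim u v) (Sum.elim u' v'))
  let F2 := Sum.elim (Sum.elim a1 b1) (Sum.elim (Sum.elim u1 v1) (Sum.elim u1' v1'))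
  obtain ⟨S0, hS0, hint⟩ := Algebra.IsAlgebraic.exists_integral_multiples (MvPolynomial s ℤ)
    (Finset.univ.image F1 ∪ Finset.univ.image F2 ∪ {y.1, y.2})
  set c : K := algebraMap (MvPolynomial s ℤ) K S0 with hcd
  have hc : c ≠ 0 := by
    rw [hcd, map_ne_zero_iff _ (FaithfulSMul.algebraMap_injective _ _)]; exact hS0
  have hi : ∀ z ∈ (Finset.univ.image F1 ∪ Finset.univ.image F2 ∪ {y.1, y.2}), IsIntegral (MvPolynomial s ℤ) (c * z) := by
    intro z hz
    rw [hcd, ← Algebra.smul_def]; exact hint z hz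
  have hF1 : ∀ j, IsIntegral (MvPolynomial s ℤ) (c * F1 j) := fun j => hi _ (by
    simp only [Finset.mem_union]; exact Or.inl (Or.inl (by simp)))
  have hF2 : ∀ j, IsIntegral (MvPolynomial s ℤ) (c * F2 j) := fun j => hi _ (by
    simp only [Finset.mem_union]; exact Or.inl (Or.inr (by simp)))
  have hy1 : IsIntegral (MvPolynomial s ℤ) (c * c * y.1) := by
    rw [mul_assoc]; exact isIntegral_algebraMap.mul (hi _ (by simp))
  have hy2 : IsIntegral (MvPolynomial s ℤ) (c * c * y.2) := by
    rw [mul_assoc]; exact isIntegral_algebraMap.mul (hi _ (by simp))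
  let O := integralClosure (MvPolynomial s ℤ) K
  have : FaithfulSMul (MvPolynomial s ℤ) O := by
    rw [faithfulSMul_iff_algebraMap_injective]
    intro m m' h
    exact FaithfulSMul.algebraMap_injective _ K (congrArg Subtype.val h)
  let ι : O →+* K := algebraMap O K
  have hι : Function.Injective ι := Subtype.val_injective
  let Y : O × O := (⟨_, hy1⟩, ⟨_, hy2⟩)
  have hYy : mp ι Y = (c * c) • y := rfl
  have hS : ι (algebraMap (MvPolynomial s ℤ) O (S0 * S0)) = c * c * 1 := by
    rw [mul_one, hcd, ← map_mul]; rfl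
  let aO : Fin (d + 1) → O := fun j => ⟨_, hF1 (Sum.inl (Sum.inl j))⟩
  let bO : Fin (d + 1) → O := fun j => ⟨_, hF1 (Sum.inl (Sum.inr j))⟩
  let a1O : Fin (e + 1) → O := fun j => ⟨_, hF2 (Sum.inl (Sum.inl j))⟩
  let b1O : Fin (e + 1) → O := fun j => ⟨_, hF2 (Sum.inl (Sum.inr j))⟩
  have ea : ι ∘ aO = c • a := rfl
  have eb : ι ∘ bO = c • b := rfl
  have ea1 : ι ∘ a1O = c • a1 := rfl
  have eb1 : ι ∘ b1O = c • b1 := rfl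
  have B : UBez aO bO (fun j => (⟨_, hF1 (Sum.inr (Sum.inl (Sum.inl j)))⟩ : O)) (fun j => (⟨_, hF1 (Sum.inr (Sum.inl (Sum.inr j)))⟩ : O))
      (fun j => (⟨_, hF1 (Sum.inr (Sum.inr (Sum.inl j)))⟩ : O)) (fun j => (⟨_, hF1 (Sum.inr (Sum.inr (Sum.inr j)))⟩ : O))
      (algebraMap (MvPolynomial s ℤ) O (S0 * S0)) := by
    apply UBez.descend ι hι
    rw [hS]
    exact hB.smul c
  have B1 : UBez a1O b1O (fun j => (⟨_, hF2 (Sum.inr (Sum.inl (Sum.inl j)))⟩ : O)) (fun j => (⟨_, hF2 (Sum.inr (Sum.inl (Sum.inr j)))⟩ : O))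
      (fun j => (⟨_, hF2 (Sum.inr (Sum.inr (Sum.inl j)))⟩ : O)) (fun j => (⟨_, hF2 (Sum.inr (Sum.inr (Sum.inr j)))⟩ : O))
      (algebraMap (MvPolynomial s ℤ) O (S0 * S0)) := by
    apply UBez.descend ι hι
    rw [hS]
    exact hB1.smul c
  refine O_contra hd he (mul_ne_zero hS0 hS0) B B1 (Y := Y) ?_ ?_ ?_ ?_
  · refine hy.imp (fun h => hι ?_) (fun h => hι ?_)
    · rw [hS, ← h]; rfl
    · rw [hS, ← h]; rfl
  · apply PP.descend hι
    rw [ea, eb, hYy, PP_scl hc _ _ (mul_ne_zero hc hc)]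
    exact hyP
  · intro h
    have := h.map ι
    rw [ea1, eb1, hYy, PP_scl hc _ _ (mul_ne_zero hc hc)] at this
    exact hyN this
  · intro J
    obtain ⟨x, x0, xw, xa, xb⟩ := hx J
    have : ∀ i, ∃ t : K, t ≠ 0 ∧ ∃ z : O × O, mp ι z = t • x i := by
      intro i
      obtain ⟨t, ht, h⟩ := Algebra.IsAlgebraic.exists_integral_multiples (MvPolynomial s ℤ) {(x i).1, (x i).2}
      refine ⟨algebraMap _ K t, ?_, ((⟨_, h (x i).1 (by simp)⟩ : O), (⟨_, h (x i).2 (by simp)⟩ : O)), ?_⟩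
      · rw [map_ne_zero_iff _ (FaithfulSMul.algebraMap_injective _ _)]; exact ht
      · exact Prod.ext (Algebra.smul_def _ _) (Algebra.smul_def _ _)
    choose t ht z hz using this
    refine ⟨z, ?_, ?_, ?_, ?_⟩
    · intro i h
      have h1 := hz i
      rw [h, mp_zero] at h1
      exact smul_ne_zero (ht i) (x0 i) h1.symm
    · intro i j hij h
      have h1 := congrArg ι h
      rw [wedge_map, hz, hz, wedge_smul_left, wedge_smul_right, map_zero] at h1
      exact mul_ne_zero (ht i) (mul_ne_zero (ht j) (xw i j hij)) h1
    · intro i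
      apply PP.descend hι
      rw [ea, eb, hz, PP_scl hc _ _ (ht i)]; exact xa i
    · intro i
      apply PP.descend hι
      rw [ea1, eb1, hz, PP_scl hc _ _ (ht i)]; exact xb i
end K

theorem C_contra {d e : ℕ} (hd : 2 ≤ d) (he : 2 ≤ e) {a b : Fin (d + 1) → ℂ} (hnz : NZ a b)
    {a1 b1 : Fin (e + 1) → ℂ} (hnz1 : NZ a1 b1) {y : ℂ × ℂ} (hy : y ≠ 0) (hyP : PP a b y)
    (hx : ∀ J : ℕ, ∃ x : Fin J → ℂ × ℂ, (∀ i, x i ≠ 0) ∧ (∀ i j, i ≠ j → wedge (x i) (x j) ≠ 0) ∧ (∀ i, PP a b (x i)) ∧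
      ∀ i, PP a1 b1 (x i)) : PP a1 b1 y := by
  by_contra hyN
  obtain ⟨s, hs⟩ := exists_isTranscendenceBasis ℤ ℂ
  let : Algebra (MvPolynomial s ℤ) ℂ := (aeval (R := ℤ) ((↑) : s → ℂ)).toRingHom.toAlgebra
  have hinj : Function.Injective (algebraMap (MvPolynomial s ℤ) ℂ) := hs.1
  have : FaithfulSMul (MvPolynomial s ℤ) ℂ := (faithfulSMul_iff_algebraMap_injective _ _).2 hinj
  have : Algebra.IsAlgebraic (MvPolynomial s ℤ) ℂ := by
    have h := hs.isAlgebraic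
    let ee := hs.1.aevalEquiv
    refine ⟨fun z => ?_⟩
    obtain ⟨P, hP, hz⟩ := h.1 z
    refine ⟨P.map (ee.symm : _ ≃ₐ[ℤ] _).toRingEquiv.toRingHom, ?_, ?_⟩
    · rw [Ne, Polynomial.map_eq_zero_iff (ee.symm.injective)]; exact hP
    · rw [Polynomial.aeval_def, Polynomial.eval₂_map, ← hz, Polynomial.aeval_def]
      congr 1
      ext w
      have := hs.1.algebraMap_aevalEquiv (ee.symm w)
      simp only [ee, AlgEquiv.apply_symm_apply] at this
      exact this.symm
  have hsc : ∀ t : ℂ, t ≠ 0 → ((t • y).1 = 1 ∨ (t • y).2 = 1) → False := by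
    intro t ht h
    refine K_contra s hd he hnz hnz1 h ?_ ?_ hx
    · have := (PP_scl one_ne_zero a b ht y).2 hyP
      rwa [one_smul, one_smul] at this
    · intro h
      apply hyN
      refine (PP_scl one_ne_zero a1 b1 ht y).1 ?_
      rwa [one_smul, one_smul]
  by_cases h1 : y.1 = 0
  · have h2 : y.2 ≠ 0 := fun h2 => hy (Prod.ext h1 h2)
    exact hsc y.2⁻¹ (inv_ne_zero h2) (Or.inr (by simp [h2]))
  · exact hsc y.1⁻¹ (inv_ne_zero h1) (Or.inl (by simp [h1]))

end BD

namespace BD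

def Fo (D : ℕ) (φ : ℂ × ℂ → ℂ) : Prop :=
  (∀ (c : ℂ) x, φ (c • x) = c ^ D * φ x) ∧ ∀ x y : ℂ × ℂ, ∃ P : Polynomial ℂ, ∀ t, φ (x + t • y) = P.eval t

lemma Fo.mul {D D' : ℕ} {φ φ' : ℂ × ℂ → ℂ} (h : Fo D φ) (h' : Fo D' φ') : Fo (D + D') (fun x => φ x * φ' x) := by
  refine ⟨fun c x => by simp only [h.1, h'.1]; ring, fun x y => ?_⟩
  obtain ⟨P, hP⟩ := h.2 x y
  obtain ⟨P', hP'⟩ := h'.2 x y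
  exact ⟨P * P', fun t => by simp only [hP, hP', Polynomial.eval_mul]⟩

lemma Fo.sub {D : ℕ} {φ φ' : ℂ × ℂ → ℂ} (h : Fo D φ) (h' : Fo D φ') : Fo D (fun x => φ x - φ' x) := by
  refine ⟨fun c x => by simp only [h.1, h'.1]; ring, fun x y => ?_⟩
  obtain ⟨P, hP⟩ := h.2 x y
  obtain ⟨P', hP'⟩ := h'.2 x y
  exact ⟨P - P', fun t => by simp only [hP, hP', Polynomial.eval_sub]⟩

lemma Fo_ev {d : ℕ} (a : Fin (d + 1) → ℂ) : Fo d (ev a) := by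
  refine ⟨fun c x => ev_smul a c x, fun x y => ?_⟩
  refine ⟨ev (Polynomial.C ∘ a) (Polynomial.C x.1 + Polynomial.X * Polynomial.C y.1,
    Polynomial.C x.2 + Polynomial.X * Polynomial.C y.2), fun t => ?_⟩
  have := ev_map (Polynomial.evalRingHom t) (Polynomial.C ∘ a) (Polynomial.C x.1 + Polynomial.X * Polynomial.C y.1,
    Polynomial.C x.2 + Polynomial.X * Polynomial.C y.2)
  rw [Polynomial.coe_evalRingHom] at this
  rw [this]
  congr 1
  · ext j; simp
  · ext <;> (simp [mp]; ring)

lemma Fo_c (c : ℂ) : Fo 0 (fun _ => c) := ⟨fun _ _ => by simp, fun _ _ => ⟨Polynomial.C c, fun t => by simp⟩⟩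
lemma Fo_fst : Fo 1 (fun x => x.1) :=
  ⟨fun _ _ => by simp, fun x y => ⟨Polynomial.C x.1 + Polynomial.X * Polynomial.C y.1, fun t => by simp; ring⟩⟩
lemma Fo_snd : Fo 1 (fun x => x.2) :=
  ⟨fun _ _ => by simp, fun x y => ⟨Polynomial.C x.2 + Polynomial.X * Polynomial.C y.2, fun t => by simp; ring⟩⟩

lemma Fo_w {d : ℕ} (a b : Fin (d + 1) → ℂ) (z : ℂ × ℂ) : Fo d (fun x => wedge (Fm a b x) z) :=
  ((Fo_ev a).mul (Fo_c z.2)).sub ((Fo_ev b).mul (Fo_c z.1))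

lemma Fo_fix {d : ℕ} (a b : Fin (d + 1) → ℂ) : Fo (d + 1) (fun x => wedge (Fm a b x) x) :=
  ((Fo_ev a).mul Fo_snd).sub ((Fo_ev b).mul Fo_fst)

lemma poly_zero {P Q : Polynomial ℂ} (h : ∀ t : ℂ, t ≠ 0 → P.eval t = Q.eval t) : P.eval 0 = Q.eval 0 := by
  have : Polynomial.X * P = Polynomial.X * Q := Polynomial.funext fun t => by
    by_cases ht : t = 0
    · simp [ht]
    · simp [h t ht]
  rw [mul_left_cancel₀ Polynomial.X_ne_zero this]

lemma Fo.pure {D : ℕ} {φ : ℂ × ℂ → ℂ} (h : Fo D φ) {e' e : ℂ × ℂ} (h0 : ∀ t : ℂ, φ (e' + t • e) ≠ 0) :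
    ∃ k : ℂ, k ≠ 0 ∧ ∀ s t : ℂ, φ (s • e' + t • e) = k * s ^ D := by
  obtain ⟨P, hP⟩ := h.2 e' e
  have hdeg : P.degree ≤ 0 := by
    by_contra hh
    obtain ⟨t, ht⟩ := IsAlgClosed.exists_root P (fun h => hh h.le)
    exact h0 t ((hP t).trans ht)
  have hPc := Polynomial.eq_C_of_degree_le_zero hdeg
  have hk : ∀ t : ℂ, φ (e' + t • e) = P.coeff 0 := fun t => by rw [hP, hPc]; simp
  have h1 : ∀ s t : ℂ, s ≠ 0 → φ (s • e' + t • e) = P.coeff 0 * s ^ D := by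
    intro s t hs
    have : s • e' + t • e = s • (e' + (s⁻¹ * t) • e) := by
      rw [smul_add, smul_smul, mul_inv_cancel_left₀ hs]
    rw [this, h.1, hk, mul_comm]
  refine ⟨P.coeff 0, by rw [← hk 0]; exact h0 0, fun s t => ?_⟩
  by_cases hs : s = 0
  · subst hs
    obtain ⟨Q, hQ⟩ := h.2 (t • e) e'
    have := poly_zero (P := Q) (Q := Polynomial.C (P.coeff 0) * Polynomial.X ^ D) (fun s hs => by
      rw [← hQ, add_comm, h1 s t hs]; simp)
    rw [← hQ] at this
    rw [add_comm, this]; simp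
  · exact h1 s t hs

lemma wedge_add_right (x y z : ℂ × ℂ) : wedge x (y + z) = wedge x y + wedge x z := by simp [wedge]; ring

lemma noH {d : ℕ} (hd : 2 ≤ d) {a b : Fin (d + 1) → ℂ} (hnz : NZ a b)
    (H : ∀ v : ℂ × ℂ, v ≠ 0 → wedge (Fm a b v) v = 0 → ∀ x, x ≠ 0 → wedge (Fm a b x) v = 0 → wedge x v = 0) : False := by
  have ne_of : ∀ x y : ℂ × ℂ, wedge x y ≠ 0 → x ≠ 0 := fun x y h h' => h (by simp [h', wedge])
  have hz : ∀ x y z : ℂ × ℂ, wedge y z ≠ 0 → wedge x y = 0 → wedge x z = 0 → x = 0 := by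
    intro x y z h h1 h2
    simp only [wedge] at h h1 h2
    ext
    · refine (mul_eq_zero.1 ?_).resolve_left h
      linear_combination y.1 * h2 - z.1 * h1
    · refine (mul_eq_zero.1 ?_).resolve_left h
      linear_combination y.2 * h2 - z.2 * h1
  obtain ⟨e, he0, he⟩ : ∃ e : ℂ × ℂ, e ≠ 0 ∧ wedge (Fm a b e) e = 0 := by
    by_contra! hh
    obtain ⟨k, -, h⟩ := (Fo_fix a b).pure (e' := (0, 1)) (e := (1, 0)) (fun t => hh _ (fun h => by
      simpa using congrArg Prod.snd h))
    have := h 0 1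
    simp only [zero_smul, one_smul, zero_add] at this
    exact hh (1, 0) (by simp) (by rw [this]; simp)
  obtain ⟨f, hf⟩ : ∃ f : ℂ × ℂ, wedge f e ≠ 0 := by
    by_contra! hh
    apply he0
    ext
    · simpa [wedge] using hh (0, 1)
    · simpa [wedge] using hh (1, 0)
  have w1 : ∀ (f : ℂ × ℂ) (t : ℂ), wedge (f + t • e) e = wedge f e := fun f t => by simp [wedge]; ring
  have pe : ∀ f : ℂ × ℂ, wedge f e ≠ 0 → ∃ k : ℂ, k ≠ 0 ∧ ∀ s t : ℂ, wedge (Fm a b (s • f + t • e)) e = k * s ^ d := by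
    intro f hf
    refine (Fo_w a b e).pure fun t h => ?_
    have hw : wedge (f + t • e) e ≠ 0 := by rw [w1]; exact hf
    exact hw (H e he0 he _ (ne_of _ _ hw) h)
  obtain ⟨g, hg, hgf⟩ : ∃ g : ℂ × ℂ, wedge g e ≠ 0 ∧ wedge (Fm a b g) g = 0 := by
    by_contra! hh
    obtain ⟨k, hk, h1⟩ := pe f hf
    obtain ⟨k2, hk2, h2⟩ := (Fo_fix a b).pure (e' := f) (e := e) (fun t => hh _ (by rw [w1]; exact hf))
    obtain ⟨Q, hQ⟩ := (Fo_w a b f).2 e f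
    have := poly_zero (P := Q) (Q := Polynomial.C k2 * Polynomial.X ^ d - Polynomial.C k * Polynomial.X ^ (d - 1)) (fun s hs => by
      rw [← hQ, add_comm]
      have h1 := h1 s 1
      have h2 := h2 s 1
      simp only [one_smul] at h1 h2
      rw [wedge_add_right, wedge_smul_right, h1] at h2
      simp only [Polynomial.eval_sub, Polynomial.eval_mul, Polynomial.eval_C, Polynomial.eval_pow, Polynomial.eval_X]
      obtain ⟨m, rfl⟩ : ∃ m, d = m + 1 := ⟨d - 1, by omega⟩
      simp only [Nat.add_sub_cancel]
      apply mul_left_cancel₀ hs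
      rw [pow_succ] at h2 ⊢
      rw [pow_succ] at h2
      linear_combination h2)
    rw [← hQ] at this
    have hd1 : d - 1 ≠ 0 := by omega
    have hd2 : d ≠ 0 := by omega
    simp only [zero_smul, add_zero, Polynomial.eval_sub, Polynomial.eval_mul, Polynomial.eval_C, Polynomial.eval_pow,
      Polynomial.eval_X, zero_pow hd1, zero_pow hd2, mul_zero, sub_zero] at this
    exact hnz e he0 (hz _ _ _ hf this he)
  obtain ⟨k, hk, h1⟩ := pe g hg
  have hg0 := ne_of _ _ hg
  obtain ⟨k', hk', h2⟩ : ∃ k : ℂ, k ≠ 0 ∧ ∀ s t : ℂ, wedge (Fm a b (s • e + t • g)) g = k * s ^ d := by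
    refine (Fo_w a b g).pure fun t h => ?_
    have hw : wedge (e + t • g) g ≠ 0 := by
      have : wedge (e + t • g) g = - wedge g e := by simp [wedge]; ring
      rw [this]; exact neg_ne_zero.2 hg
    exact hw (H g hg0 hgf _ (ne_of _ _ hw) h)
  obtain ⟨t, ht⟩ := IsAlgClosed.exists_pow_nat_eq (-k / k') (n := d - 1) (by omega)
  have ht0 : t ≠ 0 := by
    rintro rfl
    rw [zero_pow (by omega)] at ht
    exact (div_ne_zero (neg_ne_zero.2 hk) hk') ht.symm
  have hζ := Complex.isPrimitiveRoot_exp d (by omega)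
  set ζ := Complex.exp (2 * Real.pi * Complex.I / d)
  have hζ1 : ζ ≠ 1 := hζ.ne_one (by omega)
  have htd : k' * t ^ d + t * k = 0 := by
    obtain ⟨m, rfl⟩ : ∃ m, d = m + 1 := ⟨d - 1, by omega⟩
    simp only [Nat.add_sub_cancel] at ht
    rw [pow_succ, ht]; field_simp; ring
  have hv : ∀ z : ℂ, z ^ d = 1 → wedge (Fm a b (g + (z * t) • e)) (g + t • e) = 0 := by
    intro z hz
    have h1 := h1 1 (z * t)
    have h2 := h2 (z * t) 1
    rw [one_smul] at h1 h2
    rw [add_comm] at h2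
    rw [wedge_add_right, wedge_smul_right, h1, h2, mul_pow, hz]
    linear_combination htd
  have hw : ∀ z : ℂ, g + z • e ≠ 0 := fun z => ne_of _ e (by rw [w1]; exact hg)
  have := H (g + t • e) (hw _) (by simpa using hv 1 (one_pow _)) (g + (ζ * t) • e) (hw _) (hv ζ hζ.pow_eq_one)
  have h3 : t * wedge g e * (1 - ζ) = 0 := by
    rw [← this]; simp [wedge]; ring
  exact mul_ne_zero (mul_ne_zero ht0 hg) (sub_ne_zero.2 hζ1.symm) h3

def toP (v : ℂ × ℂ) (h : v ≠ 0) : P1 := Projectivization.mk ℂ ![v.1, v.2] (vec_ne (by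
  by_contra! hh; exact h (Prod.ext hh.1 hh.2)))

lemma toP_eq {v w : ℂ × ℂ} (hv : v ≠ 0) (hw : w ≠ 0) : toP v hv = toP w hw ↔ wedge v w = 0 := by
  unfold toP
  rw [Projectivization.mk_eq_mk_iff']
  constructor
  · rintro ⟨c, hc⟩
    have h0 := congrFun hc 0
    have h1 := congrFun hc 1
    simp at h0 h1
    simp only [wedge, ← h0, ← h1]; ring
  · intro h
    obtain ⟨c, rfl⟩ := prop_of_wedge hw h
    exact ⟨c, by ext i; fin_cases i <;> simp⟩

lemma exists_toP (x : P1) : ∃ v hv, x = toP v hv := by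
  have h : (x.rep 0, x.rep 1) ≠ (0 : ℂ × ℂ) := by
    intro h
    apply x.rep_nonzero
    ext i
    fin_cases i
    · exact congrArg Prod.fst h
    · exact congrArg Prod.snd h
  refine ⟨(x.rep 0, x.rep 1), h, ?_⟩
  conv_lhs => rw [← x.mk_rep]
  unfold toP
  congr 1
  ext i
  fin_cases i <;> rfl

lemma RM_nz {d : ℕ} (f : RatMap d) : NZ f.a f.b := by
  intro x hx h
  have := f.good ![x.1, x.2] (vec_ne (by by_contra! hh; exact hx (Prod.ext hh.1 hh.2)))
  rcases this with h' | h'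
  · exact h' (congrArg Prod.fst h)
  · exact h' (congrArg Prod.snd h)

lemma toFun_toP {d : ℕ} (f : RatMap d) (v : ℂ × ℂ) (hv : v ≠ 0) :
    f.toFun (toP v hv) = toP (Fm f.a f.b v) (RM_nz f v hv) := by
  obtain ⟨c, hc⟩ := Projectivization.exists_smul_eq_mk_rep ℂ ![v.1, v.2] (vec_ne (by
    by_contra! hh; exact hv (Prod.ext hh.1 hh.2)))
  have hr : (toP v hv).rep = c • ![v.1, v.2] := hc.symm
  have hp : ((toP v hv).rep 0, (toP v hv).rep 1) = (c : ℂ) • v := by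
    rw [hr]; ext <;> simp [Units.smul_def]
  have hne := RM_nz f ((c : ℂ) • v) (smul_ne_zero c.ne_zero hv)
  have hg := f.good (toP v hv).rep (Projectivization.rep_nonzero _)
  have : f.toFun (toP v hv) = toP (Fm f.a f.b ((c : ℂ) • v)) hne := by
    unfold RatMap.toFun ratFun
    rw [dif_pos hg]
    unfold toP
    congr 1
    rw [← hp]
    rfl
  rw [this, toP_eq, Fm_smul, wedge_smul_left, wedge_self, mul_zero]

lemma iter_toP {d : ℕ} (f : RatMap d) (v : ℂ × ℂ) (hv : v ≠ 0) (n : ℕ) :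
    f.toFun^[n] (toP v hv) = toP ((Fm f.a f.b)^[n] v) ((RM_nz f).iter n hv) := by
  induction n with
  | zero => rfl
  | succ n ih =>
    rw [Function.iterate_succ_apply', ih, toFun_toP]
    congr 1
    rw [Function.iterate_succ_apply']

lemma Preper_iff {d : ℕ} (f : RatMap d) (v : ℂ × ℂ) (hv : v ≠ 0) : toP v hv ∈ Preper f ↔ PP f.a f.b v := by
  unfold Preper PP
  simp only [Set.mem_ofPred_eq, iter_toP, toP_eq]
  exact exists_comm

lemma Preper_sub {d e : ℕ} (hd : 2 ≤ d) (he : 2 ≤ e) (f : RatMap d) (g : RatMap e)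
    (h : (Preper f ∩ Preper g).Infinite) : Preper f ⊆ Preper g := by
  intro y hy
  obtain ⟨v, hv, rfl⟩ := exists_toP y
  rw [Preper_iff] at hy ⊢
  refine C_contra hd he (RM_nz f) (RM_nz g) hv hy fun J => ?_
  let em := h.natEmbedding
  choose w hw hwe using exists_toP
  have hme : ∀ i, (em i : P1) ∈ Preper f ∩ Preper g := fun i => (em i).2
  refine ⟨fun i => w (em i), fun i => hw _, fun i j hij hh => ?_, fun i => ?_, fun i => ?_⟩
  · rw [← toP_eq (hw _) (hw _), ← hwe, ← hwe] at hh
    exact hij (Fin.ext (em.injective (Subtype.ext hh)))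
  · have := (hme i).1
    rw [hwe (em i), Preper_iff] at this; exact this
  · have := (hme i).2
    rw [hwe (em i), Preper_iff] at this; exact this

lemma Preper_inf {d : ℕ} (hd : 2 ≤ d) (f : RatMap d) : (Preper f).Infinite := by
  intro hfin
  refine noH hd (RM_nz f) fun v hv hfix x hx hxv => ?_
  have hback : ∀ z, f.toFun z ∈ Preper f → z ∈ Preper f := by
    rintro z ⟨n, m, h, hh⟩
    exact ⟨n + 1, m + 1, by omega, hh⟩
  have hsurj : Set.SurjOn f.toFun (Preper f) (Preper f) := by
    intro z hz
    obtain ⟨w, hw, rfl⟩ := exists_toP z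
    obtain ⟨x, hx, h⟩ := exists_zero_form (by omega) (fun j => f.a j * w.2 - f.b j * w.1)
    rw [← wedge_Fm] at h
    have : f.toFun (toP x hx) = toP w hw := by rw [toFun_toP, toP_eq]; exact h
    exact ⟨toP x hx, hback _ (this ▸ hz), this⟩
  have hmaps : Set.MapsTo f.toFun (Preper f) (Preper f) := by
    rintro z ⟨n, m, h, hh⟩
    refine ⟨n, m, h, ?_⟩
    rw [← Function.iterate_succ_apply, ← Function.iterate_succ_apply, Function.iterate_succ_apply',
      Function.iterate_succ_apply', hh]
  have hinj : Set.InjOn f.toFun (Preper f) := by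
    have : Finite (Preper f) := hfin
    have h1 : Function.Surjective (hmaps.restrict f.toFun _ _) := (Set.MapsTo.restrict_surjective_iff hmaps).2 hsurj
    exact (Set.MapsTo.restrict_inj hmaps).1 (Finite.injective_iff_surjective.2 h1)
  have e1 : f.toFun (toP v hv) = toP v hv := by rw [toFun_toP, toP_eq]; exact hfix
  have e2 : f.toFun (toP x hx) = toP v hv := by rw [toFun_toP, toP_eq]; exact hxv
  have m1 : toP v hv ∈ Preper f := ⟨1, 0, by omega, e1⟩
  have m2 : toP x hx ∈ Preper f := hback _ (e2 ▸ m1)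
  have := hinj m2 m1 (e2.trans e1.symm)
  rwa [toP_eq] at this

end BD

theorem statement4 {d e : ℕ} (hd : 2 ≤ d) (he : 2 ≤ e) (f : RatMap d) (g : RatMap e) :
    (Preper f ∩ Preper g).Infinite ↔ Preper f = Preper g := by
  constructor
  · intro h
    exact (BD.Preper_sub hd he f g h).antisymm (BD.Preper_sub he hd g f (by rwa [Set.inter_comm]))
  · intro h
    rw [← h, Set.inter_self]
    exact BD.Preper_inf hd f
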